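/- Let G = {K_{i+1}}_{i∈ℕ} and S(1) = {S_i(1)}_{i∈ℕ} with S_i(1) = {d_{Θ[i,1]}} the singleton prime-distance coloring. For fixed t ∈ ℕ, define the Ramsey symbol (X(t),C(t)) by X_i(t) = {(P_t)_j}_{0<j<i}, a family of copies of the path graph P_t with t edges indexed by gaps j with 0 < j < i, and C_i(t) = {j_{(P_t)_j}}_{0<j<i}, the constant coloring with value j on the j-th copy. Then the Ramsey number R_{(G,S(1))}(X(t),C(t)) exists for every t ∈ ℕ. -/

import Mathlib

namespace RamseyGen

open SimpleGraph

/-- A copy of the finite undirected graph `X` inside `G`: an injective vertex map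
preserving adjacency.  Such copies correspond exactly to graph isomorphisms from
subgraphs `Y ≤ G` onto `X`, i.e. to the elements `π` of the isomorphism set `G/X`
(a copy is the inverse of the edge map `π : E(Y) → E(X)`).  In particular
`G/X ≠ ∅` iff `Nonempty (Copy X G)`. -/
structure Copy {W V : Type*} (X : SimpleGraph W) (G : SimpleGraph V) where
  toFun : W → V
  injective : Function.Injective toFun
  map_adj : ∀ {a b : W}, X.Adj a b → G.Adj (toFun a) (toFun b)

theorem Copy.edgeMap_mem {W V : Type*} {X : SimpleGraph W} {G : SimpleGraph V}
    (f : Copy X G) (e : X.edgeSet) : e.1.map f.toFun ∈ G.edgeSet := by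
  obtain ⟨e, he⟩ := e
  induction e using Sym2.ind with
  | _ a b =>
    rw [Sym2.map_pair_eq, SimpleGraph.mem_edgeSet]
    exact f.map_adj (X.mem_edgeSet.mp he)

/-- The map on edges induced by a copy (the inverse of the edge map `π ∈ G/X`). -/
def Copy.edgeMap {W V : Type*} {X : SimpleGraph W} {G : SimpleGraph V}
    (f : Copy X G) (e : X.edgeSet) : G.edgeSet :=
  ⟨e.1.map f.toFun, f.edgeMap_mem e⟩

instance {W V : Type*} [Finite W] [Finite V] {X : SimpleGraph W} {G : SimpleGraph V} :
    Finite (Copy X G) :=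
  Finite.of_injective (fun f => f.toFun) fun f g h => by cases f; cases g; simpa using h

/-- `Hits X ψ G ρ` says: there is `π ∈ G/X` with `ρ|_{π⁻¹(X)} = ψ ∘ π`, i.e. the
edge-coloring `ρ` of `G` restricts, on some subgraph of `G` isomorphic to `X`,
to the target coloring `ψ` of `X`. -/
def Hits {W V A : Type*} (X : SimpleGraph W) (ψ : X.edgeSet → A)
    (G : SimpleGraph V) (ρ : G.edgeSet → A) : Prop :=
  ∃ f : Copy X G, ∀ e : X.edgeSet, ρ (f.edgeMap e) = ψ e

/-- A family of graphs indexed by a (strictly well-)ordered set is hereditary if the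
graphs increase, with respect to containment, along the order. -/
def Hereditary {I : Type*} [LT I] {Vtx : I → Type*} (G : ∀ i, SimpleGraph (Vtx i)) : Prop :=
  ∀ a b : I, a < b → Nonempty (Copy (G a) (G b))

/-- The metrical ("prime-distance") edge-coloring of a graph induced by a vertex
labelling `f : V → ℕ`: the edge joining `v` and `w` gets the color `|f v − f w|`. -/
def distColoring {V : Type*} {G : SimpleGraph V} (f : V → ℕ) (e : G.edgeSet) : ℕ :=
  Sym2.lift ⟨fun u v => Nat.dist (f u) (f v), fun u v => Nat.dist_comm (f u) (f v)⟩ e.1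

namespace GreenTao

section Averages

open scoped BigOperators

/-- The average of a real function over a finite type. -/
noncomputable def avg {X : Type*} [Finite X] (f : X → ℝ) : ℝ :=
  letI := Fintype.ofFinite X
  𝔼 x, f x

theorem indicator_le_one_real {X : Type*} (A : Set X) (x : X) : A.indicator (1 : X → ℝ) x ≤ 1 := by
  by_cases h : x ∈ A <;> simp [h]

theorem indicator_nonneg_real {X : Type*} (A : Set X) (x : X) : 0 ≤ A.indicator (1 : X → ℝ) x :=
  Set.indicator_nonneg (fun _ _ => zero_le_one) _

variable {X Y : Type*} [Finite X] [Finite Y]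

theorem avg_eq [Fintype X] (f : X → ℝ) : avg f = 𝔼 x, f x := by
  unfold avg
  congr 1
  exact congrArg (fun i : Fintype X => @Finset.univ X i) (Subsingleton.elim _ _)

theorem avg_eq_sum_div [Fintype X] (f : X → ℝ) : avg f = (∑ x, f x) / Nat.card X := by
  rw [avg_eq, Fintype.expect_eq_sum_div_card, Nat.card_eq_fintype_card]

theorem avg_const [Nonempty X] (c : ℝ) : avg (fun _ : X => c) = c := by
  cases nonempty_fintype X
  rw [avg_eq, Fintype.expect_const]

theorem avg_add (f g : X → ℝ) : avg (fun x => f x + g x) = avg f + avg g := by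
  cases nonempty_fintype X
  simp only [avg_eq, Finset.expect_add_distrib]

theorem avg_sub (f g : X → ℝ) : avg (fun x => f x - g x) = avg f - avg g := by
  cases nonempty_fintype X
  simp only [avg_eq, Finset.expect_sub_distrib]

theorem avg_sum {κ : Type*} (s : Finset κ) (f : κ → X → ℝ) :
    avg (fun x => ∑ i ∈ s, f i x) = ∑ i ∈ s, avg (f i) := by
  cases nonempty_fintype X
  simp only [avg_eq, Finset.expect_sum_comm]

theorem avg_const_mul (c : ℝ) (f : X → ℝ) : avg (fun x => c * f x) = c * avg f := by
  cases nonempty_fintype X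
  simp only [avg_eq, Finset.mul_expect]

theorem avg_mul_const (f : X → ℝ) (c : ℝ) : avg (fun x => f x * c) = avg f * c := by
  cases nonempty_fintype X
  simp only [avg_eq, Finset.expect_mul]

theorem avg_mono {f g : X → ℝ} (h : ∀ x, f x ≤ g x) : avg f ≤ avg g := by
  cases nonempty_fintype X
  simp only [avg_eq]
  exact Finset.expect_le_expect fun x _ => h x

theorem avg_nonneg {f : X → ℝ} (h : ∀ x, 0 ≤ f x) : 0 ≤ avg f := by
  cases nonempty_fintype X
  simp only [avg_eq]
  exact Finset.expect_nonneg fun x _ => h x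

theorem avg_le_of_le [Nonempty X] {f : X → ℝ} {c : ℝ} (h : ∀ x, f x ≤ c) : avg f ≤ c :=
  (avg_mono h).trans_eq (avg_const c)

theorem le_avg_of_le [Nonempty X] {f : X → ℝ} {c : ℝ} (h : ∀ x, c ≤ f x) : c ≤ avg f :=
  (avg_const c).symm.trans_le (avg_mono h)

theorem abs_avg_le (f : X → ℝ) : |avg f| ≤ avg fun x => |f x| := by
  cases nonempty_fintype X
  simp only [avg_eq]
  exact Finset.abs_expect_le _ _

theorem avg_comm (f : X → Y → ℝ) :
    (avg fun x => avg fun y => f x y) = avg fun y => avg fun x => f x y := by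
  cases nonempty_fintype X
  cases nonempty_fintype Y
  simp only [avg_eq, Finset.expect_comm (s := (Finset.univ : Finset X))]

theorem avg_prod (f : X × Y → ℝ) : avg f = avg fun x => avg fun y => f (x, y) := by
  cases nonempty_fintype X
  cases nonempty_fintype Y
  simp only [avg_eq, ← Finset.univ_product_univ, Finset.expect_product]

theorem avg_equiv (e : X ≃ Y) (f : Y → ℝ) : (avg fun x => f (e x)) = avg f := by
  cases nonempty_fintype X
  cases nonempty_fintype Y
  simp only [avg_eq]
  exact Fintype.expect_equiv e _ _ fun _ => rfl

theorem exists_le_of_le_avg {f : X → ℝ} {c : ℝ} [Nonempty X] (h : c ≤ avg f) : ∃ x, c ≤ f x := by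
  by_contra! hc
  cases nonempty_fintype X
  have h1 : avg f < c := by
    rw [avg_eq, ← Fintype.expect_const (ι := X) c]
    exact Finset.expect_lt_expect (fun x _ => (hc x).le)
      ⟨Classical.arbitrary X, Finset.mem_univ _, hc _⟩
  linarith

theorem avg_mul_sq_le (f g : X → ℝ) :
    (avg fun x => f x * g x) ^ 2 ≤ (avg fun x => f x ^ 2) * avg fun x => g x ^ 2 := by
  cases nonempty_fintype X
  simp only [avg_eq]
  exact Finset.expect_mul_sq_le_sq_mul_sq _ _ _

theorem avg_sumArrow {ι κ X : Type*} [Finite ι] [Finite κ] [Finite X] (f : (ι ⊕ κ → X) → ℝ) :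
    avg f = avg fun u : ι → X => avg fun z : κ → X => f (Sum.elim u z) := by
  rw [← avg_equiv (Equiv.sumArrowEquivProdArrow ι κ X).symm f, avg_prod]
  rfl

theorem mul_avg_le_of_injective {i : Y → X} (hi : Function.Injective i) {f : X → ℝ}
    (hf : ∀ x, 0 ≤ f x) :
    (Nat.card Y : ℝ) * (avg fun y => f (i y)) ≤ Nat.card X * avg f := by
  classical
  cases nonempty_fintype X
  cases nonempty_fintype Y
  simp only [avg_eq, Nat.card_eq_fintype_card, Fintype.card_mul_expect]
  rw [← Finset.sum_image (s := Finset.univ) (g := i) (f := f) fun x _ y _ h => hi h]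
  exact Finset.sum_le_sum_of_subset_of_nonneg (Finset.subset_univ _) fun x _ _ => hf x

theorem avg_le_of_injective [Nonempty X] [Nonempty Y] {i : Y → X} (hi : Function.Injective i)
    {f : X → ℝ} {M : ℝ} (hf : ∀ x, f x ≤ M) :
    avg f ≤ (Nat.card Y / Nat.card X : ℝ) * (avg fun y => f (i y)) +
      (1 - (Nat.card Y / Nat.card X : ℝ)) * M := by
  have h := mul_avg_le_of_injective hi (f := fun x => M - f x) fun x => by linarith [hf x]
  rw [avg_sub, avg_sub, avg_const, avg_const] at h
  have hX : (0 : ℝ) < Nat.card X := by exact_mod_cast Nat.card_pos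
  have h2 : (Nat.card Y / Nat.card X : ℝ) * (M - avg fun y => f (i y)) ≤ M - avg f := by
    rw [div_mul_eq_mul_div, div_le_iff₀ hX]
    linarith
  linarith

/-- The density of a subset of a finite type. -/
noncomputable def dens (A : Set X) : ℝ := avg (A.indicator 1)

theorem dens_nonneg (A : Set X) : 0 ≤ dens A :=
  avg_nonneg fun _ => Set.indicator_nonneg (fun _ _ => zero_le_one) _

theorem dens_le_one (A : Set X) : dens A ≤ 1 := by
  cases isEmpty_or_nonempty X
  · cases nonempty_fintype X
    simp [dens, avg_eq]
  · exact avg_le_of_le fun x => indicator_le_one_real A x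

theorem dens_mono {A B : Set X} (h : A ⊆ B) : dens A ≤ dens B :=
  avg_mono fun x => Set.indicator_le_indicator_of_subset h (fun _ => zero_le_one) x

theorem dens_empty : dens (∅ : Set X) = 0 := by
  cases nonempty_fintype X
  simp [dens, avg_eq]

theorem nonempty_of_dens_pos {A : Set X} (h : 0 < dens A) : A.Nonempty := by
  by_contra hA
  rw [Set.not_nonempty_iff_eq_empty] at hA
  rw [hA, dens_empty] at h
  exact h.false

theorem dens_equiv (e : X ≃ Y) (A : Set Y) : dens (e ⁻¹' A) = dens A :=
  avg_equiv e (A.indicator 1)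

theorem dens_sumArrow {ι κ X : Type*} [Finite ι] [Finite κ] [Finite X] (A : Set (ι ⊕ κ → X)) :
    dens A = avg fun u : ι → X => dens {z : κ → X | Sum.elim u z ∈ A} :=
  avg_sumArrow _

theorem avg_dens_comm (A : X → Set Y) :
    (avg fun x => dens (A x)) = avg fun y => dens {x | y ∈ A x} :=
  avg_comm _

end Averages

section Words

variable {ι α β η ζ : Type}

/-- Replace the wildcard of a word by the letter `a`. -/
def fill (x : ι → Option α) (a : α) : ι → α := fun i => (x i).getD a

/-- Evaluate the subspace word `V` at `y`, its constant letters being transported by `f`. -/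
def sev (f : α → β) (V : ι → α ⊕ η) (y : η → β) : ι → β := fun i => Sum.elim f y (V i)

/-- Every parameter of the subspace word occurs. -/
def IsSubspace (V : ι → α ⊕ η) : Prop := ∀ e, ∃ i, V i = Sum.inr e

/-- The subspace of the subspace `V` described by `W`. -/
def compWord (V : ι → α ⊕ η) (W : η → α ⊕ ζ) : ι → α ⊕ ζ := fun i => Sum.elim Sum.inl W (V i)

theorem isSubspace_compWord {V : ι → α ⊕ η} {W : η → α ⊕ ζ} (hV : IsSubspace V)
    (hW : IsSubspace W) : IsSubspace (compWord V W) := fun e => by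
  obtain ⟨j, hj⟩ := hW e
  obtain ⟨i, hi⟩ := hV j
  exact ⟨i, by simp [compWord, hi, hj]⟩

theorem sev_compWord (f : α → β) (V : ι → α ⊕ η) (W : η → α ⊕ ζ) (y : ζ → β) :
    sev f (compWord V W) y = sev f V (sev f W y) := by
  funext i
  unfold sev compWord
  rcases V i with a | e <;> simp

theorem fill_sev_some (V : ι → α ⊕ η) (x : η → Option α) (a : α) :
    fill (sev some V x) a = sev id V (fill x a) := by
  funext i
  unfold fill sev
  rcases V i with b | e <;> simp

theorem sev_injective {f : α → β} {V : ι → α ⊕ η} (hV : IsSubspace V) :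
    Function.Injective (sev f V) := fun y y' h => by
  funext e
  obtain ⟨i, hi⟩ := hV e
  simpa [sev, hi] using congrFun h i

/-- The density Hales–Jewett property of the alphabet `α` at density `δ`. -/
def DHJ (α : Type) [Finite α] (δ : ℝ) : Prop :=
  ∃ (ι : Type) (_ : Finite ι), ∀ A : Set (ι → α), δ ≤ dens A →
    ∃ x : ι → Option α, (∃ i, x i = none) ∧ ∀ a, fill x a ∈ A

variable [Finite α] [Finite β]

theorem DHJ.mono {δ δ' : ℝ} (h : DHJ α δ) (hδ : δ ≤ δ') : DHJ α δ' := by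
  obtain ⟨ι, hι, h⟩ := h
  exact ⟨ι, hι, fun A hA => h A (hδ.trans hA)⟩

theorem DHJ.of_equiv (e : α ≃ β) {δ : ℝ} (h : DHJ α δ) : DHJ β δ := by
  obtain ⟨ι, hι, h⟩ := h
  refine ⟨ι, hι, fun A hA => ?_⟩
  obtain ⟨x, ⟨i, hi⟩, hx⟩ := h ((Equiv.arrowCongr (Equiv.refl ι) e) ⁻¹' A)
    (by rwa [dens_equiv])
  refine ⟨fun i => (x i).map e, ⟨i, by simp [hi]⟩, fun b => ?_⟩
  have hb : Equiv.arrowCongr (Equiv.refl ι) e (fill x (e.symm b)) ∈ A := hx (e.symm b)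
  convert hb using 1
  funext j
  simp only [fill, Equiv.arrowCongr_apply, Equiv.refl_symm, Equiv.coe_refl, Function.comp_apply, id]
  cases x j <;> simp

theorem DHJ.of_isEmpty [IsEmpty α] {δ : ℝ} (hδ : 0 < δ) : DHJ α δ := by
  refine ⟨Unit, inferInstance, fun A hA => ?_⟩
  obtain ⟨w, -⟩ := nonempty_of_dens_pos (hδ.trans_le hA)
  exact isEmptyElim (w ())

theorem DHJ.of_subsingleton [Subsingleton α] {δ : ℝ} (hδ : 0 < δ) : DHJ α δ := by
  refine ⟨Unit, inferInstance, fun A hA => ?_⟩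
  obtain ⟨w, hw⟩ := nonempty_of_dens_pos (hδ.trans_le hA)
  exact ⟨fun _ => none, ⟨(), rfl⟩, fun a => by rwa [Subsingleton.elim (fill _ a) w]⟩

/-- Probabilistic form of the density Hales–Jewett property. -/
theorem DHJ.exists_line_dens {δ : ℝ} (hδ : 0 < δ) (h : DHJ α (δ / 2)) :
    ∃ (ι : Type) (_ : Finite ι) (θ : ℝ), 0 < θ ∧ ∀ (Ω : Type) [Finite Ω] [Nonempty Ω]
      (B : (ι → α) → Set Ω), δ ≤ (avg fun w => dens (B w)) →
      ∃ x : ι → Option α, (∃ i, x i = none) ∧ θ ≤ dens {ω | ∀ a, ω ∈ B (fill x a)} := by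
  obtain ⟨ι, hι, h⟩ := h
  have hL : (0 : ℝ) < Nat.card (ι → Option α) := by exact_mod_cast Nat.card_pos
  refine ⟨ι, hι, δ / (4 * Nat.card (ι → Option α)), by positivity, fun Ω _ _ B hB => ?_⟩
  by_contra! hc
  classical
  cases nonempty_fintype (ι → Option α)
  set s : Finset (ι → Option α) := Finset.univ.filter fun x => ∃ i, x i = none
  have key : ∀ ω, dens {w | ω ∈ B w} ≤
      δ / 2 + ∑ x ∈ s, {ω | ∀ a, ω ∈ B (fill x a)}.indicator (1 : Ω → ℝ) ω := by
    intro ω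
    have hnn : ∀ x ∈ s, 0 ≤ {ω | ∀ a, ω ∈ B (fill x a)}.indicator (1 : Ω → ℝ) ω :=
      fun x _ => indicator_nonneg_real _ _
    by_cases hω : δ / 2 ≤ dens {w | ω ∈ B w}
    · obtain ⟨x, hx, hxa⟩ := h _ hω
      have h1 := Finset.single_le_sum hnn (show x ∈ s by simpa [s] using hx)
      rw [Set.indicator_of_mem (show ω ∈ {ω | ∀ a, ω ∈ B (fill x a)} from hxa)] at h1
      have := dens_le_one {w | ω ∈ B w}
      simp only [Pi.one_apply] at h1
      linarith
    · linarith [Finset.sum_nonneg hnn]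
  rw [avg_dens_comm] at hB
  have h2 := hB.trans (avg_mono key)
  rw [avg_add, avg_const, avg_sum] at h2
  have h3 : ∑ x ∈ s, avg (fun ω => {ω | ∀ a, ω ∈ B (fill x a)}.indicator (1 : Ω → ℝ) ω) ≤
      ∑ x ∈ s, δ / (4 * Nat.card (ι → Option α)) :=
    Finset.sum_le_sum fun x hx => (hc x (by simpa [s] using hx)).le
  rw [Finset.sum_const, nsmul_eq_mul] at h3
  have h4 : (s.card : ℝ) ≤ Nat.card (ι → Option α) := by
    rw [Nat.card_eq_fintype_card]
    exact_mod_cast Finset.card_le_univ s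
  have h5 : (s.card : ℝ) * (δ / (4 * Nat.card (ι → Option α))) ≤ δ / 4 :=
    (mul_le_mul_of_nonneg_right h4 (by positivity)).trans_eq (by field_simp)
  change δ ≤ δ / 2 + ∑ x ∈ s, avg _ at h2
  linarith

/-- Multidimensional density Hales–Jewett. -/
theorem exists_subspace_of_dens (h : ∀ δ : ℝ, 0 < δ → DHJ α δ) (η : Type) [Finite η] :
    ∀ δ : ℝ, 0 < δ → ∃ (ι : Type) (_ : Finite ι), ∀ A : Set (ι → α), δ ≤ dens A →
      ∃ V : ι → α ⊕ η, IsSubspace V ∧ ∀ y, sev id V y ∈ A := by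
  cases isEmpty_or_nonempty α
  · intro δ hδ
    refine ⟨Unit, inferInstance, fun A hA => ?_⟩
    obtain ⟨w, -⟩ := nonempty_of_dens_pos (hδ.trans_le hA)
    exact isEmptyElim (w ())
  refine Finite.induction_empty_option (P := fun η => ∀ δ : ℝ, 0 < δ → ∃ (ι : Type) (_ : Finite ι),
    ∀ A : Set (ι → α), δ ≤ dens A → ∃ V : ι → α ⊕ η, IsSubspace V ∧ ∀ y, sev id V y ∈ A)
    ?_ ?_ ?_ η
  · intro η η' e ih δ hδ
    obtain ⟨ι, hι, ih⟩ := ih δ hδ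
    refine ⟨ι, hι, fun A hA => ?_⟩
    obtain ⟨V, hV, hVA⟩ := ih A hA
    refine ⟨fun i => (V i).map id e, fun e' => ?_, fun y => ?_⟩
    · obtain ⟨i, hi⟩ := hV (e.symm e')
      exact ⟨i, by simp [hi]⟩
    · convert hVA (y ∘ e) using 1
      funext i
      simp only [sev]
      cases V i <;> simp
  · intro δ hδ
    refine ⟨Unit, inferInstance, fun A hA => ?_⟩
    obtain ⟨w, hw⟩ := nonempty_of_dens_pos (hδ.trans_le hA)
    exact ⟨fun i => Sum.inl (w i), fun e => e.elim, fun y => hw⟩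
  · intro η _ ih δ hδ
    obtain ⟨ι₁, _, θ, hθ, h1⟩ := (h (δ / 2) (by linarith)).exists_line_dens hδ
    obtain ⟨ι₂, _, h2⟩ := ih θ hθ
    refine ⟨ι₁ ⊕ ι₂, inferInstance, fun A hA => ?_⟩
    rw [dens_sumArrow] at hA
    obtain ⟨x, ⟨i, hi⟩, hx⟩ := h1 (ι₂ → α) (fun w => {z | Sum.elim w z ∈ A}) hA
    obtain ⟨V, hV, hVA⟩ := h2 _ hx
    refine ⟨Sum.elim (fun i => (x i).elim (Sum.inr none) Sum.inl)
      (fun i => (V i).map id some), ?_, fun y => ?_⟩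
    · rintro (_ | e)
      · exact ⟨Sum.inl i, by simp [hi]⟩
      · obtain ⟨j, hj⟩ := hV e
        exact ⟨Sum.inr j, by simp [hj]⟩
    · have hy : Sum.elim (fill x (y none)) (sev id V fun e => y (some e)) ∈ A :=
        hVA (fun e => y (some e)) (y none)
      convert hy using 1
      funext j
      rcases j with j | j
      · simp only [sev, Sum.elim_inl, fill]
        cases x j <;> simp
      · simp only [sev, Sum.elim_inr]
        cases V j <;> simp

end Words

section GrahamRothschild

variable {ι α κ η : Type}

theorem exists_mono_subspace (α κ η : Type) [Finite α] [Finite κ] [Finite η] :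
    ∃ (ι : Type) (_ : Finite ι), ∀ c : (ι → α) → κ, ∃ V : ι → α ⊕ η, IsSubspace V ∧
      ∃ k, ∀ y, c (sev id V y) = k := by
  obtain ⟨ι, hι, h⟩ := Combinatorics.Subspace.exists_mono_in_high_dimension α κ η
  refine ⟨ι, inferInstance, fun c => ?_⟩
  obtain ⟨l, k, hl⟩ := h c
  exact ⟨l.idxFun, l.proper, k, hl⟩

/-- A coloring of words is prefix-determined if words containing a wildcard are colored
according to the part before some wildcard. -/
def PrefixDet {m : ℕ} (f : (Fin m → Option α) → κ) : Prop :=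
  ∀ j x x', (∀ i < j, x i = x' i) → x j = none → x' j = none → f x = f x'

theorem exists_prefixDet [Finite α] (m : ℕ) : ∀ (κ : Type) [Finite κ],
    ∃ (ι : Type) (_ : Finite ι), ∀ c : (ι → Option α) → κ, ∃ V : ι → α ⊕ Fin m,
      IsSubspace V ∧ PrefixDet fun x => c (sev some V x) := by
  induction m with
  | zero =>
    intro κ _
    exact ⟨Empty, inferInstance, fun c => ⟨fun i => i.elim, fun e => e.elim0, fun j => j.elim0⟩⟩
  | succ m ih =>
    intro κ _
    obtain ⟨ι', _, h1⟩ := ih (α → κ)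
    obtain ⟨ι₂, _, h2⟩ := exists_mono_subspace (Option α) κ ι'
    refine ⟨Option ι₂, inferInstance, fun c => ?_⟩
    obtain ⟨U, hU, k, hk⟩ := h2 fun y => c fun i => i.elim none y
    obtain ⟨V, hV, hpd⟩ := h1 fun y a => c fun i => i.elim (some a)
      (sev (fun o : Option α => o.elim (some a) some) U y)
    refine ⟨fun i => i.elim (Sum.inr 0) fun i => Sum.elim
      (fun o : Option α => o.elim (Sum.inr 0) Sum.inl) (fun e => (V e).map id Fin.succ) (U i),
      ?_, ?_⟩
    · intro j
      refine Fin.cases ⟨none, rfl⟩ (fun j => ?_) j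
      obtain ⟨e, he⟩ := hV j
      obtain ⟨i, hi⟩ := hU e
      exact ⟨some i, by simp [hi, he]⟩
    · have key : ∀ x : Fin (m + 1) → Option α, (sev some (fun i : Option ι₂ => i.elim (Sum.inr 0)
          fun i => Sum.elim (fun o : Option α => o.elim (Sum.inr 0) Sum.inl)
          (fun e => (V e).map id Fin.succ) (U i)) x) =
          fun i => i.elim (x 0) (sev (fun o : Option α => o.elim (x 0) some) U
            (sev some V fun j => x j.succ)) := by
        intro x
        funext i
        rcases i with _ | i
        · simp [sev]
        · simp only [sev, Option.elim_some]
          rcases U i with (_ | a) | e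
          · simp
          · simp
          · simp only [Sum.elim_inr, sev]
            rcases V e with a | j <;> simp
      have key0 : ∀ x : Fin (m + 1) → Option α, x 0 = none → c (sev some (fun i : Option ι₂ =>
          i.elim (Sum.inr 0) fun i => Sum.elim (fun o : Option α => o.elim (Sum.inr 0) Sum.inl)
          (fun e => (V e).map id Fin.succ) (U i)) x) = k := by
        intro x hx
        rw [key, hx, ← hk (sev some V fun j => x j.succ)]
        congr 2
        funext i
        congr 1
        funext i
        unfold sev
        rcases U i with (_ | a) | e <;> rfl
      intro j x x' hxx hx hx'
      dsimp only
      by_cases h0 : x 0 = none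
      · have h0' : x' 0 = none := by
          by_cases hj : j = 0
          · rwa [hj] at hx'
          · rw [← hxx 0 (Fin.pos_of_ne_zero hj), h0]
        rw [key0 x h0, key0 x' h0']
      · obtain ⟨a, ha⟩ := Option.ne_none_iff_exists'.1 h0
        have hj : j ≠ 0 := fun hj => h0 (hj ▸ hx)
        have ha' : x' 0 = some a := by rw [← hxx 0 (Fin.pos_of_ne_zero hj), ha]
        obtain ⟨j, rfl⟩ := Fin.exists_succ_eq.2 hj
        rw [key, key, ha, ha']
        exact congrFun (hpd j (fun j => x j.succ) (fun j => x' j.succ)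
          (fun i hi => hxx _ (Fin.succ_lt_succ_iff.2 hi)) hx hx') a

theorem exists_first_none_det [Finite α] [Nonempty α] (m : ℕ) : ∀ (κ : Type) [Finite κ],
    ∃ n : ℕ, ∀ c : (Fin n → Option α) → κ, PrefixDet c → ∃ V : Fin n → α ⊕ Fin m,
      IsSubspace V ∧ ∃ g : Fin m → κ, ∀ x j, (∀ i < j, x i ≠ none) → x j = none →
        c (sev some V x) = g j := by
  induction m with
  | zero =>
    intro κ _
    refine ⟨0, fun c _ => ⟨fun i => i.elim0, fun e => e.elim0, fun j => j.elim0, fun _ j => j.elim0⟩⟩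
  | succ m ih =>
    intro κ _
    obtain ⟨b, hb⟩ := Combinatorics.Subspace.exists_mono_in_high_dimension_fin α (Fin m → κ) Unit
    obtain ⟨n, hn⟩ := ih ((Fin b → α) → κ)
    refine ⟨b + n, fun c hc => ?_⟩
    obtain ⟨V, hV, g, hg⟩ := hn (fun y u => c (Fin.append (fun i => some (u i)) y)) (by
      intro j x x' hxx hx hx'
      funext u
      refine hc (Fin.natAdd b j) _ _ (fun i hi => ?_) (by simpa using hx) (by simpa using hx')
      refine Fin.addCases (fun i _ => ?_) (fun i hi => ?_) i hi
      · simp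
      · simpa using hxx i (by simpa using hi))
    obtain ⟨l, k, hl⟩ := hb fun u i => g i u
    obtain ⟨p, hp⟩ := l.proper ()
    let W : Fin (b + n) → α ⊕ Fin (m + 1) := Fin.append
      (fun i => (l.idxFun i).map id fun _ => 0) (fun i => (V i).map id Fin.succ)
    have hW : ∀ x : Fin (m + 1) → Option α, sev some W x =
        Fin.append (sev some l.idxFun fun _ => x 0) (sev some V fun j => x j.succ) := by
      intro x
      funext i
      refine Fin.addCases (fun i => ?_) (fun i => ?_) i
      · simp only [sev, W, Fin.append_left]
        cases l.idxFun i <;> simp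
      · simp only [sev, W, Fin.append_right]
        cases V i <;> simp
    have hW0 : ∀ x x' : Fin (m + 1) → Option α, x 0 = none → x' 0 = none →
        c (sev some W x) = c (sev some W x') := by
      intro x x' hx hx'
      rw [hW, hW, hx, hx']
      refine hc (Fin.castAdd n p) _ _ (fun i hi => ?_) ?_ ?_
      · refine Fin.addCases (fun i _ => ?_) (fun i hi => ?_) i hi
        · simp
        · simp only [Fin.lt_def, Fin.val_natAdd, Fin.val_castAdd] at hi
          omega
      · simp [sev, hp]
      · simp [sev, hp]
    refine ⟨W, fun e => ?_, Fin.cons (c (sev some W fun _ => none)) k, fun x j => ?_⟩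
    · refine Fin.cases ⟨Fin.castAdd n p, by simp [W, hp]⟩ (fun j => ?_) e
      obtain ⟨i, hi⟩ := hV j
      exact ⟨Fin.natAdd b i, by simp [W, hi]⟩
    · refine Fin.cases (fun _ hx => ?_) (fun j hj hx => ?_) j
      · exact hW0 _ _ hx rfl
      · obtain ⟨a, ha⟩ := Option.ne_none_iff_exists'.1 (hj 0 (Fin.succ_pos j))
        have h1 := congrFun (hg (fun j => x j.succ) j
          (fun i hi => hj _ (Fin.succ_lt_succ_iff.2 hi)) hx) (l fun _ => a)
        rw [hW, ha, Fin.cons_succ, ← congrFun (hl fun _ => a) j]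
        refine Eq.trans ?_ h1
        congr 2
        funext i
        simp only [sev, Combinatorics.Subspace.apply_def]
        cases l.idxFun i <;> rfl

/-- The Graham–Rothschild theorem for words containing a wildcard. -/
theorem exists_subspace_mono_lines (α κ η : Type) [Finite α] [Nonempty α] [Finite κ] [Finite η] :
    ∃ (ι : Type) (_ : Finite ι), ∀ c : (ι → Option α) → κ, ∃ V : ι → α ⊕ η,
      IsSubspace V ∧ ∃ k, ∀ x : η → Option α, (∃ i, x i = none) → c (sev some V x) = k := by
  classical
  cases nonempty_fintype κ
  obtain ⟨n, hn⟩ := exists_first_none_det (α := α) (Fintype.card κ * Nat.card η + 1) κ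
  obtain ⟨ι, hι, h⟩ := exists_prefixDet (α := α) n κ
  refine ⟨ι, hι, fun c => ?_⟩
  obtain ⟨V₁, hV₁, hpd⟩ := h c
  obtain ⟨V₂, hV₂, g, hg⟩ := hn _ hpd
  obtain ⟨k, hk⟩ := Fintype.exists_lt_card_fiber_of_mul_lt_card g (n := Nat.card η)
    (by simp)
  cases nonempty_fintype η
  obtain ⟨e⟩ : Nonempty (η ↪ {i // g i = k}) := by
    refine Function.Embedding.nonempty_of_card_le ?_
    rw [Fintype.card_subtype, ← Nat.card_eq_fintype_card]
    exact hk.le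
  let a₀ : α := Classical.arbitrary α
  let V₃ : Fin (Fintype.card κ * Nat.card η + 1) → α ⊕ η := fun i =>
    if h : ∃ j, (e j : Fin _) = i then Sum.inr h.choose else Sum.inl a₀
  have hV₃ : ∀ j, V₃ (e j) = Sum.inr j := by
    intro j
    have hj : ∃ j', (e j' : Fin (Fintype.card κ * Nat.card η + 1)) = e j := ⟨j, rfl⟩
    simp only [V₃, hj, dif_pos]
    exact congrArg _ (e.injective (Subtype.ext hj.choose_spec))
  refine ⟨compWord V₁ (compWord V₂ V₃), isSubspace_compWord hV₁ (isSubspace_compWord hV₂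
    fun j => ⟨_, hV₃ j⟩), k, fun x ⟨j, hj⟩ => ?_⟩
  rw [sev_compWord, sev_compWord]
  have hex : ∃ i, sev some V₃ x i = none := ⟨e j, by simp [sev, hV₃, hj]⟩
  set s : Finset (Fin (Fintype.card κ * Nat.card η + 1)) :=
    Finset.univ.filter fun i => sev some V₃ x i = none
  have hs : s.Nonempty := by
    obtain ⟨i, hi⟩ := hex
    exact ⟨i, by simp [s, hi]⟩
  have hp : sev some V₃ x (s.min' hs) = none := by
    have := s.min'_mem hs
    simpa [s] using this
  rw [hg _ (s.min' hs) (fun i hi hin => ?_) hp]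
  · by_contra hgk
    simp only [sev, V₃] at hp
    split_ifs at hp with hr
    · obtain ⟨j', hj'⟩ := hr
      exact hgk (hj' ▸ (e j').2)
    · simp at hp
  · exact (s.min'_le i (by simp [s, hin])).not_gt hi

/-- Lifting of the probabilistic density Hales–Jewett property to all lines of a subspace. -/
theorem exists_subspace_forall_lines_dens [Finite α] [Nonempty α]
    (h : ∀ δ : ℝ, 0 < δ → DHJ α δ) {δ : ℝ} (hδ : 0 < δ) :
    ∃ θ : ℝ, 0 < θ ∧ ∀ (η : Type) [Finite η], ∃ (ι : Type) (_ : Finite ι),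
      ∀ (Ω : Type) [Finite Ω] [Nonempty Ω] (D : (ι → α) → Set Ω), (∀ w, δ ≤ dens (D w)) →
      ∃ V : ι → α ⊕ η, IsSubspace V ∧ ∀ x : η → Option α, (∃ i, x i = none) →
        θ ≤ dens {ω | ∀ a, ω ∈ D (fill (sev some V x) a)} := by
  obtain ⟨ι', _, θ, hθ, h1⟩ := (h (δ / 2) (by linarith)).exists_line_dens hδ
  refine ⟨θ, hθ, fun η _ => ?_⟩
  obtain ⟨ι, hι, h2⟩ := exists_subspace_mono_lines α Prop (η ⊕ ι')
  refine ⟨ι, hι, fun Ω _ _ D hD => ?_⟩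
  obtain ⟨V, hV, k, hk⟩ := h2 fun x => θ ≤ dens {ω | ∀ a, ω ∈ D (fill x a)}
  let a₀ : α := Classical.arbitrary α
  have hkt : k := by
    obtain ⟨x, ⟨i, hi⟩, hx⟩ := h1 Ω (fun u => D (sev id V (Sum.elim (fun _ => a₀) u)))
      (le_avg_of_le fun u => hD _)
    rw [← hk (Sum.elim (fun _ => some a₀) x) ⟨Sum.inr i, hi⟩]
    convert hx using 7 with ω a
    rw [fill_sev_some]
    congr 1
    funext j
    rcases j with j | j <;> simp [fill]
  refine ⟨compWord V (Sum.elim Sum.inr fun _ => Sum.inl a₀), isSubspace_compWord hV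
    fun e => ⟨Sum.inl e, rfl⟩, fun x ⟨i, hi⟩ => ?_⟩
  have := hk (sev some (Sum.elim Sum.inr fun _ => Sum.inl a₀) x) ⟨Sum.inl i, hi⟩
  rw [sev_compWord]
  exact this.symm ▸ hkt

end GrahamRothschild

section Insensitive

variable {ι α η ζ : Type}

/-- A set of words is insensitive if identifying the wildcard with the letter `a` does not
change membership. -/
def Insens (a : α) (E : Set (η → Option α)) : Prop :=
  ∀ x x', fill x a = fill x' a → x ∈ E → x' ∈ E

theorem insens_univ (a : α) : Insens a (Set.univ : Set (η → Option α)) :=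
  fun _ _ _ _ => trivial

theorem Insens.compl {a : α} {E : Set (η → Option α)} (h : Insens a E) : Insens a Eᶜ :=
  fun x x' hx hE hE' => hE (h x' x hx.symm hE')

theorem fill_sumElim {κ : Type} (u : ι → Option α) (z : κ → Option α) (a : α) :
    fill (Sum.elim u z) a = Sum.elim (fill u a) (fill z a) := by
  funext i
  rcases i with i | i <;> rfl

theorem Insens.section_left {κ : Type} {a : α} {E : Set (ι ⊕ κ → Option α)} (h : Insens a E)
    (z : κ → Option α) : Insens a {u | Sum.elim u z ∈ E} :=
  fun x x' hx => h _ _ (by rw [fill_sumElim, fill_sumElim, hx])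

theorem Insens.section_right {κ : Type} {a : α} {E : Set (ι ⊕ κ → Option α)} (h : Insens a E)
    (u : ι → Option α) : Insens a {z | Sum.elim u z ∈ E} :=
  fun x x' hx => h _ _ (by rw [fill_sumElim, fill_sumElim, hx])

theorem fill_sev_congr (a : α) (V : ι → Option α ⊕ η) {y y' : η → Option α}
    (h : fill y a = fill y' a) : fill (sev id V y) a = fill (sev id V y') a := by
  funext i
  simp only [fill, sev]
  rcases V i with b | e
  · rfl
  · exact congrFun h e

theorem Insens.preimage {a : α} {E : Set (ι → Option α)} (h : Insens a E)
    (V : ι → Option α ⊕ η) : Insens a (sev id V ⁻¹' E) :=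
  fun _ _ hx => h _ _ (fill_sev_congr a V hx)

theorem sev_sumElim_const {β κ : Type} (V : ι → β ⊕ η) (z : κ → β) (y : η → β) :
    sev id (Sum.elim V fun i => Sum.inl (z i)) y = Sum.elim (sev id V y) z := by
  funext i
  rcases i with i | i <;> rfl

theorem sev_const_sumElim {β κ : Type} (V : κ → β ⊕ η) (u : ι → β) (y : η → β) :
    sev id (Sum.elim (fun i => Sum.inl (u i)) V) y = Sum.elim u (sev id V y) := by
  funext i
  rcases i with i | i <;> rfl

theorem IsSubspace.sumElim_left {β κ : Type} {V : ι → β ⊕ η} (hV : IsSubspace V)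
    (W : κ → β ⊕ η) : IsSubspace (Sum.elim V W) := fun e =>
  let ⟨i, hi⟩ := hV e
  ⟨Sum.inl i, hi⟩

theorem IsSubspace.sumElim_right {β κ : Type} {V : ι → β ⊕ η} (hV : IsSubspace V)
    (W : κ → β ⊕ η) : IsSubspace (Sum.elim W V) := fun e =>
  let ⟨i, hi⟩ := hV e
  ⟨Sum.inr i, hi⟩

theorem some_comp_injective : Function.Injective fun (w : ι → α) i => some (w i) :=
  fun _ _ h => funext fun i => Option.some_injective _ (congrFun h i)

variable [Finite α] [Nonempty α]

theorem card_words_div_pos (ι : Type) [Finite ι] :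
    (0 : ℝ) < Nat.card (ι → α) / Nat.card (ι → Option α) := by
  have h1 : (0 : ℝ) < Nat.card (ι → α) := by exact_mod_cast Nat.card_pos
  have h2 : (0 : ℝ) < Nat.card (ι → Option α) := by exact_mod_cast Nat.card_pos
  positivity

theorem card_words_div_le_one (ι : Type) [Finite ι] :
    (Nat.card (ι → α) / Nat.card (ι → Option α) : ℝ) ≤ 1 := by
  have h2 : (0 : ℝ) < Nat.card (ι → Option α) := by exact_mod_cast Nat.card_pos
  rw [div_le_one h2]
  exact_mod_cast Nat.card_le_card_of_injective _ some_comp_injective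

/-- Dense insensitive sets contain subspaces. -/
theorem exists_subspace_of_insens (h : ∀ δ : ℝ, 0 < δ → DHJ α δ) (ζ : Type) [Finite ζ] {ε : ℝ}
    (hε : 0 < ε) : ∃ (ι : Type) (_ : Finite ι), ∀ (a : α) (E : Set (ι → Option α)), Insens a E →
      ε ≤ dens E → ∃ V : ι → Option α ⊕ ζ, IsSubspace V ∧ ∀ y, sev id V y ∈ E := by
  obtain ⟨ι', _, h1⟩ := exists_subspace_of_dens h ζ (ε / 2) (by linarith)
  set q : ℝ := Nat.card (ι' → α) / Nat.card (ι' → Option α) with hq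
  have hq0 : 0 < q := card_words_div_pos ι'
  have hq1 : q ≤ 1 := card_words_div_le_one ι'
  have key : ∀ L : ℕ, ∃ (ι : Type) (_ : Finite ι), ∀ (a : α) (E : Set (ι → Option α)),
      Insens a E → (¬ ∃ V : ι → Option α ⊕ ζ, IsSubspace V ∧ ∀ y, sev id V y ∈ E) →
      dens E ≤ (1 - q) ^ L + ε / 2 := by
    intro L
    induction L with
    | zero => exact ⟨Empty, inferInstance, fun a E _ _ => by
        simpa using (dens_le_one E).trans (by linarith)⟩
    | succ L ih =>
      obtain ⟨ι, _, ih⟩ := ih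
      refine ⟨ι' ⊕ ι, inferInstance, fun a E hE hno => ?_⟩
      rw [dens_sumArrow]
      refine (avg_le_of_injective some_comp_injective (M := (1 - q) ^ L + ε / 2)
        fun u => ih a _ (hE.section_right u) ?_).trans ?_
      · rintro ⟨V, hV, hVE⟩
        exact hno ⟨Sum.elim (fun i => Sum.inl (u i)) V, hV.sumElim_right _, fun y => by
          rw [sev_const_sumElim]; exact hVE y⟩
      · have h2 : (avg fun w : ι' → α => dens {z : ι → Option α |
            Sum.elim (fun i => some (w i)) z ∈ E}) ≤ ε / 2 := by
          rw [avg_dens_comm]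
          refine avg_le_of_le fun z => ?_
          by_contra! hz
          obtain ⟨V, hV, hVE⟩ := h1 _ hz.le
          refine hno ⟨Sum.elim (fun i => (V i).map some id) fun i => Sum.inl (z i),
            IsSubspace.sumElim_left (fun e => ?_) _, fun y => ?_⟩
          · obtain ⟨i, hi⟩ := hV e
            exact ⟨i, by simp [hi]⟩
          · rw [sev_sumElim_const]
            refine hE _ _ ?_ (hVE (fill y a))
            rw [fill_sumElim, fill_sumElim]
            congr 1
            funext i
            simp only [fill, sev]
            cases V i <;> rfl
        have h3 := mul_le_mul_of_nonneg_left h2 hq0.le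
        rw [← hq, pow_succ]
        linarith
  obtain ⟨L, hL⟩ := exists_pow_lt_of_lt_one (show 0 < ε / 2 by linarith)
    (show 1 - q < 1 by linarith)
  obtain ⟨ι, hι, h2⟩ := key L
  refine ⟨ι, hι, fun a E hE hdens => ?_⟩
  by_contra hno
  linarith [h2 a E hE hno]

theorem avg_mul_indicator_range {X Y : Type} [Finite X] [Finite Y] {i : Y → X}
    (hi : Function.Injective i) (g : X → ℝ) :
    avg (fun x => g x * (Set.range i).indicator 1 x) =
      (Nat.card Y / Nat.card X : ℝ) * avg fun y => g (i y) := by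
  classical
  cases nonempty_fintype X
  cases nonempty_fintype Y
  have h : ∑ x, g x * (Set.range i).indicator 1 x = ∑ y, g (i y) := by
    rw [← Finset.sum_image (s := Finset.univ) (g := i) (f := g) fun x _ y _ h => hi h]
    rw [← Finset.sum_subset (Finset.subset_univ (Finset.univ.image i))]
    · refine Finset.sum_congr rfl fun x hx => ?_
      rw [Set.indicator_of_mem (by simpa using hx)]
      simp
    · intro x _ hx
      rw [Set.indicator_of_notMem (by simpa using hx), mul_zero]
  rw [avg_eq_sum_div, avg_eq_sum_div, h]
  cases isEmpty_or_nonempty Y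
  · simp
  · have hY : (Nat.card Y : ℝ) ≠ 0 := by exact_mod_cast Nat.card_pos.ne'
    field_simp

/-- A function with nonpositive averages over subspaces has small average over an insensitive
set. -/
theorem exists_avg_insens_le (h : ∀ δ : ℝ, 0 < δ → DHJ α δ) (ζ : Type) [Finite ζ] {ε : ℝ}
    (hε : 0 < ε) : ∃ (η : Type) (_ : Finite η), ∀ (a : α) (E : Set (η → Option α)), Insens a E →
      ∀ g : (η → Option α) → ℝ, (∀ x, g x ≤ 1) →
      (∀ V : η → Option α ⊕ ζ, IsSubspace V → (avg fun y => g (sev id V y)) ≤ 0) →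
      avg (fun x => g x * E.indicator 1 x) ≤ ε := by
  obtain ⟨ι₁, _, h1⟩ := exists_subspace_of_insens h ζ (show 0 < ε / 2 by linarith)
  have hB : (0 : ℝ) < Nat.card (ι₁ → Option α) := by exact_mod_cast Nat.card_pos
  have hB1 : (1 : ℝ) ≤ Nat.card (ι₁ → Option α) := by exact_mod_cast Nat.card_pos
  set c : ℝ := 1 / Nat.card (ι₁ → Option α) with hc
  have hc0 : 0 < c := by positivity
  have hc1 : c ≤ 1 := by rw [hc, div_le_one hB]; exact hB1
  have key : ∀ t : ℕ, ∃ (η : Type) (_ : Finite η), ∀ (a : α) (E : Set (η → Option α)),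
      Insens a E → ∀ g : (η → Option α) → ℝ, (∀ x, g x ≤ 1) →
      (∀ V : η → Option α ⊕ ζ, IsSubspace V → (avg fun y => g (sev id V y)) ≤ 0) →
      avg (fun x => g x * E.indicator 1 x) ≤ ε / 2 + (1 - c) ^ t * (dens E - ε / 2) := by
    intro t
    induction t with
    | zero =>
      refine ⟨Empty, inferInstance, fun a E _ g hg _ => ?_⟩
      rw [pow_zero, one_mul, add_sub_cancel]
      exact avg_mono fun x => by nlinarith [hg x, indicator_nonneg_real E x]
    | succ t ih =>
      obtain ⟨η, _, ih⟩ := ih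
      refine ⟨ι₁ ⊕ η, inferInstance, fun a E hE g hg hV => ?_⟩
      classical
      let rich : Set (Set (ι₁ → Option α)) :=
        {S | ∃ V : ι₁ → Option α ⊕ ζ, IsSubspace V ∧ ∀ y, sev id V y ∈ S}
      let F : Set (ι₁ → Option α) → Set (ι₁ → Option α) := fun S =>
        if hS : S ∈ rich then Set.range (sev id hS.choose) else ∅
      let sec : (η → Option α) → Set (ι₁ → Option α) := fun z => {u | Sum.elim u z ∈ E}
      let E' : Set (ι₁ ⊕ η → Option α) :=
        {x | x ∈ E ∧ (fun i => x (Sum.inl i)) ∉ F (sec fun i => x (Sum.inr i))}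
      have hsec : ∀ z z', fill z a = fill z' a → sec z = sec z' := by
        intro z z' hz
        ext u
        exact ⟨hE _ _ (by rw [fill_sumElim, fill_sumElim, hz]),
          hE _ _ (by rw [fill_sumElim, fill_sumElim, hz])⟩
      have hFsub : ∀ S, F S ⊆ S := by
        intro S
        by_cases hS : S ∈ rich
        · simp only [F, hS, dif_pos]
          rintro _ ⟨y, rfl⟩
          exact hS.choose_spec.2 y
        · simp [F, hS]
      have hF0 : ∀ z, avg (fun u => g (Sum.elim u z) * (F (sec z)).indicator 1 u) ≤ 0 := by
        intro z
        by_cases hS : sec z ∈ rich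
        · simp only [F, hS, dif_pos]
          rw [avg_mul_indicator_range (sev_injective hS.choose_spec.1) fun u => g (Sum.elim u z)]
          refine mul_nonpos_of_nonneg_of_nonpos (by positivity) ?_
          have := hV (Sum.elim hS.choose fun i => Sum.inl (z i))
            (hS.choose_spec.1.sumElim_left _)
          simpa only [sev_sumElim_const] using this
        · simp only [F, hS, dif_neg, not_false_eq_true, Set.indicator_empty]
          simp [avg_const]
      have hind : ∀ u z, E.indicator (1 : (ι₁ ⊕ η → Option α) → ℝ) (Sum.elim u z) =
          E'.indicator 1 (Sum.elim u z) + (F (sec z)).indicator 1 u := by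
        intro u z
        by_cases hu : u ∈ F (sec z)
        · have h1 : Sum.elim u z ∈ E := hFsub _ hu
          have h2 : Sum.elim u z ∉ E' := fun hh => hh.2 hu
          simp [h1, h2, hu]
        · by_cases h1 : Sum.elim u z ∈ E
          · have h2 : Sum.elim u z ∈ E' := ⟨h1, hu⟩
            simp [h1, h2, hu]
          · have h2 : Sum.elim u z ∉ E' := fun hh => h1 hh.1
            simp [h1, h2, hu]
      have hFc : ∀ z, c * rich.indicator 1 (sec z) ≤ dens (F (sec z)) := by
        intro z
        by_cases hS : sec z ∈ rich
        · rw [Set.indicator_of_mem hS, Pi.one_apply, mul_one]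
          simp only [F, hS, dif_pos]
          have := avg_mul_indicator_range
            (sev_injective (f := (id : Option α → Option α)) hS.choose_spec.1) fun _ => 1
          simp only [one_mul, avg_const, mul_one] at this
          unfold dens
          rw [this, hc]
          have h1 : (1 : ℝ) ≤ Nat.card (ζ → Option α) := by exact_mod_cast Nat.card_pos
          gcongr
        · rw [Set.indicator_of_notMem hS, mul_zero]
          exact dens_nonneg _
      have hsecdens : ∀ z, dens (sec z) ≤ rich.indicator 1 (sec z) + ε / 2 := by
        intro z
        by_cases hS : sec z ∈ rich
        · rw [Set.indicator_of_mem hS]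
          have := dens_le_one (sec z)
          simp only [Pi.one_apply]
          linarith
        · rw [Set.indicator_of_notMem hS, zero_add]
          by_contra! hd
          exact hS (h1 a _ (hE.section_left z) hd.le)
      have hdE : dens E = avg fun z => dens (sec z) := by
        rw [dens_sumArrow, avg_dens_comm]
        rfl
      have hE1 : dens E = dens E' + avg fun z => dens (F (sec z)) := by
        unfold dens
        rw [avg_sumArrow, avg_sumArrow, avg_comm, avg_comm (fun u z => E'.indicator _ _),
          ← avg_add]
        congr 1
        funext z
        rw [← avg_add]
        congr 1
        funext u
        exact hind u z
      have hE2 : avg (fun x => g x * E.indicator 1 x) ≤ avg (fun x => g x * E'.indicator 1 x) := by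
        rw [avg_sumArrow, avg_sumArrow, avg_comm, avg_comm (fun u z => g _ * E'.indicator _ _)]
        refine avg_mono fun z => ?_
        simp only [hind, mul_add]
        rw [avg_add]
        linarith [hF0 z]
      have hE3 : avg (fun x => g x * E'.indicator 1 x) ≤
          ε / 2 + (1 - c) ^ t * (dens E' - ε / 2) := by
        rw [avg_sumArrow, dens_sumArrow]
        refine (avg_mono fun u => ih a {z | Sum.elim u z ∈ E'} ?_ (fun z => g (Sum.elim u z))
          (fun z => hg _) ?_).trans_eq ?_
        · intro z z' hz hzE
          refine ⟨hE _ _ (by rw [fill_sumElim, fill_sumElim, hz]) hzE.1, ?_⟩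
          have := hzE.2
          change u ∉ F (sec z')
          rw [← hsec z z' hz]
          exact this
        · intro V hV'
          have := hV (Sum.elim (fun i => Sum.inl (u i)) V) (hV'.sumElim_right _)
          simpa only [sev_const_sumElim] using this
        · rw [avg_add, avg_const, avg_const_mul, avg_sub, avg_const]
      have hrich : dens E - ε / 2 ≤ avg fun z => rich.indicator (1 : Set (ι₁ → Option α) → ℝ) (sec z) := by
        have := avg_mono hsecdens
        rw [avg_add, avg_const, ← hdE] at this
        linarith
      have hE4 : dens E' - ε / 2 ≤ (1 - c) * (dens E - ε / 2) := by
        have := avg_mono hFc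
        rw [avg_const_mul] at this
        nlinarith
      have hρ : 0 ≤ (1 - c) ^ t := pow_nonneg (by linarith) t
      calc _ ≤ _ := hE2
        _ ≤ _ := hE3
        _ ≤ ε / 2 + (1 - c) ^ t * ((1 - c) * (dens E - ε / 2)) := by gcongr
        _ = _ := by rw [pow_succ]; ring
  obtain ⟨t, ht⟩ := exists_pow_lt_of_lt_one (show 0 < ε / 2 by linarith)
    (show 1 - c < 1 by linarith)
  obtain ⟨η, hη, h2⟩ := key t
  refine ⟨η, hη, fun a E hE g hg hV => (h2 a E hE g hg hV).trans ?_⟩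
  have h3 : (1 - c) ^ t * (dens E - ε / 2) ≤ (1 - c) ^ t * 1 :=
    mul_le_mul_of_nonneg_left (by linarith [dens_le_one E]) (pow_nonneg (by linarith) t)
  linarith

theorem exists_avg_iInter_insens_le (h : ∀ δ : ℝ, 0 < δ → DHJ α δ) (S : Finset α) :
    ∀ (ζ : Type) [Finite ζ] {ε : ℝ}, 0 < ε → ∃ (η : Type) (_ : Finite η),
      ∀ E : α → Set (η → Option α), (∀ a, Insens a (E a)) →
      ∀ g : (η → Option α) → ℝ, (∀ x, g x ≤ 1) →
      (∀ V : η → Option α ⊕ ζ, IsSubspace V → (avg fun y => g (sev id V y)) ≤ 0) →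
      avg (fun x => g x * {x | ∀ a ∈ S, x ∈ E a}.indicator 1 x) ≤ ε := by
  classical
  induction S using Finset.induction_on with
  | empty =>
    intro ζ _ ε hε
    refine ⟨ζ, inferInstance, fun E _ g _ hV => ?_⟩
    have := hV Sum.inr fun e => ⟨e, rfl⟩
    have hs : ∀ y : ζ → Option α, sev id (Sum.inr : ζ → Option α ⊕ ζ) y = y := fun y => rfl
    simp only [hs] at this
    simpa using le_trans this hε.le
  | insert b S hb ih =>
    intro ζ _ ε hε
    obtain ⟨η₁, _, h1⟩ := ih ζ (show 0 < ε / 2 by linarith)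
    obtain ⟨η, hη, h2⟩ := exists_avg_insens_le h η₁ (show 0 < ε / 2 by linarith)
    refine ⟨η, hη, fun E hE g hg hV => ?_⟩
    have h3 := h2 b (E b) (hE b)
      (fun x => g x * {x | ∀ a ∈ S, x ∈ E a}.indicator 1 x - ε / 2) (fun x => ?_) ?_
    · have h4 : ∀ x, (g x * {x | ∀ a ∈ S, x ∈ E a}.indicator 1 x - ε / 2) *
          (E b).indicator 1 x = g x * {x | ∀ a ∈ insert b S, x ∈ E a}.indicator 1 x -
            ε / 2 * (E b).indicator 1 x := by
        intro x
        by_cases hx : x ∈ E b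
        · simp [Set.indicator, hx]
        · simp [Set.indicator, hx]
      simp only [h4] at h3
      rw [avg_sub, avg_const_mul] at h3
      have := dens_le_one (E b)
      unfold dens at this
      nlinarith
    · by_cases hx : x ∈ {x | ∀ a ∈ S, x ∈ E a}
      · rw [Set.indicator_of_mem hx]
        simp only [Pi.one_apply, mul_one]
        linarith [hg x]
      · rw [Set.indicator_of_notMem hx]
        linarith
    · intro V hVs
      rw [avg_sub, avg_const]
      have := h1 (fun a => sev id V ⁻¹' E a) (fun a => (hE a).preimage V)
        (fun y => g (sev id V y)) (fun y => hg _) fun W hW => by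
          have := hV (fun i => Sum.elim Sum.inl W (V i)) (isSubspace_compWord hVs hW)
          have hs : ∀ y, sev id (fun i => Sum.elim Sum.inl W (V i)) y = sev id V (sev id W y) :=
            sev_compWord id V W
          simpa only [hs] using this
      have h5 : ∀ y, {y | ∀ a ∈ S, y ∈ sev id V ⁻¹' E a}.indicator (1 : (η₁ → Option α) → ℝ) y =
        {x | ∀ a ∈ S, x ∈ E a}.indicator 1 (sev id V y) := fun y => rfl
      simp only [h5] at this
      linarith

end Insensitive

section DensityHalesJewett

variable {ι α β η ζ : Type}

theorem fill_sev_some_some (V : ι → α ⊕ η) (x : η → Option (Option α)) (b : Option α) :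
    fill (sev (fun a => some (some a)) V x) b = sev some V (fill x b) := by
  funext i
  unfold fill sev
  rcases V i with a | e <;> simp

theorem exists_sev_eq_none {f : α → Option β} {V : ι → α ⊕ η} (hV : IsSubspace V)
    {x : η → Option β} (hx : ∃ i, x i = none) : ∃ i, sev f V x i = none := by
  obtain ⟨e, he⟩ := hx
  obtain ⟨i, hi⟩ := hV e
  exact ⟨i, by simp [sev, hi, he]⟩

theorem fill_sumElim_some {κ : Type} (u : κ → β) (x : ι → Option β) (a : β) :
    fill (Sum.elim (fun i => some (u i)) x) a = Sum.elim u (fill x a) := by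
  funext i
  rcases i with i | i <;> rfl

theorem DHJ.exists_card_ge [Finite β] [Nonempty β] {δ : ℝ} (h : DHJ β δ) (M : ℕ) :
    ∃ (ι : Type) (_ : Finite ι), M ≤ Nat.card ι ∧ ∀ A : Set (ι → β), δ ≤ dens A →
      ∃ x : ι → Option β, (∃ i, x i = none) ∧ ∀ a, fill x a ∈ A := by
  obtain ⟨ι, _, h⟩ := h
  refine ⟨Fin M ⊕ ι, inferInstance, by simp [Nat.card_sum], fun A hA => ?_⟩
  rw [dens_sumArrow] at hA
  obtain ⟨u, hu⟩ := exists_le_of_le_avg hA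
  obtain ⟨x, ⟨i, hi⟩, hx⟩ := h _ hu
  refine ⟨Sum.elim (fun i => some (u i)) x, ⟨Sum.inr i, hi⟩, fun a => ?_⟩
  rw [fill_sumElim_some]
  exact hx a

theorem exists_card_words_div_le (α : Type) [Finite α] {γ : ℝ} (hγ : 0 < γ) :
    ∃ M : ℕ, ∀ (η : Type) [Finite η], M ≤ Nat.card η →
      (Nat.card (η → α) / Nat.card (η → Option α) : ℝ) ≤ γ := by
  obtain ⟨M, hM⟩ := exists_pow_lt_of_lt_one hγ
    (show (Nat.card α / (Nat.card α + 1) : ℝ) < 1 by rw [div_lt_one (by positivity)]; linarith)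
  refine ⟨M, fun η _ hη => ?_⟩
  have h1 : (Nat.card (η → α) / Nat.card (η → Option α) : ℝ) =
      (Nat.card α / (Nat.card α + 1) : ℝ) ^ Nat.card η := by
    rw [Nat.card_fun, Nat.card_fun, Finite.card_option]
    push_cast
    rw [div_pow]
  rw [h1]
  refine (pow_le_pow_of_le_one (by positivity) ?_ hη).trans hM.le
  rw [div_le_one (by positivity)]
  linarith

theorem dens_range [Finite α] [Nonempty α] [Finite β] {i : α → β} (hi : Function.Injective i) :
    dens (Set.range i) = (Nat.card α / Nat.card β : ℝ) := by
  have := avg_mul_indicator_range hi fun _ => 1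
  simp only [one_mul, avg_const, mul_one] at this
  exact this

theorem sum_indicator_first_failure [Fintype α] (e : α ↪ ℕ) (E : α → Set β) (x : β) :
    ∑ a, {x | ∀ b ∈ (Finset.univ : Finset α), x ∈ (if e b < e a then E b else
      if e b = e a then (E b)ᶜ else Set.univ)}.indicator (1 : β → ℝ) x =
      1 - {x | ∀ a, x ∈ E a}.indicator 1 x := by
  classical
  by_cases hx : ∀ a, x ∈ E a
  · rw [Set.indicator_of_mem (show x ∈ {x | ∀ a, x ∈ E a} from hx), Pi.one_apply, sub_self]
    refine Finset.sum_eq_zero fun a _ => Set.indicator_of_notMem (fun h => ?_) _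
    have := h a (Finset.mem_univ a)
    simp [hx a] at this
  · rw [Set.indicator_of_notMem (show x ∉ {x | ∀ a, x ∈ E a} from hx), sub_zero]
    have hne : (Finset.univ.filter fun a => x ∉ E a).Nonempty := by
      push Not at hx
      obtain ⟨a, ha⟩ := hx
      exact ⟨a, by simpa using ha⟩
    obtain ⟨a, ha, hmin⟩ := Finset.exists_min_image _ e hne
    simp only [Finset.mem_filter, Finset.mem_univ, true_and] at ha hmin
    rw [Finset.sum_eq_single a]
    · rw [Set.indicator_of_mem, Pi.one_apply]
      intro b _
      split_ifs with h1 h2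
      · by_contra hb
        exact (hmin b hb).not_gt h1
      · rw [e.injective h2]
        exact ha
      · trivial
    · intro b _ hb
      refine Set.indicator_of_notMem (fun h => ?_) _
      by_cases hb' : x ∈ E b
      · have := h b (Finset.mem_univ b)
        simp [hb'] at this
      · have h1 : e a < e b := lt_of_le_of_ne (hmin b hb') fun h => hb (e.injective h.symm)
        have := h a (Finset.mem_univ a)
        simp [h1, ha] at this
    · exact fun h => absurd (Finset.mem_univ a) h

theorem DHJ.decrement [Finite α] [Nonempty α] (h : ∀ δ : ℝ, 0 < δ → DHJ α δ) {d : ℝ} (hd : 0 < d)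
    (hP : ∀ δ, d < δ → DHJ (Option α) δ) : ∃ δ < d, DHJ (Option α) δ := by
  classical
  cases nonempty_fintype α
  obtain ⟨θ, hθ, hlift⟩ := exists_subspace_forall_lines_dens h (half_pos hd)
  obtain ⟨γ, hγ, hγ1, hγ2, hγ3⟩ : ∃ γ : ℝ, 0 < γ ∧ γ ≤ d * θ / 8 ∧ γ ≤ d / 2 ∧ γ ≤ 1 / 2 :=
    ⟨min (d * θ / 8) (min (d / 2) (1 / 2)), by positivity, min_le_left _ _,
      (min_le_right _ _).trans (min_le_left _ _), (min_le_right _ _).trans (min_le_right _ _)⟩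
  have hk : (1 : ℝ) ≤ Fintype.card α := by exact_mod_cast Fintype.card_pos
  obtain ⟨M, hM⟩ := exists_card_words_div_le α hγ
  obtain ⟨ζ₁, _, hζ₁, hline₁⟩ := (hP (d + γ) (by linarith)).exists_card_ge M
  obtain ⟨η, _, hins⟩ := exists_avg_iInter_insens_le h Finset.univ ζ₁
    (show 0 < γ / (2 * Fintype.card α) by positivity)
  have hηM : M ≤ Nat.card η := by
    have hV : ∃ V : η → Option α ⊕ ζ₁, IsSubspace V := by
      by_contra! hno
      have := hins (fun _ => Set.univ) (fun a => insens_univ a) (fun _ => 1) (fun _ => le_rfl)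
        fun V hV => absurd hV (hno V)
      simp only [Set.mem_univ, implies_true, Set.ofPred_true, Set.indicator_univ, Pi.one_apply,
        mul_one, avg_const] at this
      rw [le_div_iff₀ (by positivity)] at this
      linarith
    obtain ⟨V, hV⟩ := hV
    choose f hf using hV
    refine hζ₁.trans (Nat.card_le_card_of_injective f fun e e' he => ?_)
    have := hf e
    rw [he, hf e'] at this
    exact (Sum.inr_injective this).symm
  have hq := hM η hηM
  obtain ⟨ι₀, _, hlift⟩ := hlift η
  have hB : (0 : ℝ) < Nat.card (ι₀ → Option α) := by exact_mod_cast Nat.card_pos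
  set ξ : ℝ := γ / (2 * Nat.card (ι₀ → Option α)) with hξ
  have hξ0 : 0 < ξ := by positivity
  obtain ⟨ζ, _, hline⟩ := hP (d + ξ) (by linarith)
  refine ⟨d - ξ, by linarith, ι₀ ⊕ ζ, inferInstance, fun A hA => ?_⟩
  by_contra hno
  have hup : ∀ u : ι₀ → Option α, dens {z : ζ → Option α | Sum.elim u z ∈ A} ≤ d + ξ := by
    intro u
    by_contra! hu
    obtain ⟨x, ⟨i, hi⟩, hx⟩ := hline _ hu.le
    refine hno ⟨Sum.elim (fun i => some (u i)) x, ⟨Sum.inr i, hi⟩, fun a => ?_⟩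
    rw [fill_sumElim_some]
    exact hx a
  have hlow : ∀ u : ι₀ → Option α, d - γ ≤ dens {z : ζ → Option α | Sum.elim u z ∈ A} := by
    intro u
    by_contra! hu
    rw [dens_sumArrow] at hA
    have h1 := hA.trans (avg_le_of_injective (i := fun _ : Unit => u)
      (Function.injective_of_subsingleton _) hup)
    rw [avg_const, Nat.card_unique, Nat.cast_one] at h1
    set b : ℝ := 1 / Nat.card (ι₀ → Option α) with hb
    have hb0 : 0 < b := by positivity
    have h2 : ξ = γ * b / 2 := by rw [hξ, hb]; field_simp
    have h3 := mul_lt_mul_of_pos_left hu hb0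
    nlinarith
  obtain ⟨V, hV, hVθ⟩ := hlift (ζ → Option α)
    (fun w => {z | Sum.elim (fun i => some (w i)) z ∈ A}) fun w => by
      linarith [hlow fun i => some (w i)]
  let S : (ζ → Option α) → Set (η → Option α) := fun z => {x | Sum.elim (sev some V x) z ∈ A}
  let E : (ζ → Option α) → α → Set (η → Option α) := fun z a =>
    {x | Sum.elim (fun i => some (fill (sev some V x) a i)) z ∈ A}
  let D : (ζ → Option α) → Set (η → Option α) := fun z => {x | ∀ a, x ∈ E z a}
  let R : Set (η → Option α) := Set.range fun (w : η → α) i => some (w i)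
  have hR : dens R ≤ γ := (dens_range some_comp_injective).trans_le hq
  have hRmem : ∀ x, x ∉ R → ∃ i, x i = none := by
    intro x hx
    by_contra! hne
    refine hx ⟨fun i => (x i).get (Option.isSome_iff_ne_none.2 (hne i)), ?_⟩
    simp
  have hAD : ∀ z, S z ∩ D z ⊆ R := by
    rintro z x ⟨hxS, hxD⟩
    by_contra hx
    refine hno ⟨Sum.elim (fun i => (sev some V x i).map some) fun i => some (z i), ?_, fun b => ?_⟩
    · obtain ⟨i, hi⟩ := exists_sev_eq_none (f := some) hV (hRmem x hx)
      exact ⟨Sum.inl i, by simp [hi]⟩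
    · have hfill : fill (Sum.elim (fun i => (sev some V x i).map some) fun i => some (z i)) b =
          Sum.elim (fun i => ((sev some V x i).map some).getD b) z := by
        funext i
        rcases i with i | i <;> rfl
      rw [hfill]
      rcases b with _ | a
      · convert (show Sum.elim (sev some V x) z ∈ A from hxS) using 2
        funext i
        cases sev some V x i <;> rfl
      · convert (show Sum.elim (fun i => some (fill (sev some V x) a i)) z ∈ A from hxD a) using 2
        funext i
        unfold fill
        cases sev some V x i <;> rfl
  have hS : d - γ ≤ avg fun z => dens (S z) := by
    rw [avg_dens_comm]
    exact le_avg_of_le fun x => hlow _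
  have hSD : (avg fun z => dens (S z ∩ D z)) ≤ γ :=
    avg_le_of_le fun z => (dens_mono (hAD z)).trans hR
  have hDθ : θ / 2 ≤ avg fun z => dens (D z) := by
    rw [avg_dens_comm]
    have h1 : ∀ x, θ - θ * R.indicator 1 x ≤ dens {z | x ∈ D z} := by
      intro x
      by_cases hx : x ∈ R
      · rw [Set.indicator_of_mem hx, Pi.one_apply, mul_one, sub_self]
        exact dens_nonneg _
      · rw [Set.indicator_of_notMem hx, mul_zero, sub_zero]
        exact hVθ x (hRmem x hx)
    have h2 := avg_mono h1
    rw [avg_sub, avg_const, avg_const_mul] at h2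
    change θ - θ * dens R ≤ _ at h2
    nlinarith
  obtain ⟨z, hz⟩ : ∃ z, 0 ≤ dens (S z) - dens (S z ∩ D z) - ((d + γ) * (1 - dens (D z)) + γ) := by
    apply exists_le_of_le_avg
    rw [avg_sub, avg_sub, avg_add, avg_const, avg_const_mul, avg_sub, avg_const]
    nlinarith
  let g : (η → Option α) → ℝ := fun x => (S z).indicator 1 x - (d + γ)
  let e : α ↪ ℕ := (Fintype.equivFin α).toEmbedding.trans Fin.valEmbedding
  let F : α → α → Set (η → Option α) := fun a b => if e b < e a then E z b else
      if e b = e a then (E z b)ᶜ else Set.univ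
  have hE : ∀ b, Insens b (E z b) := fun b x x' hxx hx => by
    have h1 : fill (sev some V x) b = fill (sev some V x') b := by
      rw [fill_sev_some, fill_sev_some, hxx]
    change Sum.elim (fun i => some (fill (sev some V x') b i)) z ∈ A
    rw [← h1]
    exact hx
  have hFle : ∀ a, avg (fun x => g x * {x | ∀ b ∈ Finset.univ, x ∈ F a b}.indicator 1 x) ≤
      γ / (2 * Fintype.card α) := by
    intro a
    refine hins (F a) (fun b => ?_) g (fun x => ?_) fun W hW => ?_
    · simp only [F]
      split_ifs
      · exact hE b
      · exact (hE b).compl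
      · exact insens_univ b
    · have := indicator_le_one_real (S z) x
      simp only [g]
      linarith
    · by_contra! hpos
      have h1 : d + γ ≤ dens (sev id W ⁻¹' S z) := by
        simp only [g] at hpos
        rw [avg_sub, avg_const] at hpos
        exact (lt_of_sub_pos hpos).le
      obtain ⟨x, hx, hxS⟩ := hline₁ _ h1
      obtain ⟨i, hi⟩ := exists_sev_eq_none (f := fun a => some (some a)) hV
        (exists_sev_eq_none (f := some) hW hx)
      refine hno ⟨Sum.elim (sev (fun a => some (some a)) V (sev some W x)) fun i => some (z i),
        ⟨Sum.inl i, hi⟩, fun b => ?_⟩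
      have h2 : Sum.elim (sev some V (sev id W (fill x b))) z ∈ A := hxS b
      rw [← fill_sev_some, ← fill_sev_some_some] at h2
      convert h2 using 1
      funext i
      rcases i with i | i <;> rfl
  have hsum : γ ≤ ∑ a, avg (fun x => g x *
      {x | ∀ b ∈ Finset.univ, x ∈ F a b}.indicator 1 x) := by
    rw [← avg_sum]
    simp only [← Finset.mul_sum]
    have h1 : ∀ x, ∑ a, {x | ∀ b ∈ Finset.univ, x ∈ F a b}.indicator 1 x =
        1 - (D z).indicator (1 : (η → Option α) → ℝ) x :=
      fun x => sum_indicator_first_failure e (E z) x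
    have h2 : ∀ x, g x * (1 - (D z).indicator 1 x) = (S z).indicator 1 x -
        (S z ∩ D z).indicator 1 x - (d + γ) * (1 - (D z).indicator 1 x) := by
      intro x
      by_cases h1 : x ∈ S z <;> by_cases h2 : x ∈ D z <;> simp [g, h1, h2]
    simp only [h1, h2]
    rw [avg_sub, avg_sub, avg_const_mul, avg_sub, avg_const]
    change γ ≤ dens (S z) - dens (S z ∩ D z) - (d + γ) * (1 - dens (D z))
    linarith
  have h3 := hsum.trans (Finset.sum_le_sum fun a _ => hFle a)
  rw [Finset.sum_const, Finset.card_univ, nsmul_eq_mul] at h3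
  have h4 : (Fintype.card α : ℝ) * (γ / (2 * Fintype.card α)) = γ / 2 := by field_simp
  linarith

/-- The density Hales–Jewett theorem. -/
theorem density_hales_jewett (α : Type) [Finite α] : ∀ δ : ℝ, 0 < δ → DHJ α δ := by
  refine Finite.induction_empty_option
    (P := fun α => ∀ _ : Finite α, ∀ δ : ℝ, 0 < δ → DHJ α δ) ?_ ?_ ?_ α inferInstance
  · intro α β e ih _ δ hδ
    have := Finite.of_equiv β e.symm
    exact (ih inferInstance δ hδ).of_equiv e
  · exact fun _ δ hδ => DHJ.of_isEmpty hδ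
  · intro α _ ih _ δ hδ
    cases isEmpty_or_nonempty α
    · exact DHJ.of_subsingleton hδ
    have h := ih inferInstance
    by_contra hcon
    let T : Set ℝ := {δ | DHJ (Option α) δ}
    have hT : T.Nonempty := ⟨2, Unit, inferInstance, fun A hA => by
      linarith [dens_le_one A]⟩
    have hlow : ∀ δ' ∈ T, δ ≤ δ' := fun δ' hδ' => by
      by_contra! hlt
      exact hcon (DHJ.mono hδ' hlt.le)
    have hbdd : BddBelow T := ⟨δ, hlow⟩
    obtain ⟨δ', hlt, hδ'⟩ := DHJ.decrement h (d := sInf T) (hδ.trans_le (le_csInf hT hlow))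
      fun δ' hδ' => by
        obtain ⟨δ₁, h1, h2⟩ := exists_lt_of_csInf_lt hT hδ'
        exact DHJ.mono h1 h2.le
    exact (csInf_le hbdd hδ').not_gt hlt

end DensityHalesJewett

section Szemeredi

/-- Surjective homomorphisms of finite groups preserve averages. -/
theorem avg_comp_addMonoidHom {H K : Type*} [AddCommGroup H] [AddCommGroup K] [Finite H] [Finite K]
    {φ : H →+ K} (hφ : Function.Surjective φ) (f : K → ℝ) : (avg fun h => f (φ h)) = avg f := by
  have h1 : ∀ k : K, (avg fun h => f (φ h)) = avg fun h => f (φ h + k) := fun k => by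
    obtain ⟨s, rfl⟩ := hφ k
    rw [← avg_equiv (Equiv.addRight s) fun h => f (φ h)]
    simp
  calc (avg fun h => f (φ h)) = avg fun _ : K => avg fun h => f (φ h) := (avg_const _).symm
    _ = avg fun k : K => avg fun h => f (φ h + k) := by
        congr 1
        exact funext h1
    _ = avg fun h : H => avg fun k => f (φ h + k) := avg_comm _
    _ = avg fun _ : H => avg f := by
        congr 1
        exact funext fun h => avg_equiv (Equiv.addLeft (φ h)) f
    _ = avg f := avg_const _

/-- Szemerédi's theorem in counting form (Varnavides). -/
theorem szemeredi_count (k : ℕ) [NeZero k] {δ : ℝ} (hδ : 0 < δ) :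
    ∃ c : ℝ, 0 < c ∧ ∀ (Z : Type) [AddCommGroup Z] [Finite Z] (f : Z → ℝ),
      (∀ x, 0 ≤ f x) → (∀ x, f x ≤ 1) → δ ≤ avg f →
      c ≤ avg fun p : Z × Z => ∏ i : Fin k, f (p.1 + (i : ℕ) • p.2) := by
  obtain ⟨ι, hι, θ, hθ, h⟩ := (density_hales_jewett (Fin k) (δ / 2 / 2)
    (by positivity)).exists_line_dens (half_pos hδ)
  cases nonempty_fintype ι
  classical
  refine ⟨θ * (δ / 2) ^ k, by positivity, fun Z _ _ f hf0 hf1 hf => ?_⟩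
  let lin : (ι → ℕ) → Z × (ι → Z) → Z := fun w ω => ω.1 + ∑ i, w i • ω.2 i
  let B : (ι → Fin k) → Set (Z × (ι → Z)) := fun w => {ω | δ / 2 ≤ f (lin (fun i => w i) ω)}
  have hB : ∀ w, δ / 2 ≤ dens (B w) := by
    intro w
    let φ : Z × (ι → Z) →+ Z :=
      { toFun := lin fun i => w i
        map_zero' := by simp [lin]
        map_add' := fun x y => by
          simp only [lin, Prod.fst_add, Prod.snd_add, Pi.add_apply, smul_add,
            Finset.sum_add_distrib]
          abel }
    have hφ : Function.Surjective φ := fun z => ⟨(z, 0), by simp [φ, lin]⟩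
    have h1 : avg f ≤ avg fun ω => δ / 2 + (B w).indicator 1 ω := by
      rw [← avg_comp_addMonoidHom hφ]
      refine avg_mono fun ω => ?_
      by_cases hω : ω ∈ B w
      · rw [Set.indicator_of_mem hω]
        have := hf1 (φ ω)
        simp only [Pi.one_apply]
        linarith
      · rw [Set.indicator_of_notMem hω]
        have : f (φ ω) < δ / 2 := not_le.mp hω
        linarith
    rw [avg_add, avg_const] at h1
    change avg f ≤ δ / 2 + dens (B w) at h1
    linarith
  obtain ⟨x, ⟨i₀, hi₀⟩, hx⟩ := h (Z × (ι → Z)) B (le_avg_of_le hB)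
  let φ : Z × (ι → Z) →+ Z × Z :=
    { toFun := fun ω => (lin (fun i => (x i).elim 0 fun a => a) ω,
        ∑ i, if x i = none then ω.2 i else 0)
      map_zero' := by simp [lin]
      map_add' := fun y z => by
        ext
        · simp only [lin, Prod.fst_add, Prod.snd_add, Pi.add_apply, smul_add,
            Finset.sum_add_distrib]
          abel
        · simp only [Prod.snd_add, Pi.add_apply, ← Finset.sum_add_distrib]
          exact Finset.sum_congr rfl fun i _ => by split_ifs <;> simp }
  have hφ : Function.Surjective φ := fun ⟨z, d⟩ => by
    refine ⟨(z, Pi.single i₀ d), Prod.ext ?_ ?_⟩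
    · simp only [φ, lin, AddMonoidHom.coe_mk, ZeroHom.coe_mk]
      rw [Finset.sum_eq_single i₀ (fun i _ hi => by simp [hi]) (by simp), hi₀]
      simp
    · simp only [φ, AddMonoidHom.coe_mk, ZeroHom.coe_mk]
      rw [Finset.sum_eq_single i₀ (fun i _ hi => by simp [hi]) (by simp), hi₀]
      simp
  rw [← avg_comp_addMonoidHom hφ]
  have hlin : ∀ ω (a : Fin k), (φ ω).1 + (a : ℕ) • (φ ω).2 =
      lin (fun i => ((fill x a i : Fin k) : ℕ)) ω := by
    intro ω a
    simp only [φ, lin, AddMonoidHom.coe_mk, ZeroHom.coe_mk, Finset.smul_sum, add_assoc,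
      ← Finset.sum_add_distrib]
    congr 1
    refine Finset.sum_congr rfl fun i _ => ?_
    unfold fill
    cases x i <;> simp
  calc θ * (δ / 2) ^ k
      ≤ dens {ω | ∀ a, ω ∈ B (fill x a)} * (δ / 2) ^ k := by gcongr
    _ = avg fun ω => {ω | ∀ a, ω ∈ B (fill x a)}.indicator 1 ω * (δ / 2) ^ k :=
        (avg_mul_const _ _).symm
    _ ≤ _ := avg_mono fun ω => by
        by_cases hω : ω ∈ {ω | ∀ a, ω ∈ B (fill x a)}
        · rw [Set.indicator_of_mem hω, Pi.one_apply, one_mul]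
          have := Finset.prod_le_prod (s := (Finset.univ : Finset (Fin k)))
            (f := fun _ => δ / 2) (g := fun i : Fin k => f ((φ ω).1 + (i : ℕ) • (φ ω).2))
            (fun _ _ => by positivity) fun i _ => by
              rw [hlin]
              exact hω i
          rwa [Finset.prod_const, Finset.card_univ, Fintype.card_fin] at this
        · rw [Set.indicator_of_notMem hω, zero_mul]
          exact Finset.prod_nonneg fun i _ => hf0 _

end Szemeredi

section Independence

variable {K X : Type*} [DecidableEq K]

/-- The function `F` does not depend on the coordinate `k`. -/
def Indep (k : K) (F : (K → X) → ℝ) : Prop := ∀ w x, F (Function.update w k x) = F w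

theorem Indep.mul {k : K} {F G : (K → X) → ℝ} (hF : Indep k F) (hG : Indep k G) :
    Indep k fun w => F w * G w := fun w x => by
  simp only [hF w x, hG w x]

theorem Indep.prod {ι : Type*} {k : K} {s : Finset ι} {F : ι → (K → X) → ℝ}
    (hF : ∀ i ∈ s, Indep k (F i)) : Indep k fun w => ∏ i ∈ s, F i w := fun w x =>
  Finset.prod_congr rfl fun i hi => hF i hi w x

theorem indep_const (k : K) (c : ℝ) : Indep k fun _ : K → X => c := fun _ _ => rfl

theorem indep_avg_update [Finite X] (k : K) (F : (K → X) → ℝ) :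
    Indep k fun w => avg fun x => F (Function.update w k x) := fun w x => by
  simp only [Function.update_idem]

variable [Finite K] [Finite X] [Nonempty X]

theorem avg_eq_avg_update (k : K) (F : (K → X) → ℝ) :
    avg F = avg fun w => avg fun x => F (Function.update w k x) := by
  let e := Equiv.funSplitAt k X
  have h : ∀ w x, e.symm (x, (e w).2) = Function.update w k x := fun w x => by
    funext j
    by_cases hj : j = k
    · subst hj
      simp [e, Equiv.funSplitAt, Equiv.piSplitAt]
    · simp [e, Equiv.funSplitAt, Equiv.piSplitAt, hj]
  calc avg F = avg fun p => F (e.symm p) := (avg_equiv e.symm F).symm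
    _ = avg fun x => avg fun r => F (e.symm (x, r)) := avg_prod _
    _ = avg fun r => avg fun x => F (e.symm (x, r)) := avg_comm _
    _ = avg fun _ : X => avg fun r => avg fun x => F (e.symm (x, r)) := (avg_const _).symm
    _ = avg fun p : X × ({j // j ≠ k} → X) => avg fun x => F (e.symm (x, p.2)) :=
        (avg_prod fun p : X × ({j // j ≠ k} → X) => avg fun x => F (e.symm (x, p.2))).symm
    _ = avg fun w => avg fun x => F (e.symm (x, (e w).2)) :=
        (avg_equiv e fun p : X × ({j // j ≠ k} → X) => avg fun x => F (e.symm (x, p.2))).symm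
    _ = _ := by simp only [h]

theorem Indep.avg_mul {k : K} {A : (K → X) → ℝ} (hA : Indep k A) (F : (K → X) → ℝ) :
    (avg fun w => A w * F w) = avg fun w => A w * avg fun x => F (Function.update w k x) := by
  rw [avg_eq_avg_update k]
  congr 1
  funext w
  rw [← avg_const_mul]
  simp only [hA w]

end Independence

section CauchySchwarz

variable {I X : Type*} [DecidableEq I]

/-- Exchange the two copies of the coordinates in `ω`. -/
def flip (ω : Finset I) (w : I × Bool → X) : I × Bool → X :=
  fun p => w (p.1, xor p.2 (decide (p.1 ∈ ω)))

theorem flip_empty (w : I × Bool → X) : flip ∅ w = w := by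
  funext p
  simp [flip]

theorem flip_flip_singleton {i : I} {ω : Finset I} (hi : i ∉ ω) (w : I × Bool → X) :
    flip ω (flip {i} w) = flip (insert i ω) w := by
  funext ⟨i', b⟩
  by_cases h : i' = i
  · subst h
    simp [flip, hi]
  · simp [flip, h]

theorem flip_update {i : I} {ω : Finset I} (hi : i ∉ ω) (w : I × Bool → X) (b : Bool) (x : X) :
    flip ω (Function.update w (i, b) x) = Function.update (flip ω w) (i, b) x := by
  funext ⟨i', b'⟩
  by_cases h : i' = i
  · subst h
    simp [flip, hi, Function.update_apply]
  · simp [flip, h]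

theorem flip_singleton_eq_update (i : I) (w : I × Bool → X) :
    flip {i} w = Function.update (Function.update w (i, true) (w (i, false)))
      (i, false) (w (i, true)) := by
  funext ⟨i', b'⟩
  by_cases h : i' = i
  · subst h
    cases b' <;> simp [flip]
  · simp [flip, h]

/-- The product of `F` over all exchanges of coordinates in `T`. -/
def flipProd (T : Finset I) (F : (I × Bool → X) → ℝ) (w : I × Bool → X) : ℝ :=
  ∏ ω ∈ T.powerset, F (flip ω w)

theorem flipProd_empty (F : (I × Bool → X) → ℝ) (w : I × Bool → X) : flipProd ∅ F w = F w := by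
  simp [flipProd, flip_empty]

theorem flipProd_insert {i : I} {T : Finset I} (hi : i ∉ T) (F : (I × Bool → X) → ℝ)
    (w : I × Bool → X) :
    flipProd (insert i T) F w = flipProd T F w * flipProd T F (flip {i} w) := by
  unfold flipProd
  rw [Finset.prod_powerset_insert hi]
  congr 1
  refine Finset.prod_congr rfl fun ω hω => ?_
  rw [flip_flip_singleton fun h => hi (Finset.mem_powerset.mp hω h)]

theorem Indep.flipProd {i : I} {b : Bool} {T : Finset I} (hi : i ∉ T) {F : (I × Bool → X) → ℝ}
    (hF : Indep (i, b) F) : Indep (i, b) (flipProd T F) :=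
  Indep.prod fun ω hω w x => by
    rw [flip_update fun h => hi (Finset.mem_powerset.mp hω h), hF]

variable [Finite I] [Finite X] [Nonempty X]

/-- One application of the Cauchy–Schwarz inequality. -/
theorem sq_avg_mul_le_avg_flip (i : I) {P R β : (I × Bool → X) → ℝ}
    (hP : Indep (i, false) P) (hβ : ∀ b, Indep (i, b) β) (hR : Indep (i, true) R)
    (hPβ : ∀ w, |P w| ≤ β w) :
    (avg fun w => P w * R w) ^ 2 ≤ avg β * avg fun w => β w * R w * R (flip {i} w) := by
  set M : (I × Bool → X) → ℝ := fun w => avg fun x => R (Function.update w (i, false) x) with hM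
  have hMf : Indep (i, false) M := indep_avg_update _ _
  have h0 : ∀ w, 0 ≤ β w := fun w => (abs_nonneg _).trans (hPβ w)
  have hRflip : ∀ w, R (flip {i} w) = R (Function.update w (i, false) (w (i, true))) := fun w => by
    rw [flip_singleton_eq_update, Function.update_comm (by simp), hR]
  have h1 : (avg fun w => β w * R w * R (flip {i} w)) = avg fun w => β w * M w ^ 2 := by
    calc (avg fun w => β w * R w * R (flip {i} w))
        = avg fun w => β w * R w * R (Function.update w (i, false) (w (i, true))) := by
          simp only [hRflip]
      _ = avg fun w => β w * R w * M w := by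
          rw [((hβ true).mul hR).avg_mul]
          congr 1
          funext w
          congr 2
          funext x
          rw [Function.update_comm (by simp), hR, Function.update_self]
      _ = avg fun w => β w * M w * R w := by
          congr 1
          funext w
          ring
      _ = avg fun w => β w * M w * M w := ((hβ false).mul hMf).avg_mul _
      _ = _ := by
          congr 1
          funext w
          ring
  rw [h1, hP.avg_mul]
  have h2 : |avg fun w => P w * M w| ≤ avg fun w => √(β w) * (√(β w) * |M w|) := by
    refine (abs_avg_le _).trans (avg_mono fun w => ?_)
    rw [abs_mul, ← mul_assoc, Real.mul_self_sqrt (h0 w)]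
    exact mul_le_mul_of_nonneg_right (hPβ w) (abs_nonneg _)
  calc (avg fun w => P w * M w) ^ 2 = |avg fun w => P w * M w| ^ 2 := (sq_abs _).symm
    _ ≤ (avg fun w => √(β w) * (√(β w) * |M w|)) ^ 2 := by gcongr
    _ ≤ _ := avg_mul_sq_le _ _
    _ = _ := by
        simp only [mul_pow, sq_abs, Real.sq_sqrt (h0 _)]

/-- The intermediate averages of the Cauchy–Schwarz argument. -/
noncomputable def csAvg (J : Finset I) (h : (I × Bool → X) → ℝ) (A B : I → (I × Bool → X) → ℝ)
    (T : Finset I) : ℝ :=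
  avg fun w => flipProd T h w * (∏ i ∈ T, flipProd (T.erase i) (B i) w) *
    ∏ i ∈ J \ T, flipProd T (A i) w

theorem sq_csAvg_le {J : Finset I} {h : (I × Bool → X) → ℝ} {A B : I → (I × Bool → X) → ℝ}
    (hh : ∀ i ∈ J, Indep (i, true) h) (hA : ∀ i ∈ J, Indep (i, false) (A i))
    (hA' : ∀ i ∈ J, ∀ i' ∈ J, Indep (i', true) (A i)) (hB : ∀ i ∈ J, Indep (i, false) (B i))
    (hB' : ∀ i ∈ J, ∀ i' ∈ J, Indep (i', true) (B i)) (hAB : ∀ i ∈ J, ∀ w, |A i w| ≤ B i w)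
    {T : Finset I} (hT : T ⊆ J) {i : I} (hi : i ∈ J) (hiT : i ∉ T) :
    csAvg J h A B T ^ 2 ≤ avg (flipProd T (B i)) * csAvg J h A B (insert i T) := by
  set R : (I × Bool → X) → ℝ := fun w =>
    flipProd T h w * (∏ i ∈ T, flipProd (T.erase i) (B i) w) *
      ∏ i' ∈ J \ insert i T, flipProd T (A i') w with hRdef
  have hJ : J \ T = insert i (J \ insert i T) := by
    ext a
    by_cases ha : a = i
    · subst ha
      simp [hi, hiT]
    · simp [ha]
  have h1 : csAvg J h A B T = avg fun w => flipProd T (A i) w * R w := by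
    unfold csAvg
    congr 1
    funext w
    rw [hJ, Finset.prod_insert (by simp), hRdef]
    ring
  have h2 : csAvg J h A B (insert i T) =
      avg fun w => flipProd T (B i) w * R w * R (flip {i} w) := by
    unfold csAvg
    congr 1
    funext w
    rw [Finset.prod_insert hiT, Finset.erase_insert hiT, flipProd_insert hiT]
    have h3 : ∀ i' ∈ T, flipProd ((insert i T).erase i') (B i') w =
        flipProd (T.erase i') (B i') w * flipProd (T.erase i') (B i') (flip {i} w) := by
      intro i' hi'
      rw [Finset.erase_insert_of_ne (ne_of_mem_of_not_mem hi' hiT).symm,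
        flipProd_insert fun hii => hiT (Finset.mem_of_mem_erase hii)]
    rw [Finset.prod_congr rfl h3, Finset.prod_mul_distrib]
    simp only [flipProd_insert hiT, Finset.prod_mul_distrib, hRdef]
    ring
  rw [h1, h2]
  refine sq_avg_mul_le_avg_flip i ((hA i hi).flipProd hiT) ?_ ?_ ?_
  · rintro (_ | _)
    exacts [(hB i hi).flipProd hiT, (hB' i hi i hi).flipProd hiT]
  · refine (((hh i hi).flipProd hiT).mul (Indep.prod fun i' hi' => ?_)).mul
      (Indep.prod fun i' hi' => ?_)
    · exact (hB' i' (hT hi') i hi).flipProd fun h => hiT (Finset.mem_of_mem_erase h)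
    · exact (hA' i' (Finset.mem_sdiff.mp hi').1 i hi).flipProd hiT
  · intro w
    unfold flipProd
    rw [Finset.abs_prod]
    exact Finset.prod_le_prod (fun _ _ => abs_nonneg _) fun _ _ => hAB i hi _

/-- The weighted generalized Cauchy–Schwarz inequality. -/
theorem abs_csAvg_pow_le {J : Finset I} {h : (I × Bool → X) → ℝ} {A B : I → (I × Bool → X) → ℝ}
    (hh : ∀ i ∈ J, Indep (i, true) h) (hA : ∀ i ∈ J, Indep (i, false) (A i))
    (hA' : ∀ i ∈ J, ∀ i' ∈ J, Indep (i', true) (A i)) (hB : ∀ i ∈ J, Indep (i, false) (B i))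
    (hB' : ∀ i ∈ J, ∀ i' ∈ J, Indep (i', true) (B i)) (hAB : ∀ i ∈ J, ∀ w, |A i w| ≤ B i w)
    {C : ℝ} (hC : 0 < C) (hBC : ∀ i ∈ J, ∀ T ⊆ J, i ∉ T → avg (flipProd T (B i)) ≤ C) :
    C * |csAvg J h A B ∅| ^ 2 ^ J.card ≤ C ^ 2 ^ J.card * |csAvg J h A B J| := by
  suffices H : ∀ T ⊆ J, C * |csAvg J h A B ∅| ^ 2 ^ T.card ≤ C ^ 2 ^ T.card * |csAvg J h A B T| from
    H J subset_rfl
  intro T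
  induction T using Finset.induction_on with
  | empty => simp
  | insert i T hiT ih =>
    intro hT
    have hi : i ∈ J := hT (Finset.mem_insert_self _ _)
    have hTJ : T ⊆ J := (Finset.subset_insert _ _).trans hT
    have h1 := ih hTJ
    have h2 : |csAvg J h A B T| ^ 2 ≤ C * |csAvg J h A B (insert i T)| := by
      rw [sq_abs]
      refine (sq_csAvg_le hh hA hA' hB hB' hAB hTJ hi hiT).trans ?_
      have h3 : 0 ≤ avg (flipProd T (B i)) := avg_nonneg fun w =>
        Finset.prod_nonneg fun _ _ => (abs_nonneg _).trans (hAB i hi _)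
      exact (mul_le_mul_of_nonneg_left (le_abs_self _) h3).trans
        (mul_le_mul_of_nonneg_right (hBC i hi T hTJ hiT) (abs_nonneg _))
    have h4 : C * (C * |csAvg J h A B ∅| ^ 2 ^ (T.card + 1)) ≤
        C * (C ^ 2 ^ (T.card + 1) * |csAvg J h A B (insert i T)|) := by
      calc C * (C * |csAvg J h A B ∅| ^ 2 ^ (T.card + 1))
          = (C * |csAvg J h A B ∅| ^ 2 ^ T.card) ^ 2 := by ring
        _ ≤ (C ^ 2 ^ T.card * |csAvg J h A B T|) ^ 2 := by gcongr
        _ = C ^ 2 ^ (T.card + 1) * |csAvg J h A B T| ^ 2 := by ring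
        _ ≤ C ^ 2 ^ (T.card + 1) * (C * |csAvg J h A B (insert i T)|) := by gcongr
        _ = _ := by ring
    rw [Finset.card_insert_of_notMem hiT]
    exact le_of_mul_le_mul_left h4 hC

end CauchySchwarz

section LinearForms

variable {I X : Type*} [DecidableEq I]

/-- The point using the second copy of exactly the coordinates in `ω`. -/
def pick (ω : Finset I) (w : I × Bool → X) : I → X := fun i => w (i, decide (i ∈ ω))

theorem pick_flip {ω ω' : Finset I} (h : Disjoint ω ω') (w : I × Bool → X) :
    pick ω (flip ω' w) = pick (ω ∪ ω') w := by
  funext i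
  by_cases h1 : i ∈ ω
  · simp [pick, flip, h1, Finset.disjoint_left.mp h h1]
  · simp [pick, flip, h1]

theorem pick_update (ω : Finset I) (w : I × Bool → X) (i : I) (b : Bool) (x : X) :
    pick ω (Function.update w (i, b) x) =
      if b = decide (i ∈ ω) then Function.update (pick ω w) i x else pick ω w := by
  funext i'
  by_cases h : i' = i
  · subst h
    split_ifs with hb
    · simp [pick, hb]
    · simp [pick, Ne.symm hb]
  · split_ifs <;> simp [pick, h]

theorem Indep.comp_pick {i : I} {F : (I → X) → ℝ} (hF : Indep i F) (ω : Finset I) (b : Bool) :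
    Indep (i, b) fun w => F (pick ω w) := fun w x => by
  simp only [pick_update]
  split_ifs
  · exact hF _ _
  · rfl

theorem indep_comp_pick (F : (I → X) → ℝ) {ω : Finset I} {i : I} {b : Bool}
    (h : b ≠ decide (i ∈ ω)) : Indep (i, b) fun w => F (pick ω w) := fun w x => by
  simp only [pick_update, if_neg h]

/-- The linear forms condition for a weighted hypergraph. -/
def LinForms [Finite I] [Finite X] (ν : I → (I → X) → ℝ) (ε : ℝ) : Prop :=
  ∀ S : Finset (I × Finset I), (∀ p ∈ S, p.1 ∉ p.2) →
    |(avg fun w : I × Bool → X => ∏ p ∈ S, ν p.1 (pick p.2 w)) - 1| ≤ ε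

/-- The weight `ν i` for `i ∈ T`, and the weight `1` otherwise. -/
def weight (ν : I → (I → X) → ℝ) (T : Finset I) (i : I) (v : I → X) : ℝ :=
  if i ∈ T then ν i v else 1

theorem weight_empty (ν : I → (I → X) → ℝ) (i : I) (v : I → X) : weight ν ∅ i v = 1 := by
  simp [weight]

theorem Indep.weight {ν : I → (I → X) → ℝ} (hν : ∀ i, Indep i (ν i)) (T : Finset I) (i : I) :
    Indep i (weight ν T i) := fun w x => by
  unfold GreenTao.weight
  rw [hν]

theorem exists_prod_weight_eq [Fintype I] (ν : I → (I → X) → ℝ) (T T' : Finset I) {j : I}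
    {s : Finset I} {t : I → Finset I} (hj : j ∉ s) (ht : ∀ i ∈ s, i ∉ t i) (htj : ∀ i, j ∉ t i) :
    ∃ S : Finset (I × Finset I), (∀ p ∈ S, p.1 ≠ j ∧ p.1 ∉ p.2) ∧ ∀ w : I × Bool → X,
      ∏ i ∈ s, flipProd (t i) (fun w => weight ν T i (pick ∅ w) * weight ν T' i (pick {j} w)) w =
        ∏ p ∈ S, ν p.1 (pick p.2 w) := by
  let r : Finset (I × Finset I) := Finset.univ.filter fun p => p.1 ∈ s ∧ p.2 ∈ (t p.1).powerset
  let r' : Finset (I × Finset I) := Finset.univ.filter fun p =>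
    p.1 ∈ s ∧ p.2 ∈ (t p.1).powerset.image (insert j)
  have hmem : ∀ p ∈ r, p.1 ≠ j ∧ p.1 ∉ p.2 ∧ j ∉ p.2 := by
    intro p hp
    simp only [r, Finset.mem_filter, Finset.mem_univ, true_and, Finset.mem_powerset] at hp
    exact ⟨ne_of_mem_of_not_mem hp.1 hj, fun h => ht _ hp.1 (hp.2 h), fun h => htj _ (hp.2 h)⟩
  have hmem' : ∀ p ∈ r', p.1 ≠ j ∧ p.1 ∉ p.2 ∧ j ∈ p.2 := by
    intro p hp
    simp only [r', Finset.mem_filter, Finset.mem_univ, true_and, Finset.mem_image,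
      Finset.mem_powerset] at hp
    obtain ⟨hp1, a, ha, hp2⟩ := hp
    have hpj : p.1 ≠ j := ne_of_mem_of_not_mem hp1 hj
    refine ⟨hpj, fun h => ?_, hp2 ▸ Finset.mem_insert_self _ _⟩
    rw [← hp2, Finset.mem_insert] at h
    exact ht _ hp1 (ha (h.resolve_left hpj))
  refine ⟨r.filter (fun p => p.1 ∈ T) ∪ r'.filter (fun p => p.1 ∈ T'), fun p hp => ?_, fun w => ?_⟩
  · rcases Finset.mem_union.mp hp with hp | hp
    · exact ⟨(hmem p (Finset.mem_filter.mp hp).1).1, (hmem p (Finset.mem_filter.mp hp).1).2.1⟩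
    · exact ⟨(hmem' p (Finset.mem_filter.mp hp).1).1, (hmem' p (Finset.mem_filter.mp hp).1).2.1⟩
  · rw [Finset.prod_union, Finset.prod_filter (s := r), Finset.prod_filter (s := r')]
    · have h1 : ∏ p ∈ r, (if p.1 ∈ T then ν p.1 (pick p.2 w) else 1) =
          ∏ i ∈ s, ∏ ω ∈ (t i).powerset, weight ν T i (pick ω w) :=
        Finset.prod_finset_product' r s (fun i => (t i).powerset) (by simp [r])
          (f := fun i ω => weight ν T i (pick ω w))
      have h2 : ∏ p ∈ r', (if p.1 ∈ T' then ν p.1 (pick p.2 w) else 1) =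
          ∏ i ∈ s, ∏ ω ∈ (t i).powerset.image (insert j), weight ν T' i (pick ω w) :=
        Finset.prod_finset_product' r' s (fun i => (t i).powerset.image (insert j)) (by simp [r'])
          (f := fun i ω => weight ν T' i (pick ω w))
      rw [h1, h2, ← Finset.prod_mul_distrib]
      refine Finset.prod_congr rfl fun i hi => ?_
      rw [Finset.prod_image fun a ha b hb hab => ?_, ← Finset.prod_mul_distrib]
      · refine Finset.prod_congr rfl fun ω hω => ?_
        have hjω : j ∉ ω := fun h => htj i (Finset.mem_powerset.mp hω h)
        beta_reduce
        rw [pick_flip (Finset.disjoint_empty_left _), pick_flip (by simpa using hjω),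
          Finset.empty_union, Finset.insert_eq]
      · have ha' : j ∉ a := fun h => htj i (Finset.mem_powerset.mp ha h)
        have hb' : j ∉ b := fun h => htj i (Finset.mem_powerset.mp hb h)
        rw [← Finset.erase_insert ha', ← Finset.erase_insert hb', hab]
    · rw [Finset.disjoint_left]
      intro p hp hp'
      exact (hmem p (Finset.mem_filter.mp hp).1).2.2 (hmem' p (Finset.mem_filter.mp hp').1).2.2

variable [Fintype I] [Finite X]

theorem LinForms.abs_avg_prod_sub_le {ν : I → (I → X) → ℝ} {ε : ℝ} (hν : LinForms ν ε) {j : I}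
    {U : Finset (Finset I)} (hU : U.Nonempty) (hjU : ∀ ω ∈ U, j ∉ ω)
    {S : Finset (I × Finset I)} (hS : ∀ p ∈ S, p.1 ≠ j ∧ p.1 ∉ p.2) :
    |avg fun w : I × Bool → X => (∏ ω ∈ U, (ν j (pick ω w) - 1)) *
      ∏ p ∈ S, ν p.1 (pick p.2 w)| ≤ 2 ^ U.card * ε := by
  have h1 : ∀ t ∈ U.powerset, |(avg fun w : I × Bool → X => (∏ ω ∈ U \ t, ν j (pick ω w)) *
      ∏ p ∈ S, ν p.1 (pick p.2 w)) - 1| ≤ ε := by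
    intro t _
    let S' : Finset (I × Finset I) := (U \ t).image (Prod.mk j) ∪ S
    have hS' : ∀ p ∈ S', p.1 ∉ p.2 := by
      intro p hp
      rcases Finset.mem_union.mp hp with hp | hp
      · obtain ⟨ω, hω, rfl⟩ := Finset.mem_image.mp hp
        exact hjU ω (Finset.mem_sdiff.mp hω).1
      · exact (hS p hp).2
    convert hν S' hS' using 5 with w
    rw [Finset.prod_union, Finset.prod_image fun a _ b _ hab => (Prod.mk.inj hab).2]
    rw [Finset.disjoint_left]
    intro p hp hp'
    obtain ⟨ω, -, rfl⟩ := Finset.mem_image.mp hp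
    exact (hS _ hp').1 rfl
  have h2 : (avg fun w : I × Bool → X => (∏ ω ∈ U, (ν j (pick ω w) - 1)) *
      ∏ p ∈ S, ν p.1 (pick p.2 w)) = ∑ t ∈ U.powerset, (-1) ^ t.card *
        ((avg fun w : I × Bool → X => (∏ ω ∈ U \ t, ν j (pick ω w)) *
      ∏ p ∈ S, ν p.1 (pick p.2 w)) - 1) := by
    have h0 : ∑ t ∈ U.powerset, (-1 : ℝ) ^ t.card = 0 := by
      exact_mod_cast congrArg (Int.cast (R := ℝ))
        (Finset.sum_powerset_neg_one_pow_card_of_nonempty hU)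
    simp only [mul_sub, mul_one, Finset.sum_sub_distrib, h0, sub_zero, ← avg_const_mul, ← avg_sum]
    congr 1
    funext w
    rw [Finset.prod_sub, Finset.sum_mul]
    simp [mul_assoc]
  rw [h2]
  refine (Finset.abs_sum_le_sum_abs _ _).trans ((Finset.sum_le_sum fun t ht => ?_).trans_eq
    (?_ : ∑ t ∈ U.powerset, ε = _))
  · rw [abs_mul, abs_pow, abs_neg, abs_one, one_pow, one_mul]
    exact h1 t ht
  · rw [Finset.sum_const, Finset.card_powerset, nsmul_eq_mul]
    push_cast
    rfl

/-- In averages against products of functions bounded by the weights, the weight `ν j` can be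
replaced by `1`. -/
theorem LinForms.strong [Nonempty X] {ν : I → (I → X) → ℝ} {ε : ℝ} (hν : LinForms ν ε) (hε : ε ≤ 1)
    (hind : ∀ i, Indep i (ν i)) (j : I) {T T' : Finset I} {g g' : I → (I → X) → ℝ}
    (hg : ∀ i, Indep i (g i)) (hg' : ∀ i, Indep i (g' i))
    (hgT : ∀ i v, |g i v| ≤ weight ν T i v) (hgT' : ∀ i v, |g' i v| ≤ weight ν T' i v) :
    |avg fun w : I × Bool → X => (ν j (pick ∅ w) - 1) *
      ∏ i ∈ Finset.univ.erase j, (g i (pick ∅ w) * g' i (pick {j} w))| ^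
        2 ^ (Finset.univ.erase j).card ≤ 4 ^ 2 ^ (Finset.univ.erase j).card * ε := by
  set J : Finset I := Finset.univ.erase j with hJ
  let h : (I × Bool → X) → ℝ := fun w => ν j (pick ∅ w) - 1
  let A : I → (I × Bool → X) → ℝ := fun i w => g i (pick ∅ w) * g' i (pick {j} w)
  let B : I → (I × Bool → X) → ℝ := fun i w =>
    weight ν T i (pick ∅ w) * weight ν T' i (pick {j} w)
  have hne : ∀ i ∈ J, i ≠ j := fun i hi => Finset.ne_of_mem_erase hi
  have key := abs_csAvg_pow_le (J := J) (h := h) (A := A) (B := B)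
    (fun i _ => fun w x => by
      exact congrArg (· - 1) (indep_comp_pick (ν j) (by simp) w x))
    (fun i _ => ((hg i).comp_pick _ _).mul ((hg' i).comp_pick _ _))
    (fun i _ i' hi' => (indep_comp_pick _ (by simp)).mul
      (indep_comp_pick _ (by simp [hne i' hi'])))
    (fun i _ => ((Indep.weight hind T i).comp_pick _ _).mul
      ((Indep.weight hind T' i).comp_pick _ _))
    (fun i _ i' hi' => (indep_comp_pick _ (by simp)).mul
      (indep_comp_pick _ (by simp [hne i' hi'])))
    (fun i _ w => by
      simp only [A, B, abs_mul]
      exact mul_le_mul (hgT _ _) (hgT' _ _) (abs_nonneg _) ((abs_nonneg _).trans (hgT i _)))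
    (C := 2) two_pos
    (fun i hi T₀ hT₀ hiT₀ => by
      obtain ⟨S, hS, hSeq⟩ := exists_prod_weight_eq ν T T' (X := X) (s := {i}) (t := fun _ => T₀)
        (j := j) (by simpa using (hne i hi).symm) (by simpa using hiT₀)
        fun _ hjT => by simpa [hJ] using hT₀ hjT
      have h1 := hν S fun p hp => (hS p hp).2
      simp only [Finset.prod_singleton] at hSeq
      have h2 : flipProd T₀ (B i) = fun w => ∏ p ∈ S, ν p.1 (pick p.2 w) := funext hSeq
      rw [h2]
      linarith [(abs_le.mp h1).2])
  have hQ : |csAvg J h A B J| ≤ 2 ^ 2 ^ J.card * ε := by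
    obtain ⟨S, hS, hSeq⟩ := exists_prod_weight_eq ν T T' (X := X) (s := J) (t := fun i => J.erase i)
      (j := j) (by simp [hJ]) (by simp) (by simp [hJ])
    have h1 := hν.abs_avg_prod_sub_le (j := j) (U := J.powerset) ⟨∅, by simp⟩
      (fun ω hω hj => by simpa [hJ] using Finset.mem_powerset.mp hω hj) hS
    rw [Finset.card_powerset] at h1
    convert h1 using 2
    unfold csAvg
    congr 1
    funext w
    rw [Finset.sdiff_self, Finset.prod_empty, mul_one, ← hSeq]
    congr 1
    refine Finset.prod_congr rfl fun ω _ => ?_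
    simp only [h]
    rw [pick_flip (Finset.disjoint_empty_left _), Finset.empty_union]
  have hE : csAvg J h A B ∅ = avg fun w : I × Bool → X => (ν j (pick ∅ w) - 1) *
      ∏ i ∈ J, (g i (pick ∅ w) * g' i (pick {j} w)) := by
    unfold csAvg
    congr 1
    funext w
    simp [flipProd_empty, h, A]
  rw [hE] at key
  have hε0 : 0 ≤ ε := (abs_nonneg _).trans (hν ∅ (by simp))
  have h4 : (4 : ℝ) ^ 2 ^ J.card = 2 ^ 2 ^ J.card * 2 ^ 2 ^ J.card := by
    rw [← mul_pow]
    norm_num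
  have h5 := key.trans (mul_le_mul_of_nonneg_left hQ (by positivity))
  rw [h4]
  have h6 : 0 ≤ |avg fun w : I × Bool → X => (ν j (pick ∅ w) - 1) *
      ∏ i ∈ J, (g i (pick ∅ w) * g' i (pick {j} w))| ^ 2 ^ J.card := by positivity
  linarith

end LinearForms

section Counting

variable {I X : Type} [Fintype I] [DecidableEq I] [Finite X]

/-- `d` is small in the cut norm with respect to functions independent of a coordinate `i ≠ j`. -/
def CutSmall (j : I) (d : (I → X) → ℝ) (ε : ℝ) : Prop :=
  ∀ u : I → (I → X) → ℝ, (∀ i, Indep i (u i)) → (∀ i v, |u i v| ≤ 1) →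
    |avg fun v => d v * ∏ i ∈ Finset.univ.erase j, u i v| ≤ ε

/-- The average over the coordinate `j` of the product of the functions `g i`, `i ≠ j`. -/
noncomputable def link (j : I) (g : I → (I → X) → ℝ) (v : I → X) : ℝ :=
  avg fun x => ∏ i ∈ Finset.univ.erase j, g i (Function.update v j x)

theorem indep_link (j : I) (g : I → (I → X) → ℝ) : Indep j (link j g) :=
  indep_avg_update j fun v => ∏ i ∈ Finset.univ.erase j, g i v

theorem avg_mul_link [Nonempty X] {j : I} {F : (I → X) → ℝ} (hF : Indep j F) (g : I → (I → X) → ℝ) :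
    (avg fun v => F v * link j g v) = avg fun v => F v * ∏ i ∈ Finset.univ.erase j, g i v :=
  (hF.avg_mul fun v => ∏ i ∈ Finset.univ.erase j, g i v).symm

theorem avg_prod_eq_avg_mul_link [Nonempty X] (j : I) {g : I → (I → X) → ℝ} (hg : Indep j (g j)) :
    (avg fun v => ∏ i, g i v) = avg fun v => g j v * link j g v := by
  rw [avg_mul_link hg]
  congr 1
  funext v
  exact (Finset.mul_prod_erase _ _ (Finset.mem_univ j)).symm

theorem link_mono {j : I} {g g' : I → (I → X) → ℝ} (h0 : ∀ i v, 0 ≤ g i v)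
    (h : ∀ i v, g i v ≤ g' i v) (v : I → X) : link j g v ≤ link j g' v :=
  avg_mono fun _ => Finset.prod_le_prod (fun _ _ => h0 _ _) fun _ _ => h _ _

theorem link_nonneg {j : I} {g : I → (I → X) → ℝ} (h0 : ∀ i v, 0 ≤ g i v) (v : I → X) :
    0 ≤ link j g v := avg_nonneg fun _ => Finset.prod_nonneg fun _ _ => h0 _ _

theorem abs_avg_prod_sub_le_of_cutSmall {g h : I → (I → X) → ℝ} {ε : ℝ}
    (hg : ∀ i, Indep i (g i)) (hh : ∀ i, Indep i (h i)) (hg1 : ∀ i v, |g i v| ≤ 1)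
    (hh1 : ∀ i v, |h i v| ≤ 1) (hgh : ∀ j, CutSmall j (fun v => g j v - h j v) ε) :
    |(avg fun v => ∏ i, g i v) - avg fun v => ∏ i, h i v| ≤ Fintype.card I * ε := by
  classical
  suffices H : ∀ s : Finset I, |(avg fun v => ∏ i, g i v) -
      avg fun v => ∏ i, (if i ∈ s then h i v else g i v)| ≤ s.card * ε by
    simpa using H Finset.univ
  intro s
  induction s using Finset.induction_on with
  | empty => simp
  | insert j s hj ih =>
    let u : I → (I → X) → ℝ := fun i v => if i ∈ s then h i v else g i v
    have hu : ∀ i, Indep i (u i) := fun i w x => by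
      simp only [u, hg i w x, hh i w x]
    have h1 := hgh j u hu fun i v => by
      simp only [u]
      split_ifs
      exacts [hh1 i v, hg1 i v]
    have h2 : (avg fun v => (g j v - h j v) * ∏ i ∈ Finset.univ.erase j, u i v) =
        (avg fun v => ∏ i, (if i ∈ s then h i v else g i v)) -
          avg fun v => ∏ i, (if i ∈ insert j s then h i v else g i v) := by
      rw [← avg_sub]
      congr 1
      funext v
      rw [← Finset.mul_prod_erase _ _ (Finset.mem_univ j),
        ← Finset.mul_prod_erase _ (fun i => if i ∈ insert j s then h i v else g i v)
          (Finset.mem_univ j), if_neg hj, if_pos (Finset.mem_insert_self _ _), sub_mul]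
      congr 2
      refine Finset.prod_congr rfl fun i hi => ?_
      simp [u, Finset.ne_of_mem_erase hi]
    rw [h2] at h1
    rw [Finset.card_insert_of_notMem hj]
    push_cast
    rw [abs_le] at *
    constructor <;> linarith [h1.1, h1.2, ih.1, ih.2]

variable [AddCommGroup X]

theorem link_le_one {j : I} {g : I → (I → X) → ℝ} (h0 : ∀ i v, 0 ≤ g i v)
    (h : ∀ i v, g i v ≤ 1) (v : I → X) : link j g v ≤ 1 :=
  avg_le_of_le fun _ => Finset.prod_le_one (fun _ _ => h0 _ _) fun _ _ => h _ _

theorem avg_mul_pick (j : I) (P Q : (I → X) → ℝ) :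
    (avg fun w : I × Bool → X => P (pick ∅ w) * Q (pick {j} w)) =
      avg fun v => P v * avg fun x => Q (Function.update v j x) := by
  let φ : (I × Bool → X) →+ (I → X) × X :=
    { toFun := fun w => (pick ∅ w, w (j, true))
      map_zero' := rfl
      map_add' := fun _ _ => rfl }
  have hφ : Function.Surjective φ := fun ⟨v, x⟩ =>
    ⟨fun p => if p.2 then x else v p.1, by
      refine Prod.ext (funext fun i => ?_) rfl
      change (if decide (i ∈ (∅ : Finset I)) = true then x else v i) = v i
      simp⟩
  have hpick : ∀ w : I × Bool → X, pick {j} w = Function.update (pick ∅ w) j (w (j, true)) := by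
    intro w
    funext i
    by_cases hi : i = j
    · subst hi
      simp [pick]
    · simp [pick, hi]
  have h := avg_comp_addMonoidHom hφ fun p => P p.1 * Q (Function.update p.1 j p.2)
  rw [avg_prod] at h
  simp only [avg_const_mul] at h
  rw [← h]
  simp only [hpick]
  rfl

theorem avg_mul_link_mul_link {j : I} {F : (I → X) → ℝ} (hF : Indep j F)
    (g g' : I → (I → X) → ℝ) :
    (avg fun v => F v * link j g v * link j g' v) = avg fun w : I × Bool → X =>
      F (pick ∅ w) * ∏ i ∈ Finset.univ.erase j, (g i (pick ∅ w) * g' i (pick {j} w)) := by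
  have h1 := avg_mul_pick j (fun v => F v * ∏ i ∈ Finset.univ.erase j, g i v)
    fun v => ∏ i ∈ Finset.univ.erase j, g' i v
  simp only [Finset.prod_mul_distrib]
  calc (avg fun v => F v * link j g v * link j g' v)
      = avg fun v => F v * link j g' v * link j g v := by
        congr 1
        funext v
        ring
    _ = avg fun v => F v * link j g' v * ∏ i ∈ Finset.univ.erase j, g i v :=
        avg_mul_link (hF.mul (indep_link j g')) g
    _ = avg fun v => (F v * ∏ i ∈ Finset.univ.erase j, g i v) * link j g' v := by
        congr 1
        funext v
        ring
    _ = avg fun w : I × Bool → X => (F (pick ∅ w) * ∏ i ∈ Finset.univ.erase j, g i (pick ∅ w)) *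
          ∏ i ∈ Finset.univ.erase j, g' i (pick {j} w) := h1.symm
    _ = _ := by
        congr 1
        funext w
        ring

theorem LinForms.abs_avg_sub_one_mul_link_le {ν : I → (I → X) → ℝ} {ε κ : ℝ}
    (hν : LinForms ν ε) (hε : ε ≤ 1) (hind : ∀ i, Indep i (ν i)) (hκ : 0 ≤ κ)
    (hεκ : 4 ^ 2 ^ Fintype.card I * ε ≤ min κ 1 ^ 2 ^ Fintype.card I) (j : I) {T T' : Finset I}
    {g g' : I → (I → X) → ℝ}
    (hg : ∀ i, Indep i (g i)) (hg' : ∀ i, Indep i (g' i))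
    (hgT : ∀ i v, |g i v| ≤ weight ν T i v) (hgT' : ∀ i v, |g' i v| ≤ weight ν T' i v) :
    |avg fun v => (ν j v - 1) * link j g v * link j g' v| ≤ κ := by
  have hF : Indep j fun v => ν j v - 1 := fun w x => congrArg (· - 1) (hind j w x)
  rw [avg_mul_link_mul_link hF]
  have hε0 : 0 ≤ ε := (abs_nonneg _).trans (hν ∅ (by simp))
  have hcard : 2 ^ (Finset.univ.erase j).card ≤ 2 ^ Fintype.card I :=
    Nat.pow_le_pow_right two_pos (Finset.card_le_univ _)
  refine le_of_pow_le_pow_left₀ (n := 2 ^ (Finset.univ.erase j).card) (by positivity) hκ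
    ((hν.strong hε hind j hg hg' hgT hgT').trans ?_)
  calc (4 : ℝ) ^ 2 ^ (Finset.univ.erase j).card * ε ≤ 4 ^ 2 ^ Fintype.card I * ε := by
        gcongr
        norm_num
    _ ≤ min κ 1 ^ 2 ^ Fintype.card I := hεκ
    _ ≤ min κ 1 ^ 2 ^ (Finset.univ.erase j).card :=
        pow_le_pow_of_le_one (by positivity) (min_le_right _ _) hcard
    _ ≤ _ := by
        gcongr
        exact min_le_left _ _

theorem LinForms.abs_avg_link_mul_link_sub_one_le {ν : I → (I → X) → ℝ} {ε : ℝ}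
    (hν : LinForms ν ε) (j : I) (T T' : Finset I) :
    |(avg fun v => link j (weight ν T) v * link j (weight ν T') v) - 1| ≤ ε := by
  have h := avg_mul_link_mul_link (indep_const j 1) (weight ν T) (weight ν T')
  simp only [one_mul] at h
  rw [h]
  obtain ⟨S, hS, hSeq⟩ := exists_prod_weight_eq ν T T' (X := X) (s := Finset.univ.erase j)
    (t := fun _ => ∅) (j := j) (by simp) (by simp) (by simp)
  simp only [flipProd_empty] at hSeq
  simp only [hSeq]
  exact hν S fun p hp => (hS p hp).2

theorem LinForms.avg_le {ν : I → (I → X) → ℝ} {ε : ℝ} (hν : LinForms ν ε) (j : I) :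
    avg (ν j) ≤ 1 + ε := by
  have h := avg_mul_pick j (ν j) fun _ => 1
  simp only [mul_one, avg_const] at h
  have h1 := hν {(j, ∅)} (by simp)
  simp only [Finset.prod_singleton] at h1
  rw [h] at h1
  have h2 : (avg fun v => ν j v) = avg (ν j) := rfl
  linarith [(abs_le.mp h1).2]

theorem LinForms.avg_sq_link_sub_one_le {ν : I → (I → X) → ℝ} {ε : ℝ}
    (hν : LinForms ν ε) (j : I) (T : Finset I) :
    (avg fun v => (link j (weight ν T) v - 1) ^ 2) ≤ 3 * ε := by
  have h1 := abs_le.mp (hν.abs_avg_link_mul_link_sub_one_le j T T)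
  have h2 := abs_le.mp (hν.abs_avg_link_mul_link_sub_one_le j T ∅)
  have h3 : ∀ v, link j (weight ν ∅) v = 1 := fun v => by
    simp [link, weight_empty, avg_const]
  simp only [h3, mul_one] at h2
  have h4 : (avg fun v => (link j (weight ν T) v - 1) ^ 2) =
      (avg fun v => link j (weight ν T) v * link j (weight ν T) v) -
        2 * (avg fun v => link j (weight ν T) v) + 1 := by
    have h5 : (fun v => (link j (weight ν T) v - 1) ^ 2) = fun v =>
        link j (weight ν T) v * link j (weight ν T) v - 2 * link j (weight ν T) v + 1 :=
      funext fun v => by ring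
    rw [h5, avg_add, avg_sub, avg_const_mul, avg_const]
  rw [h4]
  linarith

end Counting

section Counting

/-- The conclusion of the relative counting lemma, for hypergraphs whose edges outside `T` are
bounded by `1`. -/
def CountingOn (I : Type) [Fintype I] [DecidableEq I] (T : Finset I) : Prop :=
  ∀ η : ℝ, 0 < η → ∃ ε : ℝ, 0 < ε ∧ ∀ (X : Type) [AddCommGroup X] [Finite X]
    (ν g h : I → (I → X) → ℝ), LinForms ν ε → (∀ i, Indep i (ν i)) → (∀ i v, 0 ≤ ν i v) →
    (∀ i, Indep i (g i)) → (∀ i, Indep i (h i)) → (∀ i v, 0 ≤ g i v) →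
    (∀ i v, g i v ≤ weight ν T i v) → (∀ i v, 0 ≤ h i v) → (∀ i v, h i v ≤ 1) →
    (∀ j, CutSmall j (fun v => g j v - h j v) ε) →
    |(avg fun v => ∏ i, g i v) - avg fun v => ∏ i, h i v| ≤ η

variable {I : Type} [Fintype I] [DecidableEq I]

theorem LinForms.mono {X : Type} [Finite X] {ν : I → (I → X) → ℝ} {ε ε' : ℝ}
    (h : LinForms ν ε) (hε : ε ≤ ε') : LinForms ν ε' := fun S hS => (h S hS).trans hε

theorem CutSmall.mono {X : Type} [Finite X] {j : I} {d : (I → X) → ℝ} {ε ε' : ℝ}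
    (h : CutSmall j d ε) (hε : ε ≤ ε') : CutSmall j d ε' := fun u hu hu1 => (h u hu hu1).trans hε

theorem countingOn_empty : CountingOn I ∅ := by
  intro η hη
  refine ⟨η / (Fintype.card I + 1), by positivity, fun X _ _ ν g h _ _ _ hg hh hg0 hg1 hh0 hh1
    hgh => ?_⟩
  simp only [weight_empty] at hg1
  refine (abs_avg_prod_sub_le_of_cutSmall hg hh (fun i v => abs_le.mpr ⟨?_, hg1 i v⟩)
    (fun i v => abs_le.mpr ⟨?_, hh1 i v⟩) hgh).trans ?_
  · linarith [hg0 i v]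
  · linarith [hh0 i v]
  · rw [mul_div_assoc', div_le_iff₀ (by positivity)]
    nlinarith

/-- Replacing a sparse edge by a dense one. -/
theorem CountingOn.abs_avg_link_le {X : Type} [AddCommGroup X] [Finite X] {T : Finset I} {j : I}
    (hj : j ∉ T) {ν g h : I → (I → X) → ℝ} {ε η : ℝ} (hε : 0 ≤ ε)
    (hg : ∀ i, Indep i (g i)) (hh : ∀ i, Indep i (h i)) (hg0 : ∀ i v, 0 ≤ g i v)
    (hgT : ∀ i v, g i v ≤ weight ν (insert j T) i v) (hh0 : ∀ i v, 0 ≤ h i v)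
    (hh1 : ∀ i v, h i v ≤ 1) (hgh : ∀ j, CutSmall j (fun v => g j v - h j v) ε)
    (H : ∀ (g h : I → (I → X) → ℝ),
      (∀ i, Indep i (g i)) → (∀ i, Indep i (h i)) → (∀ i v, 0 ≤ g i v) →
      (∀ i v, g i v ≤ weight ν T i v) → (∀ i v, 0 ≤ h i v) → (∀ i v, h i v ≤ 1) →
      (∀ j, CutSmall j (fun v => g j v - h j v) ε) →
      |(avg fun v => ∏ i, g i v) - avg fun v => ∏ i, h i v| ≤ η)
    {c : (I → X) → ℝ} (hc : Indep j c) (hc0 : ∀ v, 0 ≤ c v) (hc1 : ∀ v, c v ≤ 1) :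
    |avg fun v => c v * (link j g v - link j h v)| ≤ η := by
  have hlink : ∀ g : I → (I → X) → ℝ, link j (Function.update g j c) = link j g := by
    intro g
    funext v
    unfold link
    congr 1
    funext x
    refine Finset.prod_congr rfl fun i hi => ?_
    rw [Function.update_of_ne (Finset.ne_of_mem_erase hi)]
  have hprod : ∀ g : I → (I → X) → ℝ, (avg fun v => ∏ i, Function.update g j c i v) =
      avg fun v => c v * link j g v := by
    intro g
    rw [avg_prod_eq_avg_mul_link j (by simpa using hc), hlink, Function.update_self]
  have h1 := H (Function.update g j c) (Function.update h j c) ?_ ?_ ?_ ?_ ?_ ?_ ?_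
  · rw [hprod, hprod, ← avg_sub] at h1
    simpa only [mul_sub] using h1
  all_goals
    intro i
    by_cases hi : i = j
    · subst hi
      simp only [Function.update_self]
      first
      | assumption
      | (intro v; simpa [weight, hj] using hc1 v)
      | (intro u _ _; simpa [avg_const] using hε)
    · simp only [Function.update_of_ne hi]
      first
      | exact hg i
      | exact hh i
      | exact hg0 i
      | exact hh0 i
      | exact hh1 i
      | exact hgh i
      | exact fun v => (hgT i v).trans_eq (by simp [weight, hi])

theorem countingOn_insert {T : Finset I} {j : I} (hj : j ∉ T) (ih : CountingOn I T) :
    CountingOn I (insert j T) := by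
  intro η hη
  set κ : ℝ := min (η ^ 2 / 64) 1 with hκdef
  have hκ : 0 < κ := by positivity
  obtain ⟨ε₁, hε₁, ih⟩ := ih (κ / 2) (by positivity)
  set ε : ℝ := min (min ε₁ (η / 2)) (min (κ ^ 2 / 64)
    ((κ / 4) ^ 2 ^ Fintype.card I / 4 ^ 2 ^ Fintype.card I)) with hεdef
  have hε : 0 < ε := by positivity
  have hεε₁ : ε ≤ ε₁ := (min_le_left _ _).trans (min_le_left _ _)
  have hεη : ε ≤ η / 2 := (min_le_left _ _).trans (min_le_right _ _)
  have hεκ : ε ≤ κ ^ 2 / 64 := (min_le_right _ _).trans (min_le_left _ _)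
  have hεs : 4 ^ 2 ^ Fintype.card I * ε ≤ min (κ / 4) 1 ^ 2 ^ Fintype.card I := by
    have h1 : ε ≤ (κ / 4) ^ 2 ^ Fintype.card I / 4 ^ 2 ^ Fintype.card I :=
      (min_le_right _ _).trans (min_le_right _ _)
    rw [min_eq_left (by linarith [min_le_right (η ^ 2 / 64) 1]), mul_comm]
    rwa [le_div_iff₀ (by positivity)] at h1
  have hκ1 : κ ≤ 1 := min_le_right _ _
  have hκη : κ ≤ η ^ 2 / 64 := min_le_left _ _
  have hε1 : ε ≤ 1 := by nlinarith
  refine ⟨ε, hε, fun X _ _ ν g h hν hνi hν0 hg hh hg0 hgT hh0 hh1 hgh => ?_⟩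
  let G : (I → X) → ℝ := link j g
  let H : (I → X) → ℝ := link j h
  let V : (I → X) → ℝ := link j (weight ν (insert j T))
  let c : (I → X) → ℝ := fun v => min (G v) 1
  have hG0 : ∀ v, 0 ≤ G v := link_nonneg hg0
  have hH0 : ∀ v, 0 ≤ H v := link_nonneg hh0
  have hH1 : ∀ v, H v ≤ 1 := link_le_one hh0 hh1
  have hGV : ∀ v, G v ≤ V v := link_mono hg0 hgT
  have hGi : Indep j G := indep_link j g
  have hHi : Indep j H := indep_link j h
  have hci : Indep j c := fun w x => by simp only [c, hGi w x]
  have hrepl : ∀ c : (I → X) → ℝ, Indep j c → (∀ v, 0 ≤ c v) → (∀ v, c v ≤ 1) →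
      |avg fun v => c v * (G v - H v)| ≤ κ / 2 := fun c hc hc0 hc1 =>
    CountingOn.abs_avg_link_le hj hε.le hg hh hg0 hgT hh0 hh1 hgh
      (fun g h h1 h2 h3 h4 h5 h6 h7 => ih X ν g h (hν.mono hεε₁) hνi hν0 h1 h2 h3 h4 h5 h6
        fun j => (h7 j).mono hεε₁) hc hc0 hc1
  have hdense : (avg fun v => (G v - H v) ^ 2) ≤ 2 * κ := by
    have h1 := abs_le.mp (hrepl c hci (fun v => le_min (hG0 v) zero_le_one)
      fun v => min_le_right _ _)
    have h2 := abs_le.mp (hrepl H hHi hH0 hH1)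
    have h3 : ∀ v, (G v - H v) ^ 2 ≤ c v * (G v - H v) - H v * (G v - H v) +
        ((1 + 4 / κ) * (V v - 1) ^ 2 + κ / 4) := by
      intro v
      have h4 : (G v - H v) * (G v - c v) ≤ (1 + 4 / κ) * (V v - 1) ^ 2 + κ / 4 := by
        have hpos : 0 ≤ (1 + 4 / κ) * (V v - 1) ^ 2 + κ / 4 := by positivity
        rcases le_total (G v) 1 with hG | hG
        · simpa [c, hG] using hpos
        · have hc : c v = 1 := min_eq_right hG
          have h5 : (G v - H v) * (G v - c v) ≤ ((V v - 1) + 1) * (V v - 1) := by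
            rw [hc]
            exact mul_le_mul (by linarith [hGV v, hH0 v]) (by linarith [hGV v]) (by linarith)
              (by linarith [hGV v])
          have h6 : V v - 1 ≤ 4 / κ * (V v - 1) ^ 2 + κ / 4 := by
            have h7 : 0 ≤ (4 / κ) * ((V v - 1) - κ / 8) ^ 2 := by positivity
            have h8 : (4 / κ) * ((V v - 1) - κ / 8) ^ 2 =
                4 / κ * (V v - 1) ^ 2 - (V v - 1) + κ / 16 := by
              field_simp
              ring
            linarith
          linarith
      linarith
    refine (avg_mono h3).trans ?_
    rw [avg_add, avg_sub, avg_add, avg_const_mul, avg_const]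
    have h5 := hν.avg_sq_link_sub_one_le j (insert j T)
    have h6 : (1 + 4 / κ) * (avg fun v => (V v - 1) ^ 2) ≤ (1 + 4 / κ) * (3 * ε) := by gcongr
    have h7 : (1 + 4 / κ) * (3 * ε) ≤ (1 + 4 / κ) * (3 * (κ ^ 2 / 64)) := by gcongr
    have h8 : (1 + 4 / κ) * (3 * (κ ^ 2 / 64)) = 3 * κ ^ 2 / 64 + 12 * κ / 64 := by
      field_simp
      ring
    nlinarith
  have hsparse : (avg fun v => ν j v * (G v - H v) ^ 2) ≤ 3 * κ := by
    have hgb : ∀ i v, |g i v| ≤ weight ν (insert j T) i v := fun i v => by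
      rw [abs_of_nonneg (hg0 i v)]
      exact hgT i v
    have hhb : ∀ i v, |h i v| ≤ weight ν ∅ i v := fun i v => by
      rw [abs_of_nonneg (hh0 i v), weight_empty]
      exact hh1 i v
    have h1 := abs_le.mp (hν.abs_avg_sub_one_mul_link_le hε1 hνi (by positivity) hεs j
      hg hg hgb hgb)
    have h2 := abs_le.mp (hν.abs_avg_sub_one_mul_link_le hε1 hνi (by positivity) hεs j
      hg hh hgb hhb)
    have h3 := abs_le.mp (hν.abs_avg_sub_one_mul_link_le hε1 hνi (by positivity) hεs j
      hh hh hhb hhb)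
    have h4 : (fun v => ν j v * (G v - H v) ^ 2) = fun v =>
        ((ν j v - 1) * link j g v * link j g v - 2 * ((ν j v - 1) * link j g v * link j h v) +
          (ν j v - 1) * link j h v * link j h v) + (G v - H v) ^ 2 :=
      funext fun v => by
        simp only [G, H]
        ring
    rw [h4, avg_add, avg_add, avg_sub, avg_const_mul]
    linarith
  have hmain : |avg fun v => g j v * (G v - H v)| ≤ η / 2 := by
    refine (abs_avg_le _).trans ?_
    have h1 : ∀ v, |g j v * (G v - H v)| ≤ 2 / η * (ν j v * (G v - H v) ^ 2) + η / 8 * ν j v := by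
      intro v
      rw [abs_mul, abs_of_nonneg (hg0 j v)]
      have h2 : g j v ≤ ν j v := (hgT j v).trans_eq (by simp [weight])
      have h3 : |G v - H v| ≤ 2 / η * (G v - H v) ^ 2 + η / 8 := by
        have h7 : 0 ≤ (2 / η) * (|G v - H v| - η / 4) ^ 2 := by positivity
        have h8 : (2 / η) * (|G v - H v| - η / 4) ^ 2 =
            2 / η * |G v - H v| ^ 2 - |G v - H v| + η / 8 := by
          field_simp
          ring
        rw [sq_abs] at h8
        linarith
      calc g j v * |G v - H v| ≤ ν j v * (2 / η * (G v - H v) ^ 2 + η / 8) :=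
            mul_le_mul h2 h3 (abs_nonneg _) (hν0 j v)
        _ = _ := by ring
    refine (avg_mono h1).trans ?_
    rw [avg_add, avg_const_mul, avg_const_mul]
    have h2 : avg (fun v => ν j v) ≤ 1 + ε := hν.avg_le j
    have h3 : 2 / η * (avg fun v => ν j v * (G v - H v) ^ 2) ≤ 2 / η * (3 * (η ^ 2 / 64)) := by
      gcongr
      linarith
    have h4 : 2 / η * (3 * (η ^ 2 / 64)) = 6 * η / 64 := by
      field_simp
      norm_num
    have h5 : η / 8 * avg (fun v => ν j v) ≤ η / 8 * 2 := by
      gcongr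
      linarith
    linarith
  have hcut := hgh j h hh fun i v => abs_le.mpr ⟨by linarith [hh0 i v], hh1 i v⟩
  have hgh' : Indep j fun v => g j v - h j v := fun w x => by simp only [hg j w x, hh j w x]
  rw [← avg_mul_link hgh'] at hcut
  rw [avg_prod_eq_avg_mul_link j (hg j), avg_prod_eq_avg_mul_link j (hh j), ← avg_sub]
  have hsplit : (avg fun v => g j v * link j g v - h j v * link j h v) =
      (avg fun v => g j v * (G v - H v)) + avg fun v => (g j v - h j v) * link j h v := by
    rw [← avg_add]
    congr 1
    funext v
    simp only [G, H]
    ring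
  rw [hsplit]
  exact (abs_add_le _ _).trans (by linarith)

/-- The relative counting lemma. -/
theorem countingOn_univ : CountingOn I Finset.univ := by
  refine Finset.induction_on (motive := CountingOn I) _ countingOn_empty fun j T hj ih => ?_
  exact countingOn_insert hj ih

end Counting

section DenseModel

theorem mul_mem_convexHull {Z : Type*} {Φ : Set (Z → ℝ)}
    (hmul : ∀ φ ∈ Φ, ∀ φ' ∈ Φ, φ * φ' ∈ convexHull ℝ Φ) {ψ ψ' : Z → ℝ}
    (hψ : ψ ∈ convexHull ℝ Φ) (hψ' : ψ' ∈ convexHull ℝ Φ) : ψ * ψ' ∈ convexHull ℝ Φ := by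
  have h1 : ∀ φ ∈ Φ, convexHull ℝ Φ ⊆ {ψ' | φ * ψ' ∈ convexHull ℝ Φ} := fun φ hφ =>
    convexHull_min (fun φ' hφ' => hmul φ hφ φ' hφ')
      ((convex_convexHull ℝ Φ).linear_preimage (LinearMap.mulLeft ℝ φ))
  have h2 : convexHull ℝ Φ ⊆ {ψ | ψ * ψ' ∈ convexHull ℝ Φ} :=
    convexHull_min (fun φ hφ => h1 φ hφ hψ')
      ((convex_convexHull ℝ Φ).linear_preimage (LinearMap.mulRight ℝ ψ'))
  exact h2 hψ

variable {Z : Type*} [Finite Z]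

/-- The linear functional `f ↦ 𝔼 f φ`. -/
noncomputable def avgMul (φ : Z → ℝ) : (Z → ℝ) →ₗ[ℝ] ℝ where
  toFun f := avg fun x => f x * φ x
  map_add' f g := by simp only [Pi.add_apply, add_mul, avg_add]
  map_smul' c f := by simp only [Pi.smul_apply, smul_eq_mul, mul_assoc, avg_const_mul,
    RingHom.id_apply]

theorem avgMul_apply (φ f : Z → ℝ) : avgMul φ f = avg fun x => f x * φ x := rfl

theorem avgMul_comm (φ f : Z → ℝ) : avgMul φ f = avgMul f φ := by
  simp only [avgMul_apply, mul_comm]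

theorem continuous_avgMul (φ : Z → ℝ) : Continuous (avgMul φ) :=
  LinearMap.continuous_of_finiteDimensional _

theorem abs_avgMul_le_of_mem_convexHull {Φ : Set (Z → ℝ)} {f : Z → ℝ} {ε : ℝ}
    (h : ∀ φ ∈ Φ, |avgMul f φ| ≤ ε) {ψ : Z → ℝ} (hψ : ψ ∈ convexHull ℝ Φ) :
    |avgMul f ψ| ≤ ε := by
  have h1 : convexHull ℝ Φ ⊆ avgMul f ⁻¹' Set.Icc (-ε) ε :=
    convexHull_min (fun φ hφ => abs_le.mp (h φ hφ)) ((convex_Icc _ _).linear_preimage _)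
  exact abs_le.mpr (h1 hψ)

theorem abs_avgMul_pow_le {Φ : Set (Z → ℝ)} (h1 : 1 ∈ Φ)
    (hmul : ∀ φ ∈ Φ, ∀ φ' ∈ Φ, φ * φ' ∈ convexHull ℝ Φ) {f : Z → ℝ} {ε : ℝ}
    (h : ∀ φ ∈ Φ, |avgMul f φ| ≤ ε) {ψ : Z → ℝ} (hψ : ψ ∈ convexHull ℝ Φ) (n : ℕ) :
    |avgMul f (ψ ^ n)| ≤ ε := by
  refine abs_avgMul_le_of_mem_convexHull h ?_
  induction n with
  | zero => exact subset_convexHull ℝ Φ (by simpa using h1)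
  | succ n ih =>
    rw [pow_succ]
    exact mul_mem_convexHull hmul ih hψ

/-- If no bounded function approximates `f` on `Φ`, then one function in the convex hull of `Φ`
witnesses this uniformly. -/
theorem exists_mem_convexHull_lt_avgMul {Φ : Set (Z → ℝ)} {f : Z → ℝ} {η : ℝ}
    (h : ∀ g ∈ Set.Icc (0 : Z → ℝ) 1, ∃ φ ∈ Φ, η < avgMul φ (f - g)) :
    ∃ ψ ∈ convexHull ℝ Φ, ∀ g ∈ Set.Icc (0 : Z → ℝ) 1, η < avgMul ψ (f - g) := by
  have hcomp : IsCompact (Set.Icc (0 : Z → ℝ) 1) := isCompact_Icc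
  have hcont : ∀ φ : Z → ℝ, Continuous fun g : Z → ℝ => avgMul φ (f - g) := fun φ =>
    (continuous_avgMul φ).comp (continuous_const.sub continuous_id)
  obtain ⟨t, ht, htf, hcov⟩ := hcomp.elim_finite_subcover_image (b := Φ)
    (c := fun φ => {g | η < avgMul φ (f - g)})
    (fun φ _ => isOpen_lt continuous_const (hcont φ)) (fun g hg => by
      obtain ⟨φ, hφ, hlt⟩ := h g hg
      exact Set.mem_biUnion hφ hlt)
  have haff : ∀ (φ g g' : Z → ℝ) (a b : ℝ), a + b = 1 →
      avgMul φ (f - (a • g + b • g')) = a * avgMul φ (f - g) + b * avgMul φ (f - g') := by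
    intro φ g g' a b hab
    simp only [map_sub, map_add, map_smul, smul_eq_mul]
    linear_combination -avgMul φ f * hab
  have hsymm : ∀ g : Z → ℝ, ⇑(avgMul (f - g)) = fun ψ => avgMul ψ (f - g) := fun g =>
    funext fun ψ => avgMul_comm _ _
  refine Sion.exists_lt_iInf_of_lt_iInf_of_finite (X := Set.Icc (0 : Z → ℝ) 1)
    (Y := convexHull ℝ Φ) (f := fun g ψ => avgMul ψ (f - g)) ⟨0, by simp⟩ hcomp
    (fun ψ _ => (hcont ψ).continuousOn.lowerSemicontinuousOn) (fun ψ _ => ?_)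
    (convex_convexHull ℝ Φ) (fun g _ => ?_) (fun g _ => ?_) (convex_Icc _ _) htf
    (ht.trans (subset_convexHull ℝ Φ)) (fun g hg => ?_)
  · refine ConvexOn.quasiconvexOn ⟨convex_Icc _ _, fun g _ g' _ a b _ _ hab => ?_⟩
    exact (haff ψ g g' a b hab).le
  · have h1 := ((continuous_avgMul (f - g)).continuousOn
      (s := convexHull ℝ Φ)).upperSemicontinuousOn
    exact hsymm g ▸ h1
  · have h1 := ((avgMul (f - g)).concaveOn (convex_convexHull ℝ Φ)).quasiconcaveOn
    exact hsymm g ▸ h1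
  · simpa using hcov hg

/-- The dense model theorem. -/
theorem dense_model {η : ℝ} (hη : 0 < η) : ∃ ε : ℝ, 0 < ε ∧ ∀ (Z : Type) [Finite Z] [Nonempty Z]
    (Φ : Set (Z → ℝ)) (ν f : Z → ℝ), (∀ φ ∈ Φ, ∀ x, |φ x| ≤ 1) → 1 ∈ Φ →
    (∀ φ ∈ Φ, -φ ∈ Φ) → (∀ φ ∈ Φ, ∀ φ' ∈ Φ, φ * φ' ∈ convexHull ℝ Φ) →
    (∀ φ ∈ Φ, |avgMul (ν - 1) φ| ≤ ε) → (∀ x, 0 ≤ f x) → (∀ x, f x ≤ ν x) →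
    ∃ g : Z → ℝ, (∀ x, 0 ≤ g x) ∧ (∀ x, g x ≤ 1) ∧ ∀ φ ∈ Φ, |avgMul φ (f - g)| ≤ η := by
  obtain ⟨p, hp⟩ := exists_polynomial_near_of_continuousOn (-1) 1 (fun x => max x 0)
    (continuous_id.max continuous_const).continuousOn (η / 8) (by positivity)
  set C : ℝ := ∑ n ∈ p.support, |p.coeff n| with hC
  have hC0 : 0 ≤ C := Finset.sum_nonneg fun _ _ => abs_nonneg _
  refine ⟨min 1 (η / 4 / (C + 1)), by positivity, fun Z _ _ Φ ν f hΦ h1 hneg hmul hν hf hfν => ?_⟩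
  by_contra! hcon
  set ε := min 1 (η / 4 / (C + 1)) with hε
  have hcon' : ∀ g ∈ Set.Icc (0 : Z → ℝ) 1, ∃ φ ∈ Φ, η < avgMul φ (f - g) := by
    intro g hg
    obtain ⟨φ, hφ, hlt⟩ := hcon g hg.1 hg.2
    rcases lt_abs.mp hlt with h | h
    · exact ⟨φ, hφ, h⟩
    · refine ⟨-φ, hneg φ hφ, ?_⟩
      rwa [avgMul_comm, map_neg, avgMul_comm]
  obtain ⟨ψ, hψ, hψ2⟩ := exists_mem_convexHull_lt_avgMul hcon'
  have hψ1 : ∀ x, ψ x ∈ Set.Icc (-1 : ℝ) 1 := by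
    intro x
    have h2 : convexHull ℝ Φ ⊆ LinearMap.proj (R := ℝ) (φ := fun _ : Z => ℝ) x ⁻¹'
        Set.Icc (-1) 1 :=
      convexHull_min (fun φ hφ => abs_le.mp (hΦ φ hφ x)) ((convex_Icc _ _).linear_preimage _)
    exact h2 hψ
  have h2 := hψ2 (fun x => if 0 < ψ x then 1 else 0)
    ⟨fun x => by dsimp; split_ifs <;> simp, fun x => by dsimp; split_ifs <;> simp⟩
  have h3 : avgMul ψ (f - fun x => if 0 < ψ x then 1 else 0) ≤
      avg fun x => (ν x - 1) * max (ψ x) 0 := by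
    refine avg_mono fun x => ?_
    simp only [Pi.sub_apply]
    split_ifs with h
    · rw [max_eq_left h.le]
      nlinarith [hfν x]
    · rw [max_eq_right (not_lt.mp h)]
      nlinarith [hf x, not_lt.mp h]
  have h4 : (avg fun x => (ν x - 1) * max (ψ x) 0) ≤
      (avg fun x => (ν x - 1) * p.eval (ψ x)) + avg fun x => (η / 8 * (ν x - 1) + η / 4) := by
    rw [← avg_add]
    refine avg_mono fun x => ?_
    have h5 := abs_lt.mp (hp (ψ x) (hψ1 x))
    have h6 : 0 ≤ ν x := (hf x).trans (hfν x)
    nlinarith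
  have h5 : (avg fun x => (η / 8 * (ν x - 1) + η / 4)) ≤ η / 8 * 1 + η / 4 := by
    rw [avg_add, avg_const_mul, avg_const]
    have h6 := (abs_le.mp (hν 1 h1)).2
    simp only [avgMul_apply, Pi.one_apply, Pi.sub_apply, one_mul] at h6
    have h7 : ε ≤ 1 := min_le_left _ _
    gcongr
    linarith
  have h6 : (avg fun x => (ν x - 1) * p.eval (ψ x)) ≤ η / 4 := by
    have h7 : (fun x => (ν x - 1) * p.eval (ψ x)) = fun x =>
        ∑ n ∈ p.support, p.coeff n * ((ψ ^ n) x * (ν - 1) x) := by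
      funext x
      rw [Polynomial.eval_eq_sum, Polynomial.sum, Finset.mul_sum]
      refine Finset.sum_congr rfl fun n _ => ?_
      simp only [Pi.pow_apply, Pi.sub_apply, Pi.one_apply]
      ring
    rw [h7, avg_sum]
    calc _ ≤ ∑ n ∈ p.support, |p.coeff n| * ε := Finset.sum_le_sum fun n _ => by
          rw [avg_const_mul]
          refine (le_abs_self _).trans ?_
          rw [abs_mul]
          exact mul_le_mul_of_nonneg_left (abs_avgMul_pow_le h1 hmul hν hψ n) (abs_nonneg _)
      _ = C * ε := by rw [← Finset.sum_mul]
      _ ≤ (C + 1) * (η / 4 / (C + 1)) := by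
          gcongr
          · linarith
          · exact min_le_right _ _
      _ = η / 4 := by field_simp
  linarith

end DenseModel

section DualFunctions

theorem avg_mem_convexHull {Y Z : Type*} [Finite Y] [Nonempty Y] {Φ : Set (Z → ℝ)} {φ : Y → Z → ℝ}
    (h : ∀ y, φ y ∈ Φ) : (fun x => avg fun y => φ y x) ∈ convexHull ℝ Φ := by
  cases nonempty_fintype Y
  have h1 := (convex_convexHull ℝ Φ).sum_mem (t := Finset.univ)
    (w := fun _ : Y => (1 : ℝ) / Nat.card Y) (z := φ) (fun _ _ => by positivity)
    (by simp) fun y _ => subset_convexHull ℝ Φ (h y)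
  convert h1 using 1
  funext x
  rw [avg_eq_sum_div, Finset.sum_apply, Finset.sum_div]
  refine Finset.sum_congr rfl fun y _ => ?_
  simp only [Pi.smul_apply, smul_eq_mul]
  ring

variable {I Z : Type} [Fintype I] [DecidableEq I] [AddCommGroup Z] [Finite Z]

/-- The dual function of the family `u i`, `i ≠ j`, with respect to a homomorphism `ψ`
with section `σ`. -/
noncomputable def dual (ψ : (I → Z) →+ Z) (σ : Z →+ (I → Z)) (j : I) (u : I → (I → Z) → ℝ)
    (x : Z) : ℝ :=
  avg fun v => ∏ i ∈ Finset.univ.erase j, u i (v - σ (ψ v) + σ x)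

/-- The dual functions of the families of bounded functions `u i` not depending on the
coordinate `i`. -/
def duals (ψ : (I → Z) →+ Z) (σ : Z →+ (I → Z)) (j : I) : Set (Z → ℝ) :=
  {φ | ∃ u : I → (I → Z) → ℝ, (∀ i, Indep i (u i)) ∧ (∀ i v, |u i v| ≤ 1) ∧ dual ψ σ j u = φ}

variable {ψ : (I → Z) →+ Z} {σ : Z →+ (I → Z)} {j : I}

theorem avgMul_dual (hσ : ∀ x, ψ (σ x) = x) (f : Z → ℝ) (u : I → (I → Z) → ℝ) :
    avgMul (dual ψ σ j u) f = avg fun v => f (ψ v) * ∏ i ∈ Finset.univ.erase j, u i v := by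
  let φ : Z × (I → Z) →+ (I → Z) :=
    (AddMonoidHom.snd Z (I → Z) - σ.comp (ψ.comp (AddMonoidHom.snd Z (I → Z)))) +
      σ.comp (AddMonoidHom.fst Z (I → Z))
  have hφ : ∀ p, φ p = p.2 - σ (ψ p.2) + σ p.1 := fun p => rfl
  have hsurj : Function.Surjective φ := fun w => ⟨(ψ w, w), by simp [hφ]⟩
  have hψ : ∀ p, ψ (φ p) = p.1 := fun p => by simp [hφ, hσ]
  rw [← avg_comp_addMonoidHom hsurj, avg_prod, avgMul_apply]
  congr 1
  funext x
  unfold dual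
  rw [← avg_const_mul]
  simp only [hψ]
  rfl

theorem dual_mul_dual (u u' : I → (I → Z) → ℝ) :
    dual ψ σ j u * dual ψ σ j u' = fun x => avg fun z =>
      dual ψ σ j (fun i v => u i v * u' i (v + (z - σ (ψ z)))) x := by
  funext x
  simp only [Pi.mul_apply, dual]
  rw [avg_comm, ← avg_mul_const]
  congr 1
  funext v
  rw [← avg_const_mul, ← avg_equiv (Equiv.addLeft v)]
  congr 1
  funext z
  rw [Finset.prod_mul_distrib]
  congr 2
  funext i
  congr 1
  simp only [Equiv.coe_addLeft, map_add]
  abel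

theorem abs_dual_le_one {u : I → (I → Z) → ℝ} (hu : ∀ i v, |u i v| ≤ 1) (x : Z) :
    |dual ψ σ j u x| ≤ 1 :=
  (abs_avg_le _).trans <| avg_le_of_le fun v => by
    rw [Finset.abs_prod]
    exact Finset.prod_le_one (fun _ _ => abs_nonneg _) fun i _ => hu i _

theorem one_mem_duals : 1 ∈ duals ψ σ j :=
  ⟨fun _ _ => 1, fun i => indep_const i 1, by simp, by funext x; simp [dual, avg_const]⟩

theorem neg_mem_duals {i : I} (hij : i ≠ j) {φ : Z → ℝ} (hφ : φ ∈ duals ψ σ j) :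
    -φ ∈ duals ψ σ j := by
  obtain ⟨u, hu, hu1, rfl⟩ := hφ
  refine ⟨Function.update u i fun v => -u i v, fun i' => ?_, fun i' v => ?_, ?_⟩
  · by_cases h : i' = i
    · subst h
      rw [Function.update_self]
      exact fun w x => congrArg (- ·) (hu i' w x)
    · rw [Function.update_of_ne h]
      exact hu i'
  · by_cases h : i' = i
    · subst h
      simpa using hu1 i' v
    · rw [Function.update_of_ne h]
      exact hu1 i' v
  · funext x
    simp only [dual, Pi.neg_apply]
    have hi : i ∈ Finset.univ.erase j := by simpa using hij
    rw [← neg_one_mul, ← avg_const_mul]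
    congr 1
    funext v
    rw [← Finset.mul_prod_erase _ _ hi, ← Finset.mul_prod_erase _ _ hi, Function.update_self,
      neg_one_mul, neg_mul]
    congr 2
    refine Finset.prod_congr rfl fun i' hi' => ?_
    rw [Function.update_of_ne (Finset.ne_of_mem_erase hi')]

theorem mul_mem_convexHull_duals {φ φ' : Z → ℝ} (hφ : φ ∈ duals ψ σ j) (hφ' : φ' ∈ duals ψ σ j) :
    φ * φ' ∈ convexHull ℝ (duals ψ σ j) := by
  obtain ⟨u, hu, hu1, rfl⟩ := hφ
  obtain ⟨u', hu', hu1', rfl⟩ := hφ'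
  rw [dual_mul_dual]
  refine avg_mem_convexHull fun z => ⟨_, fun i w x => ?_, fun i v => ?_, rfl⟩
  · have h : Function.update w i x + (z - σ (ψ z)) =
        Function.update (w + (z - σ (ψ z))) i (x + (z - σ (ψ z)) i) := by
      funext i'
      by_cases h : i' = i
      · subst h
        simp
      · simp [Function.update_of_ne h]
    simp only [hu i w x, h, hu' i _ _]
  · rw [abs_mul]
    exact mul_le_one₀ (hu1 i v) (abs_nonneg _) (hu1' i _)

end DualFunctions

section RelativeSzemeredi

variable {k : ℕ} {Z : Type} [AddCommGroup Z]

/-- The linear form `v ↦ ∑ i, (i - j) v i`. -/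
def apForm (Z : Type) [AddCommGroup Z] (j : Fin k) : (Fin k → Z) →+ Z where
  toFun v := ∑ i : Fin k, ((i : ℤ) - j) • v i
  map_zero' := by simp
  map_add' v w := by simp [Finset.sum_add_distrib]

theorem apForm_apply (j : Fin k) (v : Fin k → Z) :
    apForm Z j v = ∑ i : Fin k, ((i : ℤ) - j) • v i := rfl

theorem indep_apForm (F : Z → ℝ) (j : Fin k) : Indep j fun v => F (apForm Z j v) := by
  intro w x
  refine congrArg F ?_
  simp only [apForm_apply]
  refine Finset.sum_congr rfl fun i _ => ?_
  by_cases h : i = j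
  · subst h
    simp
  · rw [Function.update_of_ne h]

/-- The sum of the coordinates other than `j`. -/
def sumErase (Z : Type) [AddCommGroup Z] (j : Fin k) : (Fin k → Z) →+ Z where
  toFun v := ∑ i ∈ Finset.univ.erase j, v i
  map_zero' := by simp
  map_add' v w := by simp [Finset.sum_add_distrib]

theorem sumErase_single {i j : Fin k} (hij : i ≠ j) (x : Z) :
    sumErase Z j (AddMonoidHom.single (fun _ : Fin k => Z) i x) = x := by
  change ∑ i' ∈ Finset.univ.erase j, Pi.single (M := fun _ => Z) i x i' = x
  simp [Pi.single_apply, hij]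

theorem bijective_zsmul {a : ℤ} (h : Function.Bijective fun z : Z => a.natAbs • z) :
    Function.Bijective fun z : Z => a • z := by
  obtain ⟨n, rfl | rfl⟩ := a.eq_nat_or_neg
  · simpa using h
  · simp only [neg_smul, natCast_zsmul]
    exact (Equiv.neg Z).bijective.comp (by simpa using h)

theorem exists_equiv_apForm (hZ : ∀ m : ℕ, 0 < m → m < k → Function.Bijective fun z : Z => m • z)
    (j j₀ : Fin k) : ∃ e : (Fin k → Z) ≃ (Fin k → Z),
      (∀ v, sumErase Z j₀ (e v) = apForm Z j v) ∧
      (∀ i w x, ∃ y, e (Function.update w i x) =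
        Function.update (e w) (Equiv.swap j₀ j i) y) ∧
      ∀ i w x, ∃ y, e.symm (Function.update w i x) =
        Function.update (e.symm w) (Equiv.swap j₀ j i) y := by
  set τ := Equiv.swap j₀ j with hτ
  let m : Fin k → ℤ := fun i => if i = j then 1 else (i : ℤ) - j
  have hbij : ∀ i, Function.Bijective fun z : Z => m i • z := by
    intro i
    by_cases h : i = j
    · simp only [m, if_pos h, one_smul]
      exact Function.bijective_id
    · have h2 : (i : ℕ) ≠ j := fun h' => h (Fin.ext h')
      have h1 := hZ ((i : ℤ) - j).natAbs (by omega) (by omega)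
      simp only [m, if_neg h]
      exact bijective_zsmul h1
  let e₁ : (Fin k → Z) ≃ (Fin k → Z) :=
    Equiv.piCongrRight fun i => Equiv.ofBijective _ (hbij i)
  let e₂ : (Fin k → Z) ≃ (Fin k → Z) := Equiv.arrowCongr τ (Equiv.refl Z)
  have hττ : ∀ i, τ (τ i) = i := fun i => by simp [hτ]
  have hτs : τ.symm = τ := Equiv.symm_swap _ _
  have he : ∀ v i, (e₁.trans e₂) v i = m (τ i) • v (τ i) := fun v i => by
    simp [e₁, e₂, Equiv.arrowCongr, hτs]
  have hupd : ∀ i w x, ∃ y, (e₁.trans e₂) (Function.update w i x) =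
      Function.update ((e₁.trans e₂) w) (τ i) y := fun i w x => by
    refine ⟨m i • x, ?_⟩
    funext i'
    rw [he]
    by_cases h : i' = τ i
    · subst h
      simp [hττ]
    · rw [Function.update_of_ne h, he, Function.update_of_ne]
      rintro rfl
      exact h (hττ i').symm
  refine ⟨e₁.trans e₂, fun v => ?_, hupd, fun i w x => ?_⟩
  · change ∑ i ∈ Finset.univ.erase j₀, (e₁.trans e₂) v i = _
    simp only [he]
    have h1 : ∑ i ∈ Finset.univ.erase j, ((i : ℤ) - j) • v i = apForm Z j v :=
      Finset.sum_erase _ (by simp)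
    rw [← h1]
    have h2 : ∀ i, i ≠ j₀ ↔ τ i ≠ j := fun i => by
      have h3 : τ j₀ = j := Equiv.swap_apply_left _ _
      rw [← h3]
      exact τ.injective.ne_iff.symm
    refine Finset.sum_equiv τ (fun i => by simp [h2]) fun i hi => ?_
    have h3 : τ i ≠ j := (h2 i).mp (Finset.ne_of_mem_erase hi)
    simp [m, h3]
  · obtain ⟨z, hz⟩ := (hbij (τ i)).2 x
    refine ⟨z, ?_⟩
    rw [Equiv.symm_apply_eq]
    funext i'
    rw [he]
    by_cases h : i' = i
    · subst h
      simpa using hz.symm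
    · rw [Function.update_of_ne h, Function.update_of_ne fun h' => h (τ.injective h'), ← he,
        Equiv.apply_symm_apply]

/-- Averages against products of functions missing one coordinate, in normal form. -/
theorem exists_avg_apForm_eq [Finite Z]
    (hZ : ∀ m : ℕ, 0 < m → m < k → Function.Bijective fun z : Z => m • z) (j j₀ : Fin k)
    {u : Fin k → (Fin k → Z) → ℝ} (hu : ∀ i, Indep i (u i)) (hu1 : ∀ i v, |u i v| ≤ 1) :
    ∃ u' : Fin k → (Fin k → Z) → ℝ, (∀ i, Indep i (u' i)) ∧ (∀ i v, |u' i v| ≤ 1) ∧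
      ∀ F : Z → ℝ, (avg fun v => F (apForm Z j v) * ∏ i ∈ Finset.univ.erase j, u i v) =
        avg fun v => F (sumErase Z j₀ v) * ∏ i ∈ Finset.univ.erase j₀, u' i v := by
  obtain ⟨e, he1, -, he3⟩ := exists_equiv_apForm hZ j j₀
  refine ⟨fun i v => u (Equiv.swap j₀ j i) (e.symm v), fun i w x => ?_, fun i v => hu1 _ _,
    fun F => ?_⟩
  · obtain ⟨y, hy⟩ := he3 i w x
    simp only [hy, hu _ _ y]
  · rw [← avg_equiv e fun v => F (sumErase Z j₀ v) * _]
    congr 1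
    funext v
    rw [he1]
    congr 1
    refine Finset.prod_equiv (Equiv.swap j₀ j) (fun i => ?_) fun i _ => ?_
    · simp [Equiv.swap_apply_eq_iff]
    · simp

theorem exists_avg_sumErase_eq [Finite Z]
    (hZ : ∀ m : ℕ, 0 < m → m < k → Function.Bijective fun z : Z => m • z) (j j₀ : Fin k)
    {u : Fin k → (Fin k → Z) → ℝ} (hu : ∀ i, Indep i (u i)) (hu1 : ∀ i v, |u i v| ≤ 1) :
    ∃ u' : Fin k → (Fin k → Z) → ℝ, (∀ i, Indep i (u' i)) ∧ (∀ i v, |u' i v| ≤ 1) ∧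
      ∀ F : Z → ℝ, (avg fun v => F (sumErase Z j₀ v) * ∏ i ∈ Finset.univ.erase j₀, u i v) =
        avg fun v => F (apForm Z j v) * ∏ i ∈ Finset.univ.erase j, u' i v := by
  obtain ⟨e, he1, he2, -⟩ := exists_equiv_apForm hZ j j₀
  refine ⟨fun i v => u (Equiv.swap j₀ j i) (e v), fun i w x => ?_, fun i v => hu1 _ _,
    fun F => ?_⟩
  · obtain ⟨y, hy⟩ := he2 i w x
    simp only [hy, hu _ _ y]
  · rw [← avg_equiv e]
    congr 1
    funext v
    rw [he1]
    congr 1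
    refine Finset.prod_equiv (Equiv.swap j₀ j) (fun i => ?_) fun i _ => ?_
    · simp [Equiv.swap_apply_eq_iff]
    · simp

theorem avg_prod_apForm [Finite Z] (hk : 2 ≤ k) (g : Z → ℝ) :
    (avg fun v : Fin k → Z => ∏ j, g (apForm Z j v)) =
      avg fun p : Z × Z => ∏ j : Fin k, g (p.1 + (j : ℕ) • p.2) := by
  let φ : (Fin k → Z) →+ Z × Z :=
    { toFun := fun v => (∑ i : Fin k, (i : ℕ) • v i, -∑ i, v i)
      map_zero' := by simp
      map_add' := fun v w => by simp [Finset.sum_add_distrib, add_comm] }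
  have hφ : Function.Surjective φ := by
    rintro ⟨a, d⟩
    have h01 : (⟨0, by omega⟩ : Fin k) ≠ ⟨1, by omega⟩ := by simp
    refine ⟨Pi.single ⟨1, by omega⟩ a + Pi.single ⟨0, by omega⟩ (-d - a), ?_⟩
    change (∑ i : Fin k, (i : ℕ) • (Pi.single _ a + Pi.single _ (-d - a) : Fin k → Z) i,
      -∑ i, (Pi.single _ a + Pi.single _ (-d - a) : Fin k → Z) i) = (a, d)
    simp [Pi.single_apply, Finset.sum_add_distrib, smul_add]
  rw [← avg_comp_addMonoidHom hφ]
  congr 1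
  funext v
  refine Finset.prod_congr rfl fun j _ => congrArg g ?_
  change apForm Z j v = ∑ i : Fin k, (i : ℕ) • v i + (j : ℕ) • -∑ i, v i
  rw [apForm_apply, smul_neg, Finset.smul_sum, ← sub_eq_add_neg, ← Finset.sum_sub_distrib]
  exact Finset.sum_congr rfl fun i _ => by rw [sub_smul, natCast_zsmul, natCast_zsmul]

/-- Szemerédi's theorem relative to a weight satisfying the linear forms condition. -/
theorem relative_szemeredi (hk : 2 ≤ k) {δ : ℝ} (hδ : 0 < δ) : ∃ ε : ℝ, 0 < ε ∧ ∃ c : ℝ, 0 < c ∧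
    ∀ (Z : Type) [AddCommGroup Z] [Finite Z] (ν f : Z → ℝ),
      (∀ m : ℕ, 0 < m → m < k → Function.Bijective fun z : Z => m • z) → (∀ x, 0 ≤ ν x) →
      LinForms (fun (j : Fin k) v => ν (apForm Z j v)) ε → (∀ x, 0 ≤ f x) → (∀ x, f x ≤ ν x) →
      δ ≤ avg f → c ≤ avg fun v : Fin k → Z => ∏ j, f (apForm Z j v) := by
  have : NeZero k := ⟨by omega⟩
  obtain ⟨c, hc, hcount⟩ := szemeredi_count k (half_pos hδ)
  obtain ⟨ε₁, hε₁, hrel⟩ := countingOn_univ (I := Fin k) (c / 2) (half_pos hc)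
  obtain ⟨ε₂, hε₂, hdense⟩ := dense_model (η := min ε₁ (δ / 2)) (by positivity)
  set q : ℕ := 2 ^ Fintype.card (Fin k) with hq
  refine ⟨min (min ε₁ 1) (min ε₂ 1 ^ q / 4 ^ q), by positivity, c / 2, half_pos hc,
    fun Z _ _ ν f hZ hν0 hν hf hfν hfδ => ?_⟩
  have hind : ∀ j : Fin k, Indep j fun v => ν (apForm Z j v) := indep_apForm ν
  let i₁ : Fin k := ⟨1, by omega⟩
  have hi₁ : i₁ ≠ 0 := fun h => by simpa [i₁] using congrArg Fin.val h
  let σ : Z →+ (Fin k → Z) := AddMonoidHom.single (fun _ : Fin k => Z) i₁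
  have hσ : ∀ x, sumErase Z 0 (σ x) = x := sumErase_single hi₁
  have hνdual : ∀ φ ∈ duals (sumErase Z 0) σ 0, |avgMul (ν - 1) φ| ≤ ε₂ := by
    rintro φ ⟨u, hu, hu1, rfl⟩
    rw [avgMul_comm, avgMul_dual hσ]
    obtain ⟨u', hu', hu1', h⟩ := exists_avg_sumErase_eq hZ 0 0 hu hu1
    rw [h (ν - 1)]
    simp only [Pi.sub_apply, Pi.one_apply]
    have hε1 : min (min ε₁ 1) (min ε₂ 1 ^ q / 4 ^ q) ≤ 1 :=
      (min_le_left _ _).trans (min_le_right _ _)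
    have hε4 : 4 ^ q * min (min ε₁ 1) (min ε₂ 1 ^ q / 4 ^ q) ≤ min ε₂ 1 ^ q := by
      rw [mul_comm, ← le_div_iff₀ (by positivity)]
      exact min_le_right _ _
    have h1 := hν.abs_avg_sub_one_mul_link_le hε1 hind hε₂.le hε4 0 (T := ∅) (T' := ∅) hu'
      (fun i => indep_const i 1) (by simpa [weight] using hu1') (by simp [weight])
    have h2 : ∀ v : Fin k → Z, link 0 (fun _ _ => 1) v = 1 := fun v => by
      simp [link, avg_const]
    have hF : Indep 0 fun v : Fin k → Z => ν (apForm Z 0 v) - 1 :=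
      indep_apForm (fun x => ν x - 1) 0
    simp only [h2, mul_one] at h1
    rwa [avg_mul_link hF] at h1
  obtain ⟨g, hg0, hg1, hfg⟩ := hdense Z (duals (sumErase Z 0) σ 0) ν f
    (by
      rintro φ ⟨u, hu, hu1, rfl⟩
      exact abs_dual_le_one hu1)
    one_mem_duals (fun φ hφ => neg_mem_duals hi₁ hφ)
    (fun φ hφ φ' hφ' => mul_mem_convexHull_duals hφ hφ') hνdual hf hfν
  have hgδ : δ / 2 ≤ avg g := by
    have h1 := (abs_le.mp (hfg 1 one_mem_duals)).2
    rw [map_sub, avgMul_apply, avgMul_apply] at h1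
    simp only [Pi.one_apply, mul_one] at h1
    linarith [min_le_right ε₁ (δ / 2)]
  have hcut : ∀ j : Fin k, CutSmall j (fun v => f (apForm Z j v) - g (apForm Z j v)) ε₁ := by
    intro j u hu hu1
    obtain ⟨u', hu', hu1', h⟩ := exists_avg_apForm_eq hZ j 0 hu hu1
    have h1 := h (f - g)
    rw [← avgMul_dual hσ] at h1
    simp only [Pi.sub_apply] at h1
    rw [h1]
    exact (hfg _ ⟨u', hu', hu1', rfl⟩).trans (min_le_left _ _)
  have h1 := hrel Z (fun j v => ν (apForm Z j v)) (fun j v => f (apForm Z j v))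
    (fun j v => g (apForm Z j v)) (hν.mono ((min_le_left _ _).trans (min_le_left _ _))) hind
    (fun j v => hν0 _) (indep_apForm f) (indep_apForm g) (fun j v => hf _)
    (fun j v => by simpa [weight] using hfν _) (fun j v => hg0 _) (fun j v => hg1 _) hcut
  have h2 := hcount Z g hg0 hg1 hgδ
  rw [← avg_prod_apForm hk] at h2
  linarith [(abs_le.mp h1).1]

end RelativeSzemeredi

section Sieve

variable {P : Type}

/-- The centred divisibility function at a prime `q`. -/
noncomputable def divWeight (q : ℝ) (b : Bool) : ℝ := if b then -1 else 1 / (q - 1)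

/-- The law of divisibility by `q`. -/
noncomputable def divLaw (q : ℝ) (b : Bool) : ℝ := if b then 1 / q else 1 - 1 / q

/-- The truncated divisor sum over the family `𝒮` of sets of primes. -/
noncomputable def sieve (𝒮 : Finset (Finset P)) (q : P → ℝ) (E : P → Bool) : ℝ :=
  ∑ S ∈ 𝒮, ∏ p ∈ S, divWeight (q p) (E p)

/-- The mean square of the truncated divisor sum. -/
noncomputable def sieveMass (𝒮 : Finset (Finset P)) (q : P → ℝ) : ℝ :=
  ∑ S ∈ 𝒮, ∏ p ∈ S, 1 / (q p - 1)

theorem abs_divWeight_le_one {q : ℝ} (hq : 2 ≤ q) (b : Bool) : |divWeight q b| ≤ 1 := by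
  cases b
  · have : 0 < q - 1 := by linarith
    simp only [divWeight, Bool.false_eq_true, if_false]
    rw [abs_of_nonneg (by positivity), div_le_one this]
    linarith
  · simp [divWeight]

theorem divLaw_nonneg {q : ℝ} (hq : 2 ≤ q) (b : Bool) : 0 ≤ divLaw q b := by
  cases b
  · simp only [divLaw, Bool.false_eq_true, if_false, sub_nonneg]
    rw [div_le_one (by linarith)]
    linarith
  · simp only [divLaw, if_true]
    have : 0 < q := by linarith
    positivity

variable [Fintype P] [DecidableEq P]

theorem sum_prod_pi {Y : P → Type*} [∀ p, Fintype (Y p)] (f : ∀ p, Y p → ℝ) :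
    ∑ E : ∀ p, Y p, ∏ p, f p (E p) = ∏ p, ∑ b, f p b := by
  rw [Finset.prod_univ_sum, Fintype.piFinset_univ]

theorem sum_prod_mul_sieve_sq (𝒮 : Finset (Finset P)) (q : P → ℝ) (α : P → Bool → ℝ) :
    ∑ E : P → Bool, (∏ p, α p (E p)) * sieve 𝒮 q E ^ 2 = ∑ S ∈ 𝒮, ∑ S' ∈ 𝒮, ∏ p, ∑ b, α p b *
      ((if p ∈ S then divWeight (q p) b else 1) * if p ∈ S' then divWeight (q p) b else 1) := by
  have h1 : ∀ (S : Finset P) (E : P → Bool), ∏ p ∈ S, divWeight (q p) (E p) =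
      ∏ p, if p ∈ S then divWeight (q p) (E p) else 1 := fun S E => by
    rw [Finset.prod_ite_mem, Finset.univ_inter]
  have h2 : ∀ E : P → Bool, (∏ p, α p (E p)) * sieve 𝒮 q E ^ 2 =
      ∑ S ∈ 𝒮, ∑ S' ∈ 𝒮, ∏ p, α p (E p) * ((if p ∈ S then divWeight (q p) (E p) else 1) *
        if p ∈ S' then divWeight (q p) (E p) else 1) := fun E => by
    rw [sieve, sq, Finset.sum_mul_sum, Finset.mul_sum]
    refine Finset.sum_congr rfl fun S _ => ?_
    rw [Finset.mul_sum]
    refine Finset.sum_congr rfl fun S' _ => ?_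
    rw [h1, h1, Finset.prod_mul_distrib, Finset.prod_mul_distrib]
  simp only [h2]
  rw [Finset.sum_comm]
  refine Finset.sum_congr rfl fun S _ => ?_
  rw [Finset.sum_comm]
  refine Finset.sum_congr rfl fun S' _ => ?_
  exact sum_prod_pi fun p b => α p b * ((if p ∈ S then divWeight (q p) b else 1) *
    if p ∈ S' then divWeight (q p) b else 1)

theorem sum_divLaw {q : ℝ} (hq : 2 ≤ q) (s s' : Prop) [Decidable s] [Decidable s'] :
    ∑ b, divLaw q b * ((if s then divWeight q b else 1) * if s' then divWeight q b else 1) =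
      if s ↔ s' then (if s then 1 / (q - 1) else 1) else 0 := by
  have h1 : q - 1 ≠ 0 := by linarith
  have h2 : q ≠ 0 := by linarith
  by_cases hs : s <;> by_cases hs' : s' <;> simp [hs, hs', divLaw, divWeight] <;>
    field_simp <;> ring

/-- The second moment of the truncated divisor sum. -/
theorem sum_divLaw_mul_sieve_sq {𝒮 : Finset (Finset P)} {q : P → ℝ} (hq : ∀ p, 2 ≤ q p) :
    ∑ E : P → Bool, (∏ p, divLaw (q p) (E p)) * sieve 𝒮 q E ^ 2 = sieveMass 𝒮 q := by
  rw [sum_prod_mul_sieve_sq]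
  refine Finset.sum_congr rfl fun S hS => ?_
  rw [Finset.sum_eq_single S]
  · simp only [sum_divLaw (hq _), iff_self, if_true]
    rw [Finset.prod_ite_mem, Finset.univ_inter]
  · intro S' _ hne
    obtain ⟨p, hp⟩ : ∃ p, ¬(p ∈ S ↔ p ∈ S') := by
      by_contra! h
      exact hne (Finset.ext fun p => (h p).symm)
    refine Finset.prod_eq_zero (Finset.mem_univ p) ?_
    rw [sum_divLaw (hq _), if_neg hp]
  · exact fun h => absurd hS h

/-- The second moment bound when the law at the primes in `T` is replaced by counting measure. -/
theorem sum_ite_mul_sieve_sq_le {𝒮 : Finset (Finset P)} (h𝒮 : ∀ S ∈ 𝒮, ∀ S' ⊆ S, S' ∈ 𝒮)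
    {q : P → ℝ} (hq : ∀ p, 2 ≤ q p) (T : Finset P) :
    ∑ E : P → Bool, (∏ p, if p ∈ T then 1 else divLaw (q p) (E p)) * sieve 𝒮 q E ^ 2 ≤
      8 ^ T.card * sieveMass 𝒮 q := by
  have h1 := sum_prod_mul_sieve_sq 𝒮 q fun p b => if p ∈ T then 1 else divLaw (q p) b
  rw [h1]
  have hφ : ∀ S : Finset P, 0 ≤ ∏ p ∈ S, 1 / (q p - 1) := fun S =>
    Finset.prod_nonneg fun p _ => by
      have : 0 ≤ q p - 1 := by linarith [hq p]
      positivity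
  have h2 : ∀ S S' : Finset P, (∏ p, ∑ b, (if p ∈ T then 1 else divLaw (q p) b) *
      ((if p ∈ S then divWeight (q p) b else 1) * if p ∈ S' then divWeight (q p) b else 1)) ≤
      if S \ T = S' \ T then 2 ^ T.card * ∏ p ∈ S \ T, 1 / (q p - 1) else 0 := by
    intro S S'
    by_cases h : S \ T = S' \ T
    · rw [if_pos h]
      have h3 : (2 : ℝ) ^ T.card * ∏ p ∈ S \ T, 1 / (q p - 1) =
          ∏ p, (if p ∈ T then 2 else 1) * (if p ∈ S \ T then 1 / (q p - 1) else 1) := by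
        rw [Finset.prod_mul_distrib, Finset.prod_ite_mem, Finset.prod_ite_mem, Finset.univ_inter,
          Finset.univ_inter, Finset.prod_const]
      rw [h3]
      refine (le_abs_self _).trans ?_
      rw [Finset.abs_prod]
      refine Finset.prod_le_prod (fun _ _ => abs_nonneg _) fun p _ => ?_
      by_cases hp : p ∈ T
      · simp only [hp, if_true, one_mul, Finset.mem_sdiff, not_true, and_false, if_false, mul_one]
        have h4 : ∀ (b : Bool) (s : Prop) [Decidable s],
            |if s then divWeight (q p) b else 1| ≤ 1 := fun b s _ => by
          split_ifs
          exacts [abs_divWeight_le_one (hq p) b, abs_one.le]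
        refine (Finset.abs_sum_le_sum_abs _ _).trans ?_
        refine (Finset.sum_le_sum (g := fun _ => (1 : ℝ)) fun b _ => ?_).trans (by simp)
        rw [abs_mul]
        exact mul_le_one₀ (h4 b _) (abs_nonneg _) (h4 b _)
      · simp only [hp, if_false, Finset.mem_sdiff, not_false_iff, and_true, one_mul]
        have h5 : p ∈ S ↔ p ∈ S' := by
          have := Finset.ext_iff.mp h p
          simpa [hp] using this
        rw [sum_divLaw (hq p), if_pos h5, abs_of_nonneg]
        have : 0 ≤ q p - 1 := by linarith [hq p]
        split_ifs <;> positivity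
    · rw [if_neg h]
      obtain ⟨p, hp⟩ : ∃ p, ¬(p ∈ S \ T ↔ p ∈ S' \ T) := by
        by_contra! h'
        exact h (Finset.ext h')
      have hpT : p ∉ T := fun h => hp (by simp [h])
      refine (Finset.prod_eq_zero (Finset.mem_univ p) ?_).le
      simp only [hpT, if_false]
      rw [sum_divLaw (hq p), if_neg]
      simpa [hpT] using hp
  refine (Finset.sum_le_sum fun S _ => Finset.sum_le_sum fun S' _ => h2 S S').trans ?_
  rw [← Finset.sum_product']
  have h3 : ∑ x ∈ 𝒮 ×ˢ 𝒮, (if x.1 \ T = x.2 \ T then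
      (2 : ℝ) ^ T.card * ∏ p ∈ x.1 \ T, 1 / (q p - 1) else 0) ≤
      ∑ y ∈ 𝒮 ×ˢ (T.powerset ×ˢ T.powerset), 2 ^ T.card * ∏ p ∈ y.1, 1 / (q p - 1) := by
    rw [← Finset.sum_filter]
    have hinj : Set.InjOn (fun x : Finset P × Finset P => (x.1 \ T, x.1 ∩ T, x.2 ∩ T))
        ((𝒮 ×ˢ 𝒮).filter fun x => x.1 \ T = x.2 \ T) := by
      rintro ⟨S₁, S₁'⟩ h₁ ⟨S₂, S₂'⟩ h₂ h
      simp only [Finset.coe_filter, Set.mem_ofPred_eq] at h₁ h₂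
      simp only [Prod.mk.injEq] at h ⊢
      rw [← Finset.sdiff_union_inter S₁ T, ← Finset.sdiff_union_inter S₁' T, ← h₁.2, h.1, h.2.1,
        h.2.2, h₂.2, Finset.sdiff_union_inter]
      exact ⟨by rw [← h₂.2, Finset.sdiff_union_inter], rfl⟩
    rw [← Finset.sum_image (f := fun y : Finset P × Finset P × Finset P =>
      (2 : ℝ) ^ T.card * ∏ p ∈ y.1, 1 / (q p - 1)) hinj]
    refine Finset.sum_le_sum_of_subset_of_nonneg (fun y hy => ?_) fun y _ _ =>
      mul_nonneg (by positivity) (hφ y.1)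
    obtain ⟨x, hx, rfl⟩ := Finset.mem_image.mp hy
    simp only [Finset.mem_filter, Finset.mem_product] at hx
    simp only [Finset.mem_product, Finset.mem_powerset]
    exact ⟨h𝒮 _ hx.1.1 _ Finset.sdiff_subset, Finset.inter_subset_right, Finset.inter_subset_right⟩
  refine h3.trans (le_of_eq ?_)
  rw [Finset.sum_product]
  simp only [Finset.sum_const, Finset.card_product, Finset.card_powerset, nsmul_eq_mul]
  rw [sieveMass, Finset.mul_sum]
  refine Finset.sum_congr rfl fun S _ => ?_
  push_cast
  rw [← mul_assoc, ← mul_pow, ← mul_pow]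
  norm_num

theorem sum_prod_pow_sieve_sq {M : Type} [Fintype M] [DecidableEq M] (𝒮 : Finset (Finset P))
    (q : P → ℝ) (α : P → Bool → ℝ) :
    ∑ E : P → M → Bool, (∏ p, ∏ m, α p (E p m)) * ∏ m, sieve 𝒮 q (fun p => E p m) ^ 2 =
      (∑ E : P → Bool, (∏ p, α p (E p)) * sieve 𝒮 q E ^ 2) ^ Fintype.card M := by
  have h1 := sum_prod_pi (P := M) (Y := fun _ => P → Bool)
    fun _ E => (∏ p, α p (E p)) * sieve 𝒮 q E ^ 2
  rw [Finset.prod_const, Finset.card_univ] at h1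
  rw [← h1, ← (Equiv.piComm fun (_ : P) (_ : M) => Bool).sum_comp]
  refine Finset.sum_congr rfl fun E _ => ?_
  rw [Finset.prod_comm, ← Finset.prod_mul_distrib]
  rfl

/-- The moments of truncated divisor sums are stable under perturbations of the law of
divisibility. -/
theorem abs_sum_prod_sieve_sub_le {M : Type} [Fintype M] [DecidableEq M]
    {𝒮 : Finset (Finset P)} (h𝒮 : ∀ S ∈ 𝒮, ∀ S' ⊆ S, S' ∈ 𝒮) {q : P → ℝ} (hq : ∀ p, 2 ≤ q p)
    {μ : P → (M → Bool) → ℝ} {κ : P → ℝ}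
    (hμ : ∀ p e, |μ p e - ∏ m, divLaw (q p) (e m)| ≤ κ p) :
    |∑ E : P → M → Bool, (∏ p, μ p (E p)) * ∏ m, sieve 𝒮 q (fun p => E p m) ^ 2 -
        sieveMass 𝒮 q ^ Fintype.card M| ≤
      sieveMass 𝒮 q ^ Fintype.card M * (∏ p, (1 + κ p * 8 ^ Fintype.card M) - 1) := by
  set V := sieveMass 𝒮 q with hV
  set π : P → (M → Bool) → ℝ := fun p e => ∏ m, divLaw (q p) (e m) with hπ
  have hπ0 : ∀ p e, 0 ≤ π p e := fun p e => Finset.prod_nonneg fun m _ => divLaw_nonneg (hq p) _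
  have hκ : ∀ p, 0 ≤ κ p := fun p => (abs_nonneg _).trans (hμ p fun _ => true)
  let F : (P → M → Bool) → ℝ := fun E => ∏ m, sieve 𝒮 q (fun p => E p m) ^ 2
  have hF : ∀ E, 0 ≤ F E := fun E => Finset.prod_nonneg fun m _ => sq_nonneg _
  let A : Finset P → ℝ := fun T => ∑ E : P → M → Bool,
    ((∏ p ∈ T, (μ p (E p) - π p (E p))) * ∏ p ∈ Finset.univ \ T, π p (E p)) * F E
  have hexp : ∑ E : P → M → Bool, (∏ p, μ p (E p)) * F E =
      ∑ T ∈ (Finset.univ : Finset P).powerset, A T := by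
    rw [Finset.sum_comm]
    refine Finset.sum_congr rfl fun E _ => ?_
    rw [← Finset.sum_mul, ← Finset.prod_add]
    simp
  have hA0 : A ∅ = V ^ Fintype.card M := by
    simp only [A, Finset.prod_empty, one_mul, Finset.sdiff_empty]
    rw [hV, ← sum_divLaw_mul_sieve_sq hq, ← sum_prod_pow_sieve_sq]
  have hA : ∀ T, |A T| ≤ V ^ Fintype.card M * ∏ p ∈ T, (κ p * 8 ^ Fintype.card M) := by
    intro T
    have h1 : |A T| ≤ (∏ p ∈ T, κ p) * ∑ E : P → M → Bool,
        (∏ p, ∏ m, if p ∈ T then 1 else divLaw (q p) (E p m)) * F E := by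
      rw [Finset.mul_sum]
      refine (Finset.abs_sum_le_sum_abs _ _).trans (Finset.sum_le_sum fun E _ => ?_)
      rw [abs_mul, abs_of_nonneg (hF E), ← mul_assoc]
      refine mul_le_mul_of_nonneg_right ?_ (hF E)
      rw [abs_mul, Finset.abs_prod, Finset.abs_prod]
      refine mul_le_mul (Finset.prod_le_prod (fun _ _ => abs_nonneg _) fun p _ => hμ p _) ?_
        (Finset.prod_nonneg fun _ _ => abs_nonneg _) (Finset.prod_nonneg fun p _ => hκ p)
      refine le_of_eq ?_
      rw [← Finset.prod_sdiff (Finset.subset_univ T)]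
      have h2 : ∏ p ∈ T, ∏ m, (if p ∈ T then 1 else divLaw (q p) (E p m)) = 1 :=
        Finset.prod_eq_one fun p hp => by simp [hp]
      rw [h2, mul_one]
      refine Finset.prod_congr rfl fun p hp => ?_
      rw [abs_of_nonneg (hπ0 p _)]
      simp [hπ, (Finset.mem_sdiff.mp hp).2]
    refine h1.trans ?_
    have h3 := sum_prod_pow_sieve_sq (M := M) 𝒮 q fun p b => if p ∈ T then 1 else divLaw (q p) b
    rw [h3]
    have h4 := sum_ite_mul_sieve_sq_le h𝒮 hq T
    have h5 : 0 ≤ ∑ E : P → Bool, (∏ p, if p ∈ T then 1 else divLaw (q p) (E p)) *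
        sieve 𝒮 q E ^ 2 := Finset.sum_nonneg fun E _ => mul_nonneg (Finset.prod_nonneg fun p _ => by
      split_ifs
      exacts [zero_le_one, divLaw_nonneg (hq p) _]) (sq_nonneg _)
    calc _ ≤ (∏ p ∈ T, κ p) * (8 ^ T.card * V) ^ Fintype.card M :=
          mul_le_mul_of_nonneg_left (pow_le_pow_left₀ h5 h4 _) (Finset.prod_nonneg fun p _ => hκ p)
      _ = _ := by
          rw [Finset.prod_mul_distrib, Finset.prod_const, mul_pow, ← pow_mul, ← pow_mul,
            mul_comm T.card]
          ring
  change |∑ E : P → M → Bool, (∏ p, μ p (E p)) * F E - _| ≤ _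
  rw [hexp, ← Finset.sum_erase_add _ _ (Finset.empty_mem_powerset _), hA0, add_sub_cancel_right]
  refine (Finset.abs_sum_le_sum_abs _ _).trans ((Finset.sum_le_sum fun T _ => hA T).trans ?_)
  rw [← Finset.mul_sum, Finset.prod_one_add,
    ← Finset.sum_erase_add _ _ (Finset.empty_mem_powerset _), Finset.prod_empty,
    add_sub_cancel_right]

end Sieve

section Law

variable {M : Type} [Fintype M] [DecidableEq M]

/-- A signed law on bit strings with vanishing mass and vanishing marginals is controlled by its
values at strings with two nonzero bits. -/
theorem abs_le_of_marginals_eq_zero {δ : (M → Bool) → ℝ} {κ : ℝ} (h0 : ∑ e, δ e = 0)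
    (h1 : ∀ m, ∑ e, (if e m then δ e else 0) = 0)
    (h2 : ∀ e m m', m ≠ m' → e m → e m' → |δ e| ≤ κ) (hκ : 0 ≤ κ) (e : M → Bool) :
    |δ e| ≤ 4 ^ Fintype.card M * κ := by
  have hcard : ∀ (s : Finset (M → Bool)) (K : ℝ), 0 ≤ K → (∀ e ∈ s, |δ e| ≤ K) →
      |∑ e ∈ s, δ e| ≤ 2 ^ Fintype.card M * K := fun s K hK hs => by
    refine (Finset.abs_sum_le_sum_abs _ _).trans ((Finset.sum_le_card_nsmul _ _ _ hs).trans ?_)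
    rw [nsmul_eq_mul]
    refine mul_le_mul_of_nonneg_right ?_ hK
    have := Finset.card_le_univ s
    rw [Fintype.card_fun, Fintype.card_bool] at this
    exact_mod_cast this
  have hone : ∀ e m, e m → |δ e| ≤ 2 ^ Fintype.card M * κ := by
    intro e m he
    by_cases h : ∃ m', m' ≠ m ∧ e m'
    · obtain ⟨m', hne, hm'⟩ := h
      refine (h2 e m' m hne hm' he).trans (le_mul_of_one_le_left hκ ?_)
      exact one_le_pow₀ one_le_two
    · push Not at h
      have h3 := h1 m
      rw [← Finset.sum_filter, ← Finset.add_sum_erase _ _ (a := e) (by simpa using he)] at h3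
      rw [eq_neg_of_add_eq_zero_left h3, abs_neg]
      refine hcard _ _ hκ fun e' he' => ?_
      simp only [Finset.mem_erase, Finset.mem_filter, Finset.mem_univ, true_and] at he'
      obtain ⟨m', hm'⟩ : ∃ m', e' m' ≠ e m' := by
        by_contra! h'
        exact he'.1 (funext h')
      have hne : m' ≠ m := by
        rintro rfl
        exact hm' (he'.2.trans he.symm)
      refine h2 e' m' m hne ?_ he'.2
      have := h m' hne
      cases h4 : e' m'
      · simp_all
      · rfl
  have h24 : (2 : ℝ) ^ Fintype.card M * (2 ^ Fintype.card M * κ) = 4 ^ Fintype.card M * κ := by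
    rw [← mul_assoc, ← mul_pow]
    norm_num
  have hK : 0 ≤ 2 ^ Fintype.card M * κ := by positivity
  rw [← h24]
  by_cases h : ∃ m, e m
  · obtain ⟨m, hm⟩ := h
    exact (hone e m hm).trans (le_mul_of_one_le_left hK (one_le_pow₀ one_le_two))
  · push Not at h
    rw [← Finset.add_sum_erase _ _ (Finset.mem_univ e)] at h0
    rw [eq_neg_of_add_eq_zero_left h0, abs_neg]
    refine hcard _ _ hK fun e' he' => ?_
    obtain ⟨m', hm'⟩ : ∃ m', e' m' ≠ e m' := by
      by_contra! h'
      exact (Finset.mem_erase.mp he').1 (funext h')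
    refine hone e' m' ?_
    have := h m'
    cases h4 : e' m'
    · simp_all
    · rfl

theorem abs_sub_prod_divLaw_le {q : ℝ} (hq : 2 ≤ q) {μ : (M → Bool) → ℝ} (hμ : ∀ e, 0 ≤ μ e)
    (h0 : ∑ e, μ e = 1) (h1 : ∀ m, ∑ e, (if e m then μ e else 0) = 1 / q)
    (h2 : ∀ e m m', m ≠ m' → e m → e m' → μ e ≤ 1 / q ^ 2) (e : M → Bool) :
    |μ e - ∏ m, divLaw q (e m)| ≤ 4 ^ Fintype.card M * (1 / q ^ 2) := by
  have hq0 : 0 < q := by linarith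
  have hsum : ∑ b, divLaw q b = 1 := by simp [divLaw]
  have hle : ∀ b, divLaw q b ≤ 1 := fun b => by
    rw [← hsum]
    exact Finset.single_le_sum (f := divLaw q) (fun b _ => divLaw_nonneg hq b) (Finset.mem_univ b)
  refine abs_le_of_marginals_eq_zero (δ := fun e => μ e - ∏ m, divLaw q (e m)) ?_ ?_ ?_
    (by positivity) e
  · rw [Finset.sum_sub_distrib, h0, sum_prod_pi fun _ : M => divLaw q]
    simp only [hsum, Finset.prod_const_one, sub_self]
  · intro m
    have h3 : ∀ e : M → Bool, (if e m then μ e - ∏ m, divLaw q (e m) else 0) =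
        (if e m then μ e else 0) -
          ∏ m', (if m' = m ∧ e m' = false then 0 else divLaw q (e m')) := fun e => by
      split_ifs with h
      · congr 1
        refine Finset.prod_congr rfl fun m' _ => (if_neg ?_).symm
        rintro ⟨rfl, h'⟩
        simp_all
      · rw [Finset.prod_eq_zero (Finset.mem_univ m) (by simp_all), sub_zero]
    rw [Finset.sum_congr rfl fun e _ => h3 e, Finset.sum_sub_distrib, h1,
      sum_prod_pi fun (m' : M) b => if m' = m ∧ b = false then 0 else divLaw q b,
      Finset.prod_eq_single m]
    · simp [divLaw]
    · intro m' _ hne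
      simp only [hne, false_and, if_false, hsum]
    · simp
  · intro e m m' hne hm hm'
    refine abs_sub_le_of_nonneg_of_le (hμ e) (h2 e m m' hne hm hm')
      (Finset.prod_nonneg fun _ _ => divLaw_nonneg hq _) ?_
    rw [← Finset.mul_prod_erase _ _ (Finset.mem_univ m),
      ← Finset.mul_prod_erase _ _ (Finset.mem_erase.mpr ⟨hne.symm, Finset.mem_univ m'⟩), hm, hm']
    have h3 : ∏ x ∈ (Finset.univ.erase m).erase m', divLaw q (e x) ≤ 1 :=
      Finset.prod_le_one (fun _ _ => divLaw_nonneg hq _) fun _ _ => hle _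
    calc _ ≤ divLaw q true * (divLaw q true * 1) := by
          refine mul_le_mul_of_nonneg_left (mul_le_mul_of_nonneg_left h3 ?_) ?_ <;>
            exact divLaw_nonneg hq _
      _ = _ := by simp [divLaw]; ring

end Law

section Model

theorem avg_pi_prod {P : Type} [Fintype P] [DecidableEq P] {Y : P → Type} [∀ p, Finite (Y p)]
    (g : ∀ p, Y p → ℝ) : (avg fun t : ∀ p, Y p => ∏ p, g p (t p)) = ∏ p, avg (g p) := by
  cases nonempty_fintype (∀ p, Y p)
  have := fun p => Fintype.ofFinite (Y p)
  simp only [avg_eq_sum_div]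
  rw [Finset.prod_div_distrib, ← sum_prod_pi, Nat.card_pi]
  push_cast
  congr 1
  exact Finset.sum_congr (by ext; simp) fun _ _ => rfl

theorem avg_single {X : Type} [Finite X] [DecidableEq X] (x : X) :
    (avg fun y => if y = x then (1 : ℝ) else 0) = 1 / Nat.card X := by
  cases nonempty_fintype X
  rw [avg_eq_sum_div]
  simp

variable {M D : Type} [Fintype M] [DecidableEq M] [Fintype D] [DecidableEq D]

/-- The law of the vanishing pattern of a system of affine-linear forms. -/
theorem abs_avg_pattern_sub_le (p : ℕ) [hp : Fact p.Prime] (c : M → D → ZMod p) (s : M → ZMod p)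
    (hc : ∀ m, ∃ a, c m a ≠ 0)
    (hcc : ∀ m m', m ≠ m' → ∃ a a', c m a ≠ 0 ∧ c m' a' ≠ 0 ∧ c m a' = 0 ∧ c m' a = 0)
    (e : M → Bool) :
    |(avg fun t : D → ZMod p => if (fun m => decide (∑ d, c m d * t d = s m)) = e
        then (1 : ℝ) else 0) - ∏ m, divLaw p (e m)| ≤ 4 ^ Fintype.card M * (1 / (p : ℝ) ^ 2) := by
  let φ : M → (D → ZMod p) →+ ZMod p := fun m =>
    { toFun := fun t => ∑ d, c m d * t d
      map_zero' := by simp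
      map_add' := fun x y => by simp [mul_add, Finset.sum_add_distrib] }
  have hφ : ∀ m t, φ m t = ∑ d, c m d * t d := fun _ _ => rfl
  have hφ1 : ∀ m, Function.Surjective (φ m) := by
    intro m x
    obtain ⟨a, ha⟩ := hc m
    refine ⟨Pi.single a ((c m a)⁻¹ * x), ?_⟩
    rw [hφ, Finset.sum_eq_single a]
    · simp [ha]
    · intro d _ hd
      simp [hd]
    · simp
  have hφ2 : ∀ m m', m ≠ m' → Function.Surjective ((φ m).prod (φ m')) := by
    rintro m m' hne ⟨x, x'⟩
    obtain ⟨a, a', h1, h2, h3, h4⟩ := hcc m m' hne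
    have key : ∀ m d y, φ m (Pi.single d y) = c m d * y := by
      intro m d y
      rw [hφ, Finset.sum_eq_single d]
      · simp
      · intro d' _ hd
        simp [hd]
      · simp
    refine ⟨Pi.single a ((c m a)⁻¹ * x) + Pi.single a' ((c m' a')⁻¹ * x'), ?_⟩
    simp [key, h1, h2, h3, h4]
  refine abs_sub_prod_divLaw_le (μ := fun e => avg fun t : D → ZMod p =>
    if (fun m => decide (∑ d, c m d * t d = s m)) = e then (1 : ℝ) else 0)
    (by exact_mod_cast hp.out.two_le) (fun e => avg_nonneg fun t => by split_ifs <;> simp) ?_ ?_ ?_ e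
  · rw [← avg_sum]
    simp [avg_const]
  · intro m
    have h1 : ∀ e : M → Bool, (if e m then avg fun t : D → ZMod p =>
        if (fun m => decide (∑ d, c m d * t d = s m)) = e then (1 : ℝ) else 0 else 0) =
        avg fun t : D → ZMod p => if (fun m => decide (∑ d, c m d * t d = s m)) = e then
          (if e m then (1 : ℝ) else 0) else 0 := fun e => by
      split_ifs with h
      · rfl
      · simp [avg_const]
    simp only [h1]
    rw [← avg_sum]
    simp only [Finset.sum_ite_eq, Finset.mem_univ, if_true, decide_eq_true_eq]
    have h2 := avg_comp_addMonoidHom (hφ1 m) fun y => if y = s m then (1 : ℝ) else 0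
    rw [avg_single, Nat.card_zmod] at h2
    exact h2
  · intro e m m' hne hm hm'
    have h2 := avg_comp_addMonoidHom (hφ2 m m' hne) fun y => if y = (s m, s m') then (1 : ℝ) else 0
    rw [avg_single, Nat.card_prod, Nat.card_zmod] at h2
    push_cast at h2
    rw [← sq] at h2
    rw [← h2]
    refine avg_mono fun t => ?_
    split_ifs with h3 h4 h4
    · exact le_rfl
    · refine absurd ?_ h4
      have h5 := congrFun h3 m
      have h6 := congrFun h3 m'
      rw [hm] at h5
      rw [hm'] at h6
      simp only [decide_eq_true_eq] at h5 h6
      simp only [AddMonoidHom.prod_apply, hφ, h5, h6]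
    · exact zero_le_one
    · exact le_rfl

/-- The truncated divisor sum at an integer. -/
noncomputable def sieveAt {𝒬 : Finset ℕ} (𝒮 : Finset (Finset 𝒬)) (n : ℤ) : ℝ :=
  sieve 𝒮 (fun p => ((p : ℕ) : ℝ)) fun p => decide (((p : ℕ) : ℤ) ∣ n)

/-- A system of integral linear forms, any two of which are separated by a pair of variables, where
the nonzero coefficients involved are coprime to `𝒬`. -/
def Separated (𝒬 : Finset ℕ) (c : M → D → ℤ) : Prop :=
  (∀ m, ∃ a, ∀ p ∈ 𝒬, ¬(p : ℤ) ∣ c m a) ∧ ∀ m m', m ≠ m' → ∃ a a',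
    (∀ p ∈ 𝒬, ¬(p : ℤ) ∣ c m a) ∧ (∀ p ∈ 𝒬, ¬(p : ℤ) ∣ c m' a') ∧ c m a' = 0 ∧ c m' a = 0

/-- Moments of truncated divisor sums along linear forms, averaged over a full period. -/
theorem abs_avg_prod_sieveAt_sub_le {𝒬 : Finset ℕ} (h𝒬 : ∀ p ∈ 𝒬, p.Prime)
    {𝒮 : Finset (Finset 𝒬)} (h𝒮 : ∀ S ∈ 𝒮, ∀ S' ⊆ S, S' ∈ 𝒮) {W b : ℤ}
    (hW : ∀ p ∈ 𝒬, ¬(p : ℤ) ∣ W) {c : M → D → ℤ} (hc : Separated 𝒬 c) (r : M → ℤ)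
    [NeZero (∏ p : 𝒬, (p : ℕ))] :
    |(avg fun t : D → ZMod (∏ p : 𝒬, (p : ℕ)) =>
        ∏ m, sieveAt 𝒮 (W * (r m + ∑ d, c m d * ((t d).val : ℤ)) + b) ^ 2) -
        sieveMass 𝒮 (fun p => ((p : ℕ) : ℝ)) ^ Fintype.card M| ≤
      sieveMass 𝒮 (fun p => ((p : ℕ) : ℝ)) ^ Fintype.card M *
        (∏ p : 𝒬, (1 + 32 ^ Fintype.card M / ((p : ℕ) : ℝ) ^ 2) - 1) := by
  have hfact : ∀ p : 𝒬, Fact (p : ℕ).Prime := fun p => ⟨h𝒬 p p.2⟩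
  let ε : ZMod (∏ p : 𝒬, (p : ℕ)) ≃+* ∀ p : 𝒬, ZMod (p : ℕ) := ZMod.prodEquivPi (fun p : 𝒬 => (p : ℕ)) fun p q hpq =>
    (Nat.coprime_primes (h𝒬 p p.2) (h𝒬 q q.2)).mpr fun h => hpq (Subtype.ext h)
  let s : ∀ p : 𝒬, M → ZMod (p : ℕ) := fun p m => -(b / W : ZMod (p : ℕ)) - r m
  let pat : ∀ p : 𝒬, (D → ZMod (p : ℕ)) → M → Bool := fun p τ m =>
    decide (∑ d, (c m d : ZMod (p : ℕ)) * τ d = s p m)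
  let φ : (D → ZMod (∏ p : 𝒬, (p : ℕ))) →+ ∀ p : 𝒬, D → ZMod (p : ℕ) :=
    { toFun := fun t p d => ε (t d) p
      map_zero' := by
        funext p d
        exact congrFun (map_zero ε) p
      map_add' := fun x y => by
        funext p d
        exact congrFun (map_add ε _ _) p }
  have hφ : Function.Surjective φ := fun τ => ⟨fun d => ε.symm fun p => τ p d, by
    funext p d
    exact congrFun (ε.apply_symm_apply _) p⟩
  have hval : ∀ t p d, φ t p d = ((t d).val : ZMod (p : ℕ)) := fun t p d => by
    change ε (t d) p = _
    have h := congrFun (map_natCast ε (t d).val) p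
    rwa [ZMod.natCast_zmod_val] at h
  have hdvd : ∀ (p : 𝒬) (m : M) (t : D → ZMod (∏ p : 𝒬, (p : ℕ))),
      decide (((p : ℕ) : ℤ) ∣ W * (r m + ∑ d, c m d * ((t d).val : ℤ)) + b) =
        pat p (φ t p) m := by
    intro p m t
    have hWp : (W : ZMod (p : ℕ)) ≠ 0 := fun h => hW p p.2 ((ZMod.intCast_zmod_eq_zero_iff_dvd _ _).mp h)
    refine decide_eq_decide.mpr ?_
    rw [← ZMod.intCast_zmod_eq_zero_iff_dvd]
    push_cast
    simp only [hval, s]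
    constructor
    · intro h
      field_simp
      linear_combination h
    · intro h
      rw [h]
      field_simp
      ring
  let F : (𝒬 → M → Bool) → ℝ := fun E =>
    ∏ m, sieve 𝒮 (fun p : 𝒬 => ((p : ℕ) : ℝ)) (fun p => E p m) ^ 2
  have h1 : (avg fun t : D → ZMod (∏ p : 𝒬, (p : ℕ)) =>
      ∏ m, sieveAt 𝒮 (W * (r m + ∑ d, c m d * ((t d).val : ℤ)) + b) ^ 2) =
      avg fun τ : ∀ p : 𝒬, D → ZMod (p : ℕ) => F fun p => pat p (τ p) := by
    rw [← avg_comp_addMonoidHom hφ]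
    simp only [sieveAt, hdvd]
    rfl
  have h2 : ∀ τ : ∀ p : 𝒬, D → ZMod (p : ℕ), (F fun p => pat p (τ p)) =
      ∑ E, (∏ p, if pat p (τ p) = E p then (1 : ℝ) else 0) * F E := by
    intro τ
    rw [Finset.sum_eq_single fun p => pat p (τ p)]
    · simp
    · intro E _ hE
      obtain ⟨p, hp⟩ : ∃ p, E p ≠ pat p (τ p) := by
        by_contra! h'
        exact hE (funext h')
      rw [Finset.prod_eq_zero (Finset.mem_univ p) (if_neg hp.symm), zero_mul]
    · simp
  rw [h1]
  simp only [h2]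
  rw [avg_sum]
  have h3 : ∀ E : 𝒬 → M → Bool, (avg fun τ : ∀ p : 𝒬, D → ZMod (p : ℕ) =>
      (∏ p, if pat p (τ p) = E p then (1 : ℝ) else 0) * F E) =
      (∏ p, avg fun t => if pat p t = E p then (1 : ℝ) else 0) * F E := fun E => by
    rw [avg_mul_const, avg_pi_prod fun p t => if pat p t = E p then (1 : ℝ) else 0]
  simp only [h3]
  have h4 := abs_sum_prod_sieve_sub_le (M := M) h𝒮 (q := fun p : 𝒬 => ((p : ℕ) : ℝ))
    (fun p => by exact_mod_cast (h𝒬 p p.2).two_le)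
    (μ := fun p e => avg fun t => if pat p t = e then (1 : ℝ) else 0)
    (κ := fun p => 4 ^ Fintype.card M * (1 / ((p : ℕ) : ℝ) ^ 2)) (fun p e => by
      refine abs_avg_pattern_sub_le p _ _ (fun m => ?_) (fun m m' hne => ?_) e
      · obtain ⟨a, ha⟩ := hc.1 m
        exact ⟨a, fun h => ha p p.2 ((ZMod.intCast_zmod_eq_zero_iff_dvd _ _).mp h)⟩
      · obtain ⟨a, a', ha, ha', h5, h6⟩ := hc.2 m m' hne
        exact ⟨a, a', fun h => ha p p.2 ((ZMod.intCast_zmod_eq_zero_iff_dvd _ _).mp h),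
          fun h => ha' p p.2 ((ZMod.intCast_zmod_eq_zero_iff_dvd _ _).mp h), by simp [h5],
          by simp [h6]⟩)
  refine h4.trans_eq ?_
  congr 3
  funext p
  rw [mul_right_comm, ← mul_pow, mul_one_div]
  norm_num

end Model

section Equidistribution

theorem avg_wrap_le (N : ℕ) [NeZero N] (y : ℤ) :
    (avg fun x : ZMod N => if 0 ≤ (x.val : ℤ) + y ∧ (x.val : ℤ) + y < N then (0 : ℝ) else 1) ≤
      |(y : ℝ)| / N := by
  rw [avg_eq_sum_div, Nat.card_zmod]
  refine div_le_div_of_nonneg_right ?_ (Nat.cast_nonneg N)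
  have h1 : ∀ x : ZMod N, (if 0 ≤ (x.val : ℤ) + y ∧ (x.val : ℤ) + y < N then (0 : ℝ) else 1) =
      if ¬(0 ≤ (x.val : ℤ) + y ∧ (x.val : ℤ) + y < N) then 1 else 0 := fun x => by
    split_ifs <;> rfl
  simp only [h1]
  rw [Finset.sum_boole]
  have h2 : ((Finset.univ.filter fun x : ZMod N =>
      ¬(0 ≤ (x.val : ℤ) + y ∧ (x.val : ℤ) + y < N)).card : ℤ) ≤ |y| := by
    rcases le_total 0 y with hy | hy
    · rw [abs_of_nonneg hy]
      have := Finset.card_le_card_of_injOn (t := Finset.Ico ((N : ℤ) - y) N)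
        (s := Finset.univ.filter fun x : ZMod N =>
          ¬(0 ≤ (x.val : ℤ) + y ∧ (x.val : ℤ) + y < N)) (fun x => (x.val : ℤ)) (fun x hx => by
          have hx' : ¬(0 ≤ (x.val : ℤ) + y ∧ (x.val : ℤ) + y < N) := by simpa using hx
          have := x.val_lt
          simp only [Finset.coe_Ico, Set.mem_Ico]
          omega) (fun x _ x' _ h => ZMod.val_injective N (Int.natCast_inj.mp h))
      rw [Int.card_Ico] at this
      omega
    · rw [abs_of_nonpos hy]
      have := Finset.card_le_card_of_injOn (t := Finset.Ico 0 (-y))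
        (s := Finset.univ.filter fun x : ZMod N =>
          ¬(0 ≤ (x.val : ℤ) + y ∧ (x.val : ℤ) + y < N)) (fun x => (x.val : ℤ)) (fun x hx => by
          have hx' : ¬(0 ≤ (x.val : ℤ) + y ∧ (x.val : ℤ) + y < N) := by simpa using hx
          have := x.val_lt
          simp only [Finset.coe_Ico, Set.mem_Ico]
          omega) (fun x _ x' _ h => ZMod.val_injective N (Int.natCast_inj.mp h))
      rw [Int.card_Ico] at this
      omega
  exact_mod_cast h2

variable {M D : Type} [Fintype M] [Fintype D]

/-- A bounded function of the values of linear forms modulo `N` is on average insensitive to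
translations of the values. -/
theorem abs_avg_val_sub_le {N : ℕ} [NeZero N] {c : M → D → ℤ}
    (hsurj : ∀ m, Function.Surjective fun v : D → ZMod N => ∑ d, (c m d : ZMod N) * v d)
    {h : (M → ℤ) → ℝ} (hh : ∀ n, |h n| ≤ 1) (t : D → ℤ) :
    |(avg fun v : D → ZMod N => h fun m => ((∑ d, (c m d : ZMod N) * v d).val : ℤ)) -
      avg fun v : D → ZMod N => h fun m =>
        ((∑ d, (c m d : ZMod N) * v d).val : ℤ) + ∑ d, c m d * t d| ≤
      2 * ∑ m, |((∑ d, c m d * t d : ℤ) : ℝ)| / N := by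
  let φ : M → (D → ZMod N) →+ ZMod N := fun m =>
    { toFun := fun t => ∑ d, c m d * t d
      map_zero' := by simp
      map_add' := fun x y => by simp [mul_add, Finset.sum_add_distrib] }
  let u : D → ZMod N := fun d => t d
  have hu : ∀ m, φ m u = ((∑ d, c m d * t d : ℤ) : ZMod N) := fun m => by
    simp [φ, u]
  have hval : ∀ (x : ZMod N) (y : ℤ), 0 ≤ (x.val : ℤ) + y → (x.val : ℤ) + y < N →
      ((x + (y : ZMod N)).val : ℤ) = x.val + y := by
    intro x y h1 h2
    have h3 : x + (y : ZMod N) = (((x.val : ℤ) + y : ℤ) : ZMod N) := by simp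
    rw [h3, ZMod.val_intCast, Int.emod_eq_of_lt h1 h2]
  have heq := avg_equiv (Equiv.addRight u) fun v : D → ZMod N => h fun m => ((φ m v).val : ℤ)
  have heq' : (avg fun v : D → ZMod N => h fun m => ((∑ d, (c m d : ZMod N) * v d).val : ℤ)) =
      avg fun v => h fun m => ((φ m (Equiv.addRight u v)).val : ℤ) := heq.symm
  rw [heq', ← avg_sub]
  refine (abs_avg_le _).trans ?_
  have hbad : ∀ v : D → ZMod N,
      |(h fun m => ((φ m (Equiv.addRight u v)).val : ℤ)) -
        h fun m => ((∑ d, (c m d : ZMod N) * v d).val : ℤ) + ∑ d, c m d * t d| ≤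
      2 * ∑ m, if 0 ≤ ((φ m v).val : ℤ) + ∑ d, c m d * t d ∧
        ((φ m v).val : ℤ) + ∑ d, c m d * t d < N then (0 : ℝ) else 1 := by
    intro v
    by_cases hg : ∀ m, 0 ≤ ((φ m v).val : ℤ) + ∑ d, c m d * t d ∧
        ((φ m v).val : ℤ) + ∑ d, c m d * t d < N
    · have h1 : (fun m => ((φ m (Equiv.addRight u v)).val : ℤ)) =
          fun m => ((∑ d, (c m d : ZMod N) * v d).val : ℤ) + ∑ d, c m d * t d := by
        funext m
        rw [Equiv.coe_addRight, map_add, hu]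
        exact hval _ _ (hg m).1 (hg m).2
      rw [h1, sub_self, abs_zero]
      exact mul_nonneg zero_le_two (Finset.sum_nonneg fun m _ => by split_ifs <;> simp)
    · push Not at hg
      obtain ⟨m, hm⟩ := hg
      refine (abs_sub _ _).trans ((add_le_add (hh _) (hh _)).trans ?_)
      have h1 := Finset.single_le_sum (f := fun m =>
        if 0 ≤ ((φ m v).val : ℤ) + ∑ d, c m d * t d ∧
        ((φ m v).val : ℤ) + ∑ d, c m d * t d < N then (0 : ℝ) else 1)
        (fun m _ => by split_ifs <;> simp) (Finset.mem_univ m)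
      rw [if_neg (fun h' => absurd h'.2 (not_lt.mpr (hm h'.1)))] at h1
      linarith
  refine (avg_mono hbad).trans ?_
  rw [avg_const_mul, avg_sum]
  refine mul_le_mul_of_nonneg_left (Finset.sum_le_sum fun m _ => ?_) zero_le_two
  have h1 := avg_comp_addMonoidHom (φ := φ m) (hsurj m) fun x =>
    if 0 ≤ (x.val : ℤ) + ∑ d, c m d * t d ∧ (x.val : ℤ) + ∑ d, c m d * t d < N
      then (0 : ℝ) else 1
  rw [h1]
  exact avg_wrap_le N _

theorem avg_period_eq_of_dvd {D₀ Q : ℕ} [NeZero D₀] [NeZero Q] (hdvd : D₀ ∣ Q)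
    {h : (D → ℤ) → ℝ} (hper : ∀ n n', (∀ d, n d ≡ n' d [ZMOD D₀]) → h n = h n') :
    (avg fun t : D → ZMod D₀ => h fun d => (t d).val) =
      avg fun t : D → ZMod Q => h fun d => (t d).val := by
  let φ : (D → ZMod Q) →+ (D → ZMod D₀) :=
    { toFun := fun t d => ZMod.castHom hdvd (ZMod D₀) (t d)
      map_zero' := by
        funext d
        simp
      map_add' := fun x y => by
        funext d
        simp only [Pi.add_apply, map_add] }
  have hφ : Function.Surjective φ := fun τ => by
    choose s hs using fun d => ZMod.castHom_surjective hdvd (τ d)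
    exact ⟨s, funext hs⟩
  rw [← avg_comp_addMonoidHom hφ]
  congr 1
  funext t
  refine hper _ _ fun d => ?_
  rw [← ZMod.intCast_eq_intCast_iff]
  change (((ZMod.castHom hdvd (ZMod D₀) (t d)).val : ℤ) : ZMod D₀) = _
  rw [Int.cast_natCast, ZMod.natCast_zmod_val, ZMod.castHom_apply, ← ZMod.natCast_val,
    Int.cast_natCast]

theorem avg_period_eq {D₀ Q : ℕ} [NeZero D₀] [NeZero Q]
    {h : (D → ℤ) → ℝ} (h₀ : ∀ n n', (∀ d, n d ≡ n' d [ZMOD D₀]) → h n = h n')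
    (h₁ : ∀ n n', (∀ d, n d ≡ n' d [ZMOD Q]) → h n = h n') :
    (avg fun t : D → ZMod D₀ => h fun d => (t d).val) =
      avg fun t : D → ZMod Q => h fun d => (t d).val :=
  (avg_period_eq_of_dvd (dvd_mul_right D₀ Q) h₀).trans
    (avg_period_eq_of_dvd (dvd_mul_left Q D₀) h₁).symm

end Equidistribution

section SieveForms

theorem abs_prod_divWeight_le_one {𝒬 : Finset ℕ} (h𝒬 : ∀ p ∈ 𝒬, p.Prime) (S : Finset 𝒬)
    (E : 𝒬 → Bool) : |∏ p ∈ S, divWeight ((p : ℕ) : ℝ) (E p)| ≤ 1 := by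
  rw [Finset.abs_prod]
  exact Finset.prod_le_one (fun _ _ => abs_nonneg _) fun p _ =>
    abs_divWeight_le_one (by exact_mod_cast (h𝒬 p p.2).two_le) _

variable {M D : Type} [Fintype M] [DecidableEq M] [Fintype D] [DecidableEq D]

/-- Moments of truncated divisor sums along linear forms over a cyclic group. -/
theorem abs_avg_prod_sieveAt_form_sub_le {𝒬 : Finset ℕ} (h𝒬 : ∀ p ∈ 𝒬, p.Prime)
    {𝒮 : Finset (Finset 𝒬)} (h𝒮 : ∀ S ∈ 𝒮, ∀ S' ⊆ S, S' ∈ 𝒮) {R : ℕ} (hcard : 𝒮.card ≤ R)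
    (hR : ∀ S ∈ 𝒮, ∏ p ∈ S, (p : ℕ) ≤ R) {W b : ℤ} (hW : ∀ p ∈ 𝒬, ¬(p : ℤ) ∣ W)
    {c : M → D → ℤ} (hc : Separated 𝒬 c) {B : ℕ} (hB : ∀ m, ∑ d, |c m d| ≤ B) {N : ℕ} [NeZero N]
    (hsurj : ∀ m, Function.Surjective fun v : D → ZMod N => ∑ d, (c m d : ZMod N) * v d) :
    |(avg fun v : D → ZMod N =>
        ∏ m, sieveAt 𝒮 (W * ((∑ d, (c m d : ZMod N) * v d).val : ℤ) + b) ^ 2) -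
        sieveMass 𝒮 (fun p => ((p : ℕ) : ℝ)) ^ Fintype.card M| ≤
      sieveMass 𝒮 (fun p => ((p : ℕ) : ℝ)) ^ Fintype.card M *
        (∏ p : 𝒬, (1 + 32 ^ Fintype.card M / ((p : ℕ) : ℝ) ^ 2) - 1) +
      2 * Fintype.card M * B * (R : ℝ) ^ (4 * Fintype.card M) / N := by
  have hQ : NeZero (∏ p : 𝒬, (p : ℕ)) :=
    ⟨Finset.prod_ne_zero_iff.mpr fun p _ => (h𝒬 p p.2).ne_zero⟩
  let Q := ∏ p : 𝒬, (p : ℕ)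
  let L : M → (D → ZMod N) → ℤ := fun m v => ((∑ d, (c m d : ZMod N) * v d).val : ℤ)
  let F : (M → ℤ) → ℝ := fun x => ∏ m, sieveAt 𝒮 (W * x m + b) ^ 2
  let 𝒜 : Finset (M → Finset 𝒬 × Finset 𝒬) := Fintype.piFinset fun _ => 𝒮 ×ˢ 𝒮
  let g : Finset 𝒬 → ℤ → ℝ := fun S n =>
    ∏ p ∈ S, divWeight ((p : ℕ) : ℝ) (decide (((p : ℕ) : ℤ) ∣ n))
  let h : (M → Finset 𝒬 × Finset 𝒬) → (M → ℤ) → ℝ := fun a x =>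
    ∏ m, g (a m).1 (W * x m + b) * g (a m).2 (W * x m + b)
  have hF : ∀ x, F x = ∑ a ∈ 𝒜, h a x := fun x => by
    simp only [F, h, 𝒜]
    rw [← Finset.prod_univ_sum (fun _ : M => 𝒮 ×ˢ 𝒮)
      fun m s => g s.1 (W * x m + b) * g s.2 (W * x m + b)]
    refine Finset.prod_congr rfl fun m _ => ?_
    rw [sieveAt, sieve, sq, Finset.sum_mul_sum, Finset.sum_product]
  have hh1 : ∀ a x, |h a x| ≤ 1 := fun a x => by
    rw [Finset.abs_prod]
    refine Finset.prod_le_one (fun _ _ => abs_nonneg _) fun m _ => ?_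
    rw [abs_mul]
    exact mul_le_one₀ (abs_prod_divWeight_le_one h𝒬 _ _) (abs_nonneg _)
      (abs_prod_divWeight_le_one h𝒬 _ _)
  have hgper : ∀ (S : Finset 𝒬) (n n' : ℤ), (∀ p ∈ S, n ≡ n' [ZMOD (p : ℕ)]) → g S n = g S n' :=
    fun S n n' hn => Finset.prod_congr rfl fun p hp => by
      rw [decide_eq_decide.mpr (hn p hp).dvd_iff]
  have hhper : ∀ a (x x' : M → ℤ), (∀ m, ∀ p : 𝒬, p ∈ (a m).1 ∨ p ∈ (a m).2 →
      x m ≡ x' m [ZMOD (p : ℕ)]) → h a x = h a x' := fun a x x' hx => by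
    refine Finset.prod_congr rfl fun m _ => ?_
    rw [hgper _ _ (W * x' m + b) fun p hp => ((hx m p (Or.inl hp)).mul_left W).add_right b,
      hgper (a m).2 _ (W * x' m + b) fun p hp => ((hx m p (Or.inr hp)).mul_left W).add_right b]
  have hshift : ∀ (a : M → Finset 𝒬 × Finset 𝒬) (q : ℕ),
      (∀ m, ∀ p : 𝒬, p ∈ (a m).1 ∨ p ∈ (a m).2 → (p : ℕ) ∣ q) → ∀ v (n n' : D → ℤ),
      (∀ d, n d ≡ n' d [ZMOD q]) →
      h a (fun m => L m v + ∑ d, c m d * n d) = h a (fun m => L m v + ∑ d, c m d * n' d) :=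
    fun a q hq v n n' hn => hhper a _ _ fun m p hp => Int.ModEq.add_left _ <|
      Int.ModEq.sum fun d _ => Int.ModEq.mul_left _ <|
        (hn d).of_dvd (Int.natCast_dvd_natCast.mpr (hq m p hp))
  let X : (M → Finset 𝒬 × Finset 𝒬) → ℝ := fun a => avg fun v => h a fun m => L m v
  let Y : (M → Finset 𝒬 × Finset 𝒬) → ℝ := fun a => avg fun v => avg fun t : D → ZMod Q =>
    h a fun m => L m v + ∑ d, c m d * ((t d).val : ℤ)
  have hXY : ∀ a ∈ 𝒜, |X a - Y a| ≤
      2 * (Fintype.card M * (B * (R : ℝ) ^ (2 * Fintype.card M) / N)) := by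
    intro a ha
    let D₀ : ℕ := ∏ m, (∏ p ∈ (a m).1, (p : ℕ)) * ∏ p ∈ (a m).2, (p : ℕ)
    have hD₀ : NeZero D₀ := ⟨Finset.prod_ne_zero_iff.mpr fun m _ => mul_ne_zero
      (Finset.prod_ne_zero_iff.mpr fun p _ => (h𝒬 p p.2).ne_zero)
      (Finset.prod_ne_zero_iff.mpr fun p _ => (h𝒬 p p.2).ne_zero)⟩
    have hD₀R : D₀ ≤ R ^ (2 * Fintype.card M) := by
      rw [pow_mul, ← Finset.card_univ, ← Finset.prod_const]
      refine Finset.prod_le_prod' fun m _ => ?_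
      rw [sq]
      have h1 := Finset.mem_product.mp (Fintype.mem_piFinset.mp ha m)
      exact Nat.mul_le_mul (hR _ h1.1) (hR _ h1.2)
    have hY : Y a = avg fun t : D → ZMod D₀ => avg fun v =>
        h a fun m => L m v + ∑ d, c m d * ((t d).val : ℤ) := by
      rw [avg_comm]
      simp only [Y]
      congr 1
      funext v
      refine (avg_period_eq (h := fun n : D → ℤ => h a fun m => L m v + ∑ d, c m d * n d)
        (hshift a D₀ (fun m p hp => ?_) v) (hshift a Q (fun m p hp => ?_) v)).symm
      · refine dvd_trans ?_ (Finset.dvd_prod_of_mem _ (Finset.mem_univ m))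
        rcases hp with hp | hp
        · exact (Finset.dvd_prod_of_mem _ hp).mul_right _
        · exact (Finset.dvd_prod_of_mem _ hp).mul_left _
      · exact Finset.dvd_prod_of_mem _ (Finset.mem_univ p)
    rw [hY, ← avg_const (X := D → ZMod D₀) (X a), ← avg_sub]
    refine (abs_avg_le _).trans (avg_le_of_le fun t => ?_)
    refine (abs_avg_val_sub_le hsurj (hh1 a) fun d => ((t d).val : ℤ)).trans ?_
    refine mul_le_mul_of_nonneg_left ?_ zero_le_two
    rw [← Finset.sum_div, ← mul_div_assoc]
    refine div_le_div_of_nonneg_right ?_ (Nat.cast_nonneg N)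
    rw [← Finset.card_univ, ← nsmul_eq_mul]
    refine Finset.sum_le_card_nsmul _ _ _ fun m _ => ?_
    have h1 : |∑ d, c m d * ((t d).val : ℤ)| ≤ B * (R ^ (2 * Fintype.card M) : ℕ) := by
      refine (Finset.abs_sum_le_sum_abs _ _).trans ?_
      refine le_trans (Finset.sum_le_sum (g := fun d => |c m d| * (D₀ : ℤ)) fun d _ => ?_) ?_
      · rw [abs_mul, Nat.abs_cast]
        exact mul_le_mul_of_nonneg_left (by exact_mod_cast (t d).val_lt.le) (abs_nonneg _)
      · rw [← Finset.sum_mul]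
        exact mul_le_mul (hB m) (by exact_mod_cast hD₀R) (by positivity) (by positivity)
    exact_mod_cast h1
  have hmodel : ∀ v, |(avg fun t : D → ZMod Q =>
      F fun m => L m v + ∑ d, c m d * ((t d).val : ℤ)) -
      sieveMass 𝒮 (fun p => ((p : ℕ) : ℝ)) ^ Fintype.card M| ≤
      sieveMass 𝒮 (fun p => ((p : ℕ) : ℝ)) ^ Fintype.card M *
        (∏ p : 𝒬, (1 + 32 ^ Fintype.card M / ((p : ℕ) : ℝ) ^ 2) - 1) := fun v =>
    abs_avg_prod_sieveAt_sub_le h𝒬 h𝒮 hW hc fun m => L m v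
  have hX : (avg fun v => F fun m => L m v) = ∑ a ∈ 𝒜, X a := by
    simp only [hF, X]
    rw [avg_sum]
  have hY : (avg fun v => avg fun t : D → ZMod Q =>
      F fun m => L m v + ∑ d, c m d * ((t d).val : ℤ)) = ∑ a ∈ 𝒜, Y a := by
    simp only [hF, Y, avg_sum]
  have h1 : |∑ a ∈ 𝒜, X a - ∑ a ∈ 𝒜, Y a| ≤
      2 * Fintype.card M * B * (R : ℝ) ^ (4 * Fintype.card M) / N := by
    rw [← Finset.sum_sub_distrib]
    refine (Finset.abs_sum_le_sum_abs _ _).trans ((Finset.sum_le_card_nsmul _ _ _ hXY).trans ?_)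
    have h2 : 𝒜.card ≤ R ^ (2 * Fintype.card M) := by
      simp only [𝒜, Fintype.card_piFinset, Finset.prod_const, Finset.card_univ,
        Finset.card_product]
      rw [pow_mul, sq]
      exact Nat.pow_le_pow_left (Nat.mul_le_mul hcard hcard) _
    rw [nsmul_eq_mul]
    calc _ ≤ (R : ℝ) ^ (2 * Fintype.card M) *
          (2 * (Fintype.card M * (B * (R : ℝ) ^ (2 * Fintype.card M) / N))) :=
          mul_le_mul_of_nonneg_right (by exact_mod_cast h2) (by positivity)
      _ = _ := by ring
  have h3 : |∑ a ∈ 𝒜, Y a - sieveMass 𝒮 (fun p => ((p : ℕ) : ℝ)) ^ Fintype.card M| ≤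
      sieveMass 𝒮 (fun p => ((p : ℕ) : ℝ)) ^ Fintype.card M *
        (∏ p : 𝒬, (1 + 32 ^ Fintype.card M / ((p : ℕ) : ℝ) ^ 2) - 1) := by
    rw [← hY, ← avg_const (X := D → ZMod N)
      (sieveMass 𝒮 (fun p => ((p : ℕ) : ℝ)) ^ Fintype.card M), ← avg_sub]
    refine (abs_avg_le _).trans (avg_le_of_le fun v => ?_)
    rw [avg_const]
    exact hmodel v
  change |(avg fun v => F fun m => L m v) - _| ≤ _
  rw [hX, add_comm]
  exact (abs_sub_le _ _ _).trans (add_le_add h1 h3)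

end SieveForms

section SieveMeasure

/-- The primes used in the sieve. -/
def sievePrimes (w R : ℕ) : Finset ℕ := (Finset.Ioc w R).filter Nat.Prime

/-- The sets of primes with product at most `R`. -/
def sieveSets (w R : ℕ) : Finset (Finset (sievePrimes w R)) :=
  Finset.univ.filter fun S => ∏ p ∈ S, (p : ℕ) ≤ R

/-- The mean square of the sieve. -/
noncomputable def sieveNorm (w R : ℕ) : ℝ :=
  sieveMass (sieveSets w R) fun p => ((p : ℕ) : ℝ)

/-- The normalised sieve weight on the progression `W * x + b`. -/
noncomputable def sieveMeasure (w R W b : ℕ) {N : ℕ} (x : ZMod N) : ℝ :=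
  sieveAt (sieveSets w R) (W * (x.val : ℤ) + b) ^ 2 / sieveNorm w R

theorem prime_of_mem_sievePrimes {w R p : ℕ} (hp : p ∈ sievePrimes w R) : p.Prime :=
  (Finset.mem_filter.mp hp).2

theorem mem_sieveSets {w R : ℕ} {S : Finset (sievePrimes w R)} :
    S ∈ sieveSets w R ↔ ∏ p ∈ S, (p : ℕ) ≤ R := by
  simp [sieveSets]

theorem sieveSets_mono {w R : ℕ} (S : Finset (sievePrimes w R)) (hS : S ∈ sieveSets w R)
    (S' : Finset (sievePrimes w R)) (h : S' ⊆ S) : S' ∈ sieveSets w R :=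
  mem_sieveSets.mpr <| (Finset.prod_le_prod_of_subset_of_one_le' h fun p _ _ =>
    (prime_of_mem_sievePrimes p.2).one_le).trans (mem_sieveSets.mp hS)

theorem prod_pos_of_sievePrimes {w R : ℕ} (S : Finset (sievePrimes w R)) :
    0 < ∏ p ∈ S, (p : ℕ) :=
  Finset.prod_pos fun p _ => (prime_of_mem_sievePrimes p.2).pos

theorem prod_sievePrimes_injective {w R : ℕ} :
    Function.Injective fun S : Finset (sievePrimes w R) => ∏ p ∈ S, (p : ℕ) := by
  intro S S' h
  have key : ∀ S : Finset (sievePrimes w R),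
      (∏ p ∈ S, (p : ℕ)).primeFactors = S.map (Function.Embedding.subtype _) := fun S => by
    have h1 : ∏ p ∈ S, (p : ℕ) = ∏ p ∈ S.map (Function.Embedding.subtype _), p := by
      rw [Finset.prod_map]
      rfl
    rw [h1, Nat.primeFactors_prod]
    intro p hp
    obtain ⟨q, -, rfl⟩ := Finset.mem_map.mp hp
    exact prime_of_mem_sievePrimes q.2
  have h2 := key S
  dsimp only at h
  rw [h, key S'] at h2
  exact (Finset.map_injective _ h2).symm

theorem card_sieveSets_le (w R : ℕ) : (sieveSets w R).card ≤ R := by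
  have := Finset.card_le_card_of_injOn (s := sieveSets w R) (t := Finset.Icc 1 R)
    (fun S => ∏ p ∈ S, (p : ℕ)) (fun S hS => by
      simp only [Finset.coe_Icc, Set.mem_Icc]
      exact ⟨prod_pos_of_sievePrimes S, mem_sieveSets.mp hS⟩) prod_sievePrimes_injective.injOn
  simpa using this

theorem one_le_sieveNorm {w R : ℕ} (hR : 1 ≤ R) : 1 ≤ sieveNorm w R := by
  have h := Finset.single_le_sum (s := sieveSets w R)
    (f := fun S : Finset (sievePrimes w R) => ∏ p ∈ S, 1 / (((p : ℕ) : ℝ) - 1)) (fun S _ => Finset.prod_nonneg fun p _ => by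
      have : (2 : ℝ) ≤ (p : ℕ) := by exact_mod_cast (prime_of_mem_sievePrimes p.2).two_le
      have : 0 ≤ ((p : ℕ) : ℝ) - 1 := by linarith
      positivity) (a := ∅) (mem_sieveSets.mpr (by simpa using hR))
  rwa [Finset.prod_empty] at h

theorem sieveNorm_le {w R : ℕ} : sieveNorm w R ≤ R := by
  unfold sieveNorm sieveMass
  refine (Finset.sum_le_card_nsmul _ _ 1 fun S _ => Finset.prod_le_one (fun p _ => ?_)
    fun p _ => ?_).trans ?_
  · have : (2 : ℝ) ≤ (p : ℕ) := by exact_mod_cast (prime_of_mem_sievePrimes p.2).two_le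
    have : 0 ≤ ((p : ℕ) : ℝ) - 1 := by linarith
    positivity
  · have : (2 : ℝ) ≤ (p : ℕ) := by exact_mod_cast (prime_of_mem_sievePrimes p.2).two_le
    rw [div_le_one (by linarith)]
    linarith
  · rw [nsmul_one]
    exact_mod_cast card_sieveSets_le w R

theorem sieveMeasure_nonneg {w R W b N : ℕ} (hR : 1 ≤ R) (x : ZMod N) :
    0 ≤ sieveMeasure w R W b x :=
  div_nonneg (sq_nonneg _) (zero_le_one.trans (one_le_sieveNorm hR))

/-- The sieve weight is maximal at integers without prime factors up to `R`. -/
theorem sieveMeasure_eq {w R W b N : ℕ} (hR : 1 ≤ R) {x : ZMod N}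
    (hx : ∀ p, p.Prime → p ≤ R → ¬p ∣ W * x.val + b) : sieveMeasure w R W b x = sieveNorm w R := by
  have h1 : sieveAt (sieveSets w R) (W * (x.val : ℤ) + b) = sieveNorm w R := by
    unfold sieveAt sieve sieveNorm sieveMass
    refine Finset.sum_congr rfl fun S _ => Finset.prod_congr rfl fun p _ => by
      have h2 : ¬((p : ℕ) : ℤ) ∣ W * (x.val : ℤ) + b := by
        have := hx p (prime_of_mem_sievePrimes p.2)
          (Finset.mem_Ioc.mp (Finset.mem_filter.mp p.2).1).2
        exact_mod_cast this
      simp [divWeight, h2]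
  have := one_le_sieveNorm (w := w) hR
  rw [sieveMeasure, h1, sq, mul_div_assoc, div_self (by linarith), mul_one]

theorem prod_one_add_div_sq_le {w R : ℕ} (hw : w ≠ 0) {C : ℝ} (hC : 0 ≤ C) :
    ∏ p : sievePrimes w R, (1 + C / ((p : ℕ) : ℝ) ^ 2) ≤ Real.exp (C / w) := by
  calc _ ≤ ∏ p : sievePrimes w R, Real.exp (C / ((p : ℕ) : ℝ) ^ 2) := by
        refine Finset.prod_le_prod (fun p _ => by positivity) fun p _ => ?_
        rw [add_comm]
        exact Real.add_one_le_exp _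
    _ = Real.exp (∑ p ∈ sievePrimes w R, C / (p : ℝ) ^ 2) := by
        rw [← Real.exp_sum, ← Finset.sum_coe_sort (sievePrimes w R) fun p => C / (p : ℝ) ^ 2]
    _ ≤ _ := by
        refine Real.exp_le_exp.mpr ?_
        rcases le_total w R with h | h
        · have h1 := sum_Ioc_inv_sq_le_sub (α := ℝ) hw h
          calc _ ≤ ∑ p ∈ Finset.Ioc w R, C / (p : ℝ) ^ 2 :=
                Finset.sum_le_sum_of_subset_of_nonneg (Finset.filter_subset _ _)
                  fun _ _ _ => by positivity
            _ = C * ∑ p ∈ Finset.Ioc w R, ((p : ℝ) ^ 2)⁻¹ := by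
                rw [Finset.mul_sum]
                rfl
            _ ≤ C * (w : ℝ)⁻¹ := by
                refine mul_le_mul_of_nonneg_left (h1.trans ?_) hC
                have : (0 : ℝ) ≤ (R : ℝ)⁻¹ := by positivity
                linarith
            _ = _ := rfl
        · rw [sievePrimes, Finset.Ioc_eq_empty (by omega), Finset.filter_empty, Finset.sum_empty]
          positivity

/-- The coefficients of the linear forms in the linear forms condition for progressions. -/
def apCoeff {k : ℕ} (p : Fin k × Finset (Fin k)) (d : Fin k × Bool) : ℤ :=
  if d.2 = decide (d.1 ∈ p.2) then (d.1 : ℤ) - (p.1 : ℤ) else 0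

variable {k : ℕ}

theorem abs_apCoeff_le (p : Fin k × Finset (Fin k)) (d : Fin k × Bool) : |apCoeff p d| ≤ k := by
  unfold apCoeff
  have h1 := d.1.2
  have h2 := p.1.2
  split_ifs
  · rw [abs_le]
    omega
  · simp

theorem sum_apCoeff_mul {Z : Type} [Ring Z] (p : Fin k × Finset (Fin k)) (v : Fin k × Bool → Z) :
    ∑ d, (apCoeff p d : Z) * v d = apForm Z p.1 (pick p.2 v) := by
  rw [Fintype.sum_prod_type, apForm_apply]
  refine Finset.sum_congr rfl fun i _ => ?_
  rw [Finset.sum_eq_single (decide (i ∈ p.2))]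
  · simp [apCoeff, pick, zsmul_eq_mul]
  · intro b _ hb
    simp [apCoeff, hb]
  · simp

theorem not_dvd_apCoeff {w R : ℕ} (hw : k ≤ w) (p : Fin k × Finset (Fin k)) {i : Fin k}
    (hi : i ≠ p.1) {q : ℕ} (hq : q ∈ sievePrimes w R) :
    ¬(q : ℤ) ∣ apCoeff p (i, decide (i ∈ p.2)) := by
  have h1 : w < q := (Finset.mem_Ioc.mp (Finset.mem_filter.mp hq).1).1
  have h2 := i.2
  have h3 := p.1.2
  have h4 : (i : ℕ) ≠ p.1 := fun h => hi (Fin.ext h)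
  simp only [apCoeff, if_true]
  intro h
  have := Int.eq_zero_of_abs_lt_dvd h (by rw [abs_lt]; omega)
  omega

theorem separated_apCoeff {w R : ℕ} (hk : 2 ≤ k) (hw : k ≤ w) {S : Finset (Fin k × Finset (Fin k))}
    (hS : ∀ p ∈ S, p.1 ∉ p.2) :
    Separated (sievePrimes w R) fun p : S => apCoeff (p : Fin k × Finset (Fin k)) := by
  have : Nontrivial (Fin k) := Fin.nontrivial_iff_two_le.mpr hk
  refine ⟨fun p => ?_, fun p p' hne => ?_⟩
  · obtain ⟨i, hi⟩ := exists_ne (p : Fin k × Finset (Fin k)).1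
    exact ⟨_, fun q hq => not_dvd_apCoeff hw _ hi hq⟩
  · obtain ⟨⟨j, ω⟩, hp⟩ := p
    obtain ⟨⟨j', ω'⟩, hp'⟩ := p'
    have h1 : j ∉ ω := hS _ hp
    have h1' : j' ∉ ω' := hS _ hp'
    by_cases hj : j = j'
    · subst hj
      have hω : ω ≠ ω' := fun h => hne (by simp [h])
      obtain ⟨i, hi⟩ : ∃ i, ¬(i ∈ ω ↔ i ∈ ω') := by
        by_contra! h
        exact hω (Finset.ext h)
      have hij : i ≠ j := by
        rintro rfl
        simp [h1, h1'] at hi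
      refine ⟨(i, decide (i ∈ ω)), (i, decide (i ∈ ω')),
        fun q hq => not_dvd_apCoeff hw (j, ω) hij hq,
        fun q hq => not_dvd_apCoeff hw (j, ω') hij hq, if_neg ?_, if_neg ?_⟩
      · rw [decide_eq_decide]
        exact fun h => hi h.symm
      · rw [decide_eq_decide]
        exact hi
    · refine ⟨(j', decide (j' ∈ ω)), (j, decide (j ∈ ω')),
        fun q hq => not_dvd_apCoeff hw (j, ω) (Ne.symm hj) hq,
        fun q hq => not_dvd_apCoeff hw (j', ω') hj hq, ?_, ?_⟩ <;> simp [apCoeff]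

theorem surjective_sum_apCoeff {N : ℕ} (hk : 2 ≤ k)
    (hN : ∀ m : ℕ, 0 < m → m < k → m.Coprime N) (p : Fin k × Finset (Fin k)) :
    Function.Surjective fun v : Fin k × Bool → ZMod N => ∑ d, (apCoeff p d : ZMod N) * v d := by
  have : Nontrivial (Fin k) := Fin.nontrivial_iff_two_le.mpr hk
  obtain ⟨i, hi⟩ := exists_ne p.1
  have hu : IsUnit ((apCoeff p (i, decide (i ∈ p.2)) : ℤ) : ZMod N) := by
    have h1 : (i : ℕ) ≠ p.1 := fun h => hi (Fin.ext h)
    have h2 := i.2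
    have h3 := p.1.2
    simp only [apCoeff, if_true]
    rcases lt_or_gt_of_ne h1 with h | h
    · have h4 := (ZMod.isUnit_iff_coprime _ _).mpr (hN ((p.1 : ℕ) - i) (by omega) (by omega))
      rw [Nat.cast_sub h.le] at h4
      have := h4.neg
      push_cast
      rwa [neg_sub] at this
    · have h4 := (ZMod.isUnit_iff_coprime _ _).mpr (hN ((i : ℕ) - p.1) (by omega) (by omega))
      rw [Nat.cast_sub h.le] at h4
      push_cast
      exact h4
  obtain ⟨u, hu⟩ := hu
  intro x
  refine ⟨Pi.single (i, decide (i ∈ p.2)) ((u⁻¹ : (ZMod N)ˣ) * x), ?_⟩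
  dsimp only
  rw [Finset.sum_eq_single (i, decide (i ∈ p.2))]
  · rw [Pi.single_eq_same, ← hu, ← mul_assoc, Units.mul_inv, one_mul]
  · intro d _ hd
    rw [Pi.single_eq_of_ne hd, mul_zero]
  · simp

/-- The sieve weight satisfies the linear forms condition. -/
theorem linForms_sieveMeasure {w R W b N : ℕ} [NeZero N] (hk : 2 ≤ k) (hw : k ≤ w) (hR : 1 ≤ R)
    (hW : ∀ p ∈ sievePrimes w R, ¬p ∣ W) (hN : ∀ m : ℕ, 0 < m → m < k → m.Coprime N) {ε : ℝ}
    (h1 : Real.exp (32 ^ (k * 2 ^ k) / w) - 1 ≤ ε / 2)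
    (h2 : 2 * (k * 2 ^ k) * (2 * k * k) * (R : ℝ) ^ (4 * (k * 2 ^ k)) / N ≤ ε / 2) :
    LinForms (fun (j : Fin k) v => sieveMeasure w R W b (apForm (ZMod N) j v)) ε := by
  intro S hS
  have hcard : Fintype.card S ≤ k * 2 ^ k := by
    rw [Fintype.card_coe]
    refine (Finset.card_le_univ S).trans_eq ?_
    simp
  have hV := one_le_sieveNorm (w := w) hR
  have hV' : 1 ≤ sieveNorm w R ^ Fintype.card S := one_le_pow₀ hV
  have h3 := abs_avg_prod_sieveAt_form_sub_le (M := S) (D := Fin k × Bool)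
    (fun p hp => prime_of_mem_sievePrimes hp) sieveSets_mono (card_sieveSets_le w R)
    (fun S hS => mem_sieveSets.mp hS) (W := W) (b := b) (fun p hp h => hW p hp (by exact_mod_cast h))
    (separated_apCoeff hk hw hS) (B := 2 * k * k) (fun p => by
      refine (Finset.sum_le_card_nsmul _ _ (k : ℤ) fun d _ => abs_apCoeff_le _ d).trans_eq ?_
      rw [Finset.card_univ, Fintype.card_prod, Fintype.card_fin, Fintype.card_bool, nsmul_eq_mul]
      push_cast
      ring) (N := N) (fun p => surjective_sum_apCoeff hk hN p)
  simp only [sum_apCoeff_mul] at h3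
  have h4 : (avg fun v : Fin k × Bool → ZMod N =>
      ∏ p ∈ S, sieveMeasure w R W b (apForm (ZMod N) p.1 (pick p.2 v))) =
      (avg fun v : Fin k × Bool → ZMod N => ∏ p : S, sieveAt (sieveSets w R)
        (W * ((apForm (ZMod N) (p : Fin k × Finset (Fin k)).1
          (pick (p : Fin k × Finset (Fin k)).2 v)).val : ℤ) + b) ^ 2) /
        sieveNorm w R ^ Fintype.card S := by
    rw [div_eq_mul_inv, ← avg_mul_const]
    congr 1
    funext v
    rw [← Finset.prod_coe_sort]
    simp only [sieveMeasure]
    rw [Finset.prod_div_distrib, Finset.prod_const, Finset.card_univ, div_eq_mul_inv]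
  rw [h4, div_sub_one (by linarith), abs_div, abs_of_pos (zero_lt_one.trans_le hV'),
    div_le_iff₀ (by linarith)]
  refine h3.trans ?_
  have h5 : ∏ p : sievePrimes w R, (1 + 32 ^ Fintype.card S / ((p : ℕ) : ℝ) ^ 2) - 1 ≤ ε / 2 := by
    refine le_trans (sub_le_sub_right (le_trans (Finset.prod_le_prod (fun p _ => by positivity)
      fun p _ => ?_) (prod_one_add_div_sq_le (C := 32 ^ (k * 2 ^ k)) (by omega) (by positivity))) _)
      h1
    gcongr
    norm_num
  have h6 : 2 * (Fintype.card S : ℝ) * (2 * k * k : ℕ) * (R : ℝ) ^ (4 * Fintype.card S) / N ≤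
      ε / 2 := by
    refine le_trans ?_ h2
    have h7 : (Fintype.card S : ℝ) ≤ k * 2 ^ k := by exact_mod_cast hcard
    have h8 : (1 : ℝ) ≤ R := by exact_mod_cast hR
    push_cast
    gcongr
  have h9 : 0 ≤ ε / 2 := le_trans (by positivity) h6
  calc _ ≤ sieveNorm w R ^ Fintype.card S * (ε / 2) + ε / 2 :=
        add_le_add (mul_le_mul_of_nonneg_left h5 (by linarith)) h6
    _ ≤ sieveNorm w R ^ Fintype.card S * (ε / 2) + sieveNorm w R ^ Fintype.card S * (ε / 2) :=
        add_le_add le_rfl (le_mul_of_one_le_left h9 hV')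
    _ = _ := by ring

end SieveMeasure

section Density

theorem sum_inv_of_primeFactors_eq_le (T : Finset ℕ) (hT : ∀ p ∈ T, p.Prime) (R : ℕ) :
    ∑ n ∈ (Finset.Icc 1 R).filter (fun n => n.primeFactors = T), (1 : ℝ) / n ≤
      ∏ p ∈ T, 1 / ((p : ℝ) - 1) := by
  have hfac : ∀ n ∈ (Finset.Icc 1 R).filter (fun n => n.primeFactors = T),
      ∏ p : T, (p : ℕ) ^ n.factorization p = n := by
    intro n hn
    obtain ⟨hn1, hn2⟩ := Finset.mem_filter.mp hn
    have h0 : n ≠ 0 := by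
      have := (Finset.mem_Icc.mp hn1).1
      omega
    conv_rhs => rw [← Nat.prod_factorization_pow_eq_self h0]
    rw [Finsupp.prod, Nat.support_factorization, hn2,
      ← Finset.prod_coe_sort T fun p => p ^ n.factorization p]
  have hinj : Set.InjOn (fun (n : ℕ) (p : T) => n.factorization p)
      ((Finset.Icc 1 R).filter fun n => n.primeFactors = T) := by
    intro n hn n' hn' h
    rw [← hfac n hn, ← hfac n' hn']
    refine Finset.prod_congr rfl fun p _ => ?_
    have h' : n.factorization p = n'.factorization p := congrFun h p
    rw [h']
  calc _ = ∑ n ∈ (Finset.Icc 1 R).filter (fun n => n.primeFactors = T),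
        ∏ p : T, (1 / ((p : ℕ) : ℝ)) ^ n.factorization p := by
        refine Finset.sum_congr rfl fun n hn => ?_
        conv_lhs => rw [← hfac n hn]
        push_cast
        rw [one_div, ← Finset.prod_inv_distrib]
        exact Finset.prod_congr rfl fun p _ => by rw [one_div, inv_pow]
    _ = ∑ e ∈ ((Finset.Icc 1 R).filter fun n => n.primeFactors = T).image
          (fun (n : ℕ) (p : T) => n.factorization p), ∏ p : T, (1 / ((p : ℕ) : ℝ)) ^ e p :=
        (Finset.sum_image (f := fun e : T → ℕ => ∏ p : T, (1 / ((p : ℕ) : ℝ)) ^ e p) hinj).symm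
    _ ≤ ∑ e ∈ Fintype.piFinset fun _ : T => Finset.Ico 1 (R + 1),
          ∏ p : T, (1 / ((p : ℕ) : ℝ)) ^ e p := by
        refine Finset.sum_le_sum_of_subset_of_nonneg (fun e he => ?_) fun _ _ _ => by positivity
        obtain ⟨n, hn, rfl⟩ := Finset.mem_image.mp he
        obtain ⟨hn1, hn2⟩ := Finset.mem_filter.mp hn
        rw [Finset.mem_Icc] at hn1
        refine Fintype.mem_piFinset.mpr fun p => Finset.mem_Ico.mpr ⟨?_, ?_⟩
        · have hp : (p : ℕ) ∈ n.primeFactors := hn2 ▸ p.2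
          exact (Nat.prime_of_mem_primeFactors hp).factorization_pos_of_dvd (by omega)
            (Nat.dvd_of_mem_primeFactors hp)
        · have := Nat.factorization_lt (p : ℕ) (n := n) (by omega)
          omega
    _ = ∏ p : T, ∑ e ∈ Finset.Ico 1 (R + 1), (1 / ((p : ℕ) : ℝ)) ^ e := by
        rw [Finset.prod_univ_sum]
    _ ≤ ∏ p : T, 1 / (((p : ℕ) : ℝ) - 1) := by
        refine Finset.prod_le_prod (fun p _ => by positivity) fun p _ => ?_
        have hp : (2 : ℝ) ≤ (p : ℕ) := by exact_mod_cast (hT p p.2).two_le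
        refine (geom_sum_Ico_le_of_lt_one (by positivity) ?_).trans_eq ?_
        · rw [div_lt_one (by linarith)]
          linarith
        · have : ((p : ℕ) : ℝ) - 1 ≠ 0 := by linarith
          field_simp
    _ = _ := Finset.prod_coe_sort T fun p => 1 / ((p : ℝ) - 1)

theorem prod_div_sub_one_eq {w W : ℕ} (hW0 : W ≠ 0) (hW : ∀ p, p.Prime → (p ∣ W ↔ p ≤ w)) :
    ∏ p ∈ Nat.primesLE w, (1 / ((p : ℝ) - 1) + 1) = W / W.totient := by
  have h1 : W.primeFactors = Nat.primesLE w := by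
    ext p
    rw [Nat.mem_primeFactors_of_ne_zero hW0, Nat.mem_primesLE, and_comm]
    exact and_congr_left fun hp => hW p hp
  have h2 := Nat.totient_mul_prod_primeFactors W
  rw [h1] at h2
  have h3 : (W.totient : ℝ) * ∏ p ∈ Nat.primesLE w, (p : ℝ) =
      W * ∏ p ∈ Nat.primesLE w, ((p : ℝ) - 1) := by
    have h4 : (∏ p ∈ Nat.primesLE w, ((p : ℝ) - 1)) = (∏ p ∈ Nat.primesLE w, (p - 1) : ℕ) := by
      push_cast
      refine Finset.prod_congr rfl fun p hp => ?_
      rw [Nat.cast_sub (Nat.prime_of_mem_primesLE hp).one_le, Nat.cast_one]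
    rw [h4, ← Nat.cast_prod, ← Nat.cast_mul, h2, Nat.cast_mul]
  have h5 : ∏ p ∈ Nat.primesLE w, ((p : ℝ) - 1) ≠ 0 := Finset.prod_ne_zero_iff.mpr fun p hp => by
    have : (2 : ℝ) ≤ p := by exact_mod_cast (Nat.prime_of_mem_primesLE hp).two_le
    linarith
  have h6 : (W.totient : ℝ) ≠ 0 := by
    exact_mod_cast (Nat.totient_pos.mpr (Nat.pos_of_ne_zero hW0)).ne'
  have h7 : ∏ p ∈ Nat.primesLE w, (1 / ((p : ℝ) - 1) + 1) =
      (∏ p ∈ Nat.primesLE w, (p : ℝ)) / ∏ p ∈ Nat.primesLE w, ((p : ℝ) - 1) := by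
    rw [← Finset.prod_div_distrib]
    refine Finset.prod_congr rfl fun p hp => ?_
    have : (2 : ℝ) ≤ p := by exact_mod_cast (Nat.prime_of_mem_primesLE hp).two_le
    have : (p : ℝ) - 1 ≠ 0 := by linarith
    field_simp
    ring
  rw [h7, div_eq_div_iff h5 h6, ← h3]
  ring

/-- A lower bound for the mean square of the sieve. -/
theorem log_le_mul_sieveNorm {w W R : ℕ} (hW0 : W ≠ 0) (hW : ∀ p, p.Prime → (p ∣ W ↔ p ≤ w)) :
    Real.log (R + 1) ≤ W / W.totient * sieveNorm w R := by
  have h1 := log_add_one_le_harmonic R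
  rw [harmonic_eq_sum_Icc] at h1
  push_cast at h1
  refine h1.trans ?_
  rw [← prod_div_sub_one_eq hW0 hW, Finset.prod_add_one, sieveNorm, sieveMass,
    Finset.sum_mul_sum, ← Finset.sum_product']
  let G : ℕ → Finset ℕ × Finset (sievePrimes w R) := fun n =>
    (n.primeFactors.filter (· ≤ w), Finset.univ.filter fun p : sievePrimes w R => (p : ℕ) ∣ n)
  have hG : ∀ n ∈ Finset.Icc 1 R, G n ∈ (Nat.primesLE w).powerset ×ˢ sieveSets w R := by
    intro n hn
    rw [Finset.mem_Icc] at hn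
    rw [Finset.mem_product, Finset.mem_powerset, mem_sieveSets]
    refine ⟨fun p hp => ?_, ?_⟩
    · rw [Finset.mem_filter] at hp
      exact Nat.mem_primesLE.mpr ⟨hp.2, Nat.prime_of_mem_primeFactors hp.1⟩
    · refine (Nat.le_of_dvd (by omega) ?_).trans hn.2
      refine Finset.prod_dvd_of_isRelPrime ?_ fun p hp => (Finset.mem_filter.mp hp).2
      intro p _ q _ hpq
      exact Nat.coprime_iff_isRelPrime.mp <| (Nat.coprime_primes (prime_of_mem_sievePrimes p.2) (prime_of_mem_sievePrimes q.2)).mpr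
        fun h => hpq (Subtype.ext h)
  rw [← Finset.sum_fiberwise_of_maps_to hG]
  refine Finset.sum_le_sum fun y hy => ?_
  obtain ⟨A, S⟩ := y
  rw [Finset.mem_product, Finset.mem_powerset] at hy
  have hA : ∀ p ∈ A, p.Prime ∧ p ≤ w := fun p hp =>
    ⟨(Nat.mem_primesLE.mp (hy.1 hp)).2, (Nat.mem_primesLE.mp (hy.1 hp)).1⟩
  have hS : ∀ p ∈ S.map (Function.Embedding.subtype _), p ∈ sievePrimes w R := fun p hp => by
    obtain ⟨q, -, rfl⟩ := Finset.mem_map.mp hp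
    exact q.2
  have hdisj : Disjoint A (S.map (Function.Embedding.subtype _)) :=
    Finset.disjoint_left.mpr fun p hp hp' => by
      have h2 := (hA p hp).2
      have h3 := (Finset.mem_Ioc.mp (Finset.mem_filter.mp (hS p hp')).1).1
      omega
  have h2 := sum_inv_of_primeFactors_eq_le (A ∪ S.map (Function.Embedding.subtype _))
    (fun p hp => (Finset.mem_union.mp hp).elim (fun h => (hA p h).1)
      fun h => prime_of_mem_sievePrimes (hS p h)) R
  rw [Finset.prod_union hdisj, Finset.prod_map] at h2
  rw [Finset.sum_congr rfl fun (n : ℕ) _ => one_div (n : ℝ)] at h2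
  refine le_trans (Finset.sum_le_sum_of_subset_of_nonneg ?_ fun _ _ _ => by positivity) h2
  intro n hn
  rw [Finset.mem_filter] at hn ⊢
  refine ⟨hn.1, ?_⟩
  have hn1 := Finset.mem_Icc.mp hn.1
  have h3 : n.primeFactors.filter (· ≤ w) = A := congrArg Prod.fst hn.2
  have h4 : (Finset.univ.filter fun p : sievePrimes w R => (p : ℕ) ∣ n) = S :=
    congrArg Prod.snd hn.2
  ext p
  rw [Finset.mem_union, ← h3, ← h4, Finset.mem_filter]
  simp only [Finset.mem_map, Finset.mem_filter, Finset.mem_univ, true_and]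
  constructor
  · intro hp
    by_cases hpw : p ≤ w
    · exact Or.inl ⟨hp, hpw⟩
    · have hpR := Nat.le_of_dvd (by omega) (Nat.dvd_of_mem_primeFactors hp)
      exact Or.inr ⟨⟨p, Finset.mem_filter.mpr ⟨Finset.mem_Ioc.mpr ⟨by omega, by omega⟩,
        Nat.prime_of_mem_primeFactors hp⟩⟩, Nat.dvd_of_mem_primeFactors hp, rfl⟩
  · rintro (h | ⟨q, hq, rfl⟩)
    · exact h.1
    · exact Nat.mem_primeFactors.mpr ⟨prime_of_mem_sievePrimes q.2, hq, by omega⟩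

end Density

section Chebyshev

theorem eventually_le_log_mul_primeCounting {A W : ℕ} (hA : 2 ≤ A) (hW : 1 ≤ W) :
    ∀ᶠ R : ℕ in Filter.atTop, (1 : ℝ) / (64 * A) ≤
      Real.log (R + 1) * (((W * (R ^ A / 2) - 1).primeCounting : ℝ) - R) / (W * (R ^ A : ℕ)) := by
  have hlog : ∀ᶠ R : ℕ in Filter.atTop, 64 * (A : ℝ) * Real.log R ≤ R := by
    have h := (Real.isLittleO_log_id_atTop.comp_tendsto tendsto_natCast_atTop_atTop).def
      (c := 1 / (64 * (A : ℝ))) (by positivity)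
    filter_upwards [h, Filter.eventually_ge_atTop 1] with R hR hR1
    have hR1' : (1 : ℝ) ≤ R := by exact_mod_cast hR1
    simp only [Function.comp_apply, id_eq, Real.norm_eq_abs] at hR
    rw [abs_of_nonneg (Real.log_nonneg hR1'), abs_of_nonneg (by linarith : (0 : ℝ) ≤ R)] at hR
    have hA' : (0 : ℝ) < 64 * A := by positivity
    rw [one_div, inv_mul_eq_div, le_div_iff₀ hA'] at hR
    linarith
  filter_upwards [hlog, Filter.eventually_ge_atTop W, Filter.eventually_ge_atTop 16]
    with R hRlog hRW hR16
  have hA2 : (2 : ℝ) ≤ A := by exact_mod_cast hA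
  have hW1 : (1 : ℝ) ≤ W := by exact_mod_cast hW
  have hR : (16 : ℝ) ≤ R := by exact_mod_cast hR16
  have hL : 0 < Real.log R := Real.log_pos (by linarith)
  have hRN : R ^ 2 ≤ R ^ A := Nat.pow_le_pow_right (by omega) hA
  have hRN' : (R : ℝ) ^ 2 ≤ (R ^ A : ℕ) := by exact_mod_cast hRN
  set N := R ^ A with hN
  have hN256 : (256 : ℝ) ≤ (N : ℝ) := by nlinarith
  set n := W * (N / 2) - 1 with hn
  have hN2 : 1 ≤ N / 2 := by
    have : 256 ≤ N := by exact_mod_cast hN256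
    omega
  have hn1 : n + 1 = W * (N / 2) := by
    have : 1 ≤ W * (N / 2) := Nat.mul_pos hW hN2
    omega
  have hn1' : (n : ℝ) + 1 = W * ((N / 2 : ℕ) : ℝ) := by exact_mod_cast hn1
  have hhalf : (N : ℝ) ≤ 2 * ((N / 2 : ℕ) : ℝ) + 1 := by
    have : N ≤ 2 * (N / 2) + 1 := by omega
    exact_mod_cast this
  have hhalf' : ((N / 2 : ℕ) : ℝ) ≤ N := by exact_mod_cast Nat.div_le_self N 2
  have hnlow : (W : ℝ) * N / 4 ≤ n := by nlinarith
  have hnup : (n : ℝ) ≤ W * N := by nlinarith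
  have hn64 : (64 : ℝ) ≤ n := by nlinarith
  have hpi := Chebyshev.pi_ge n
  have hlogn : Real.log (n + 1) ≤ (n + 1) / 4 - 1 + 2 * Real.log 2 := by
    have h1 := Real.log_le_sub_one_of_pos (show (0 : ℝ) < (n + 1) / 4 by positivity)
    rw [Real.log_div (by positivity) (by norm_num), show (4 : ℝ) = 2 ^ 2 by norm_num,
      Real.log_pow] at h1
    push_cast at h1
    linarith
  have hnum : (W : ℝ) * N / 16 ≤ n * Real.log 2 - Real.log (n + 1) := by
    nlinarith [Real.log_two_gt_d9, Real.log_two_lt_d9]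
  have hnpos : 0 < Real.log n := Real.log_pos (by linarith)
  have hlogup : Real.log n ≤ 2 * A * Real.log R := by
    have h1 : (n : ℝ) ≤ (R : ℝ) ^ (A + 1) := by
      refine hnup.trans ?_
      rw [pow_succ, mul_comm ((R : ℝ) ^ A), hN, Nat.cast_pow]
      have : (W : ℝ) ≤ R := by exact_mod_cast hRW
      gcongr
    have h2 := Real.log_le_log (by linarith) h1
    rw [Real.log_pow] at h2
    push_cast at h2
    nlinarith
  have hWN : (0 : ℝ) < W * N := by positivity
  have hpi2 : (W : ℝ) * N / 16 / (2 * A * Real.log R) ≤ n.primeCounting := by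
    refine le_trans ?_ hpi
    gcongr
    exact le_trans (by positivity) hnum
  have hAL : 0 < 64 * (A : ℝ) * Real.log R := by positivity
  have hR2 : (R : ℝ) ≤ W * N / (64 * A * Real.log R) := by
    rw [le_div_iff₀ hAL]
    nlinarith
  have hdiff : (W : ℝ) * N / (64 * A * Real.log R) ≤ n.primeCounting - R := by
    have : (W : ℝ) * N / 16 / (2 * A * Real.log R) = 2 * (W * N / (64 * A * Real.log R)) := by
      field_simp
      ring
    linarith
  have hlogR : Real.log R ≤ Real.log (R + 1) := Real.log_le_log (by linarith) (by linarith)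
  rw [le_div_iff₀ hWN]
  calc (1 : ℝ) / (64 * A) * (W * N) = Real.log R * (W * N / (64 * A * Real.log R)) := by
        field_simp
    _ ≤ _ := mul_le_mul hlogR hdiff (by positivity) (hL.le.trans hlogR)

end Chebyshev

section Primes

variable {k : ℕ}

/-- The `x < H` for which `W * x + b` is a prime exceeding `R`. -/
def primesInProgression (R W b H : ℕ) : Finset ℕ :=
  (Finset.range H).filter fun x => (W * x + b).Prime ∧ R < W * x + b

theorem exists_le_card_primesInProgression {R W H : ℕ} (hW0 : 0 < W) (hH : 0 < H)
    (hWR : ∀ p, p.Prime → p ∣ W → p ≤ R) :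
    ∃ b, ((W * H - 1).primeCounting - R : ℝ) / W.totient ≤
      (primesInProgression R W b H).card := by
  set n := W * H - 1 with hn
  have hn1 : n + 1 = W * H := by
    have : 0 < W * H := Nat.mul_pos hW0 hH
    omega
  let s := (Nat.primesLE n).filter (R < ·)
  have hs : (n.primeCounting - R : ℝ) ≤ s.card := by
    have h1 : Nat.primesLE n ⊆ s ∪ Finset.Icc 1 R := fun p hp => by
      rw [Finset.mem_union, Finset.mem_filter, Finset.mem_Icc]
      have := (Nat.prime_of_mem_primesLE hp).one_le
      by_cases h : R < p
      · exact Or.inl ⟨hp, h⟩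
      · exact Or.inr ⟨this, by omega⟩
    have h2 := (Finset.card_le_card h1).trans (Finset.card_union_le _ _)
    rw [Nat.primesLE_card_eq_primeCounting, Nat.card_Icc, Nat.add_sub_cancel] at h2
    have h3 : (n.primeCounting : ℝ) ≤ s.card + R := by exact_mod_cast h2
    linarith
  let T := (Finset.range W).filter fun a => W.Coprime a
  have hT : T.card = W.totient := rfl
  have hφ : 0 < W.totient := Nat.totient_pos.mpr hW0
  have hmaps : ∀ q ∈ s, q % W ∈ T := fun q hq => by
    obtain ⟨hq1, hq2⟩ := Finset.mem_filter.mp hq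
    refine Finset.mem_filter.mpr ⟨Finset.mem_range.mpr (Nat.mod_lt _ hW0), ?_⟩
    have hqp := Nat.prime_of_mem_primesLE hq1
    have h1 : W.Coprime q := ((Nat.Prime.coprime_iff_not_dvd hqp).mpr fun h => by
      have := hWR q hqp h
      omega).symm
    rw [Nat.Coprime, Nat.gcd_comm, ← Nat.gcd_rec]
    exact h1
  obtain ⟨b, -, hb⟩ := Finset.exists_le_card_fiber_of_nsmul_le_card_of_maps_to
    (b := (n.primeCounting - R : ℝ) / W.totient) hmaps
    (Finset.card_pos.mp (hT ▸ hφ)) (by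
      rw [hT, nsmul_eq_mul, mul_div_cancel₀ _ (by exact_mod_cast hφ.ne')]
      exact hs)
  refine ⟨b, hb.trans ?_⟩
  rw [Nat.cast_le]
  have hfib : ∀ q ∈ s.filter (fun q => q % W = b), W * (q / W) + b = q := fun q hq => by
    rw [← (Finset.mem_filter.mp hq).2, Nat.div_add_mod]
  refine Finset.card_le_card_of_injOn (fun q => q / W) (fun q hq => ?_) fun q hq q' hq' h => ?_
  · obtain ⟨hq1, hq2⟩ := Finset.mem_filter.mp (Finset.mem_filter.mp hq).1
    refine Finset.mem_filter.mpr ⟨Finset.mem_range.mpr ?_, ?_⟩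
    · have := (Nat.mem_primesLE.mp hq1).1
      exact Nat.div_lt_of_lt_mul (by omega)
    · rw [hfib q hq]
      exact ⟨Nat.prime_of_mem_primesLE hq1, hq2⟩
  · have h' : q / W = q' / W := h
    rw [← hfib q hq, ← hfib q' hq', h']

/-- A progression modulo `N` all of whose terms have representatives in the lower half is a
progression of natural numbers. -/
theorem exists_val_eq_add_mul {N : ℕ} [NeZero N] (hk : 2 ≤ k) {x d : ZMod N} (hd : d ≠ 0)
    (h : ∀ j < k, 2 * (x + (j : ℕ) • d).val < N) :
    ∃ a e : ℕ, 0 < e ∧ ∀ i < k, ∃ j < k, (x + j • d).val = a + i * e := by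
  let y : ℕ → ℤ := fun j => ((x + j • d).val : ℤ)
  have hy0 : ∀ j, 0 ≤ y j := fun j => Int.natCast_nonneg _
  have hyN : ∀ j < k, 2 * y j < N := fun j hj => by
    simp only [y]
    exact_mod_cast h j hj
  have hyc : ∀ j, ((y j : ℤ) : ZMod N) = x + j • d := fun j => by
    simp [y]
  have hstep : ∀ j, j + 1 < k → y (j + 1) - y j = y 1 - y 0 := by
    intro j hj
    have h1 : (((y (j + 1) - y j - (y 1 - y 0) : ℤ)) : ZMod N) = 0 := by
      push_cast
      rw [hyc, hyc, hyc, hyc]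
      simp only [add_smul, one_smul, zero_smul]
      abel
    rw [ZMod.intCast_zmod_eq_zero_iff_dvd] at h1
    have h2 := Int.eq_zero_of_abs_lt_dvd h1 (by
      have := hy0 j; have := hy0 (j + 1); have := hy0 0; have := hy0 1
      have := hyN j (by omega); have := hyN (j + 1) hj
      have := hyN 0 (by omega); have := hyN 1 (by omega)
      rw [abs_lt]
      constructor <;> linarith)
    linarith
  have hlin : ∀ j < k, y j = y 0 + j * (y 1 - y 0) := by
    intro j
    induction j with
    | zero => intro _; simp
    | succ j ih =>
      intro hj
      have h1 := hstep j hj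
      have h2 := ih (by omega)
      push_cast
      linarith
  have hne : y 1 - y 0 ≠ 0 := fun h0 => hd <| by
    have h1 : ((y 1 - y 0 : ℤ) : ZMod N) = d := by
      push_cast
      rw [hyc, hyc]
      simp
    rw [← h1, h0, Int.cast_zero]
  rcases lt_or_gt_of_ne hne with hneg | hpos
  · refine ⟨(x + (k - 1) • d).val, (y 0 - y 1).toNat, by omega, fun i hi =>
      ⟨k - 1 - i, by omega, ?_⟩⟩
    have h1 := hlin (k - 1 - i) (by omega)
    have h2 := hlin (k - 1) (by omega)
    have h3 : (((k - 1 - i : ℕ) : ℤ)) = ((k - 1 : ℕ) : ℤ) - i := by omega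
    rw [h3] at h1
    zify
    rw [Int.toNat_of_nonneg (by omega)]
    change y (k - 1 - i) = y (k - 1) + i * (y 0 - y 1)
    rw [h1, h2]
    ring
  · refine ⟨(x + 0 • d).val, (y 1 - y 0).toNat, by omega, fun i hi => ⟨i, hi, ?_⟩⟩
    zify
    rw [Int.toNat_of_nonneg (by omega)]
    exact hlin i hi

theorem bijective_nsmul_zmod {N m : ℕ} (hm : m.Coprime N) :
    Function.Bijective fun z : ZMod N => m • z := by
  have h := (ZMod.unitOfCoprime m hm).mulLeft_bijective
  convert h using 2 with z
  rw [nsmul_eq_mul, ZMod.coe_unitOfCoprime]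

end Primes

section GreenTaoTheorem

variable {k : ℕ}

/-- The sieve measure restricted to the representatives in the lower half that give a prime
exceeding `R`. -/
noncomputable def primeWeight (w R W b H : ℕ) {N : ℕ} (x : ZMod N) : ℝ :=
  if x.val ∈ primesInProgression R W b H then sieveMeasure w R W b x else 0

theorem sieveMeasure_eq_of_mem {w R W b H N : ℕ} (hR : 1 ≤ R) {x : ZMod N}
    (hx : x.val ∈ primesInProgression R W b H) : sieveMeasure w R W b x = sieveNorm w R := by
  obtain ⟨-, hq, hRq⟩ := Finset.mem_filter.mp hx
  refine sieveMeasure_eq hR fun p hp hpR hdvd => ?_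
  have := (Nat.prime_dvd_prime_iff_eq hp hq).mp hdvd
  omega

theorem le_avg_primeWeight {w R W b H N : ℕ} [NeZero N] (hR : 1 ≤ R) (hHN : H ≤ N) :
    sieveNorm w R * (primesInProgression R W b H).card / N ≤
      avg fun x : ZMod N => primeWeight w R W b H x := by
  have hV : 0 ≤ sieveNorm w R := zero_le_one.trans (one_le_sieveNorm hR)
  rw [avg_eq_sum_div, Nat.card_zmod]
  refine div_le_div_of_nonneg_right ?_ (Nat.cast_nonneg N)
  have h1 : ∀ x : ZMod N, primeWeight w R W b H x =
      if x.val ∈ primesInProgression R W b H then sieveNorm w R else 0 := fun x => by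
    rw [primeWeight]
    split_ifs with hx
    · exact sieveMeasure_eq_of_mem hR hx
    · rfl
  rw [Finset.sum_congr rfl fun x _ => h1 x, ← Finset.sum_filter, Finset.sum_const, nsmul_eq_mul,
    mul_comm]
  refine mul_le_mul_of_nonneg_right ?_ hV
  rw [Nat.cast_le]
  have hval : ∀ x ∈ primesInProgression R W b H, ((x : ZMod N)).val = x := fun x hx =>
    ZMod.val_cast_of_lt ((Finset.mem_range.mp (Finset.mem_filter.mp hx).1).trans_le hHN)
  refine Finset.card_le_card_of_injOn (fun x => (x : ZMod N)) (fun x hx => ?_)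
    fun x hx x' hx' h => ?_
  · refine Finset.mem_filter.mpr ⟨Finset.mem_univ _, ?_⟩
    rw [hval x hx]
    exact hx
  · have h' : (x : ZMod N) = x' := h
    rw [← hval x hx, ← hval x' hx', h']

theorem exists_prime_progression_of_lt_avg {w R W b N : ℕ} [NeZero N] (hk : 2 ≤ k) (hR : 1 ≤ R)
    (hW : 0 < W) (h : (R : ℝ) ^ k / N <
      avg fun v : Fin k → ZMod N => ∏ j, primeWeight w R W b (N / 2) (apForm (ZMod N) j v)) :
    ∃ a d : ℕ, 0 < d ∧ ∀ i < k, (a + i * d).Prime := by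
  by_contra! hno
  have hV : 0 ≤ sieveNorm w R := zero_le_one.trans (one_le_sieveNorm hR)
  have hle : ∀ x : ZMod N, 0 ≤ primeWeight w R W b (N / 2) x ∧
      primeWeight w R W b (N / 2) x ≤ R := fun x => by
    rw [primeWeight]
    split_ifs with hx
    · rw [sieveMeasure_eq_of_mem hR hx]
      exact ⟨hV, sieveNorm_le⟩
    · exact ⟨le_rfl, Nat.cast_nonneg R⟩
  rw [avg_prod_apForm hk] at h
  refine h.not_ge ?_
  calc _ ≤ avg fun p : ZMod N × ZMod N => (R : ℝ) ^ k * if p.2 = 0 then 1 else 0 := by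
        refine avg_mono fun p => ?_
        split_ifs with hp
        · refine (Finset.prod_le_prod (fun j _ => (hle _).1) fun j _ => (hle _).2).trans_eq ?_
          simp
        · rw [mul_zero]
          by_contra! hpos
          have hmem : ∀ j < k,
              (p.1 + j • p.2).val ∈ primesInProgression R W b (N / 2) := fun j hj => by
            by_contra hj'
            refine hpos.ne' (Finset.prod_eq_zero (Finset.mem_univ (⟨j, hj⟩ : Fin k)) ?_)
            exact if_neg hj'
          obtain ⟨a, e, he, hae⟩ := exists_val_eq_add_mul (x := p.1) hk hp fun j hj => by
            have := Finset.mem_range.mp (Finset.mem_filter.mp (hmem j hj)).1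
            omega
          obtain ⟨i, hi, hi'⟩ := hno (W * a + b) (W * e) (Nat.mul_pos hW he)
          obtain ⟨j, hj, hj'⟩ := hae i hi
          have h1 := (Finset.mem_filter.mp (hmem j hj)).2.1
          rw [hj'] at h1
          refine hi' ?_
          convert h1 using 1
          ring
    _ = _ := by
        rw [avg_const_mul, avg_prod]
        simp only [avg_single, Nat.card_zmod, avg_const]
        ring

/-- The **Green–Tao theorem**. -/
theorem exists_prime_progression (hk : 2 ≤ k) :
    ∃ a d : ℕ, 0 < d ∧ ∀ i < k, (a + i * d).Prime := by
  set K := k * 2 ^ k with hK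
  have hkK : k ≤ K := Nat.le_mul_of_pos_right k (by positivity)
  set A := 4 * K + 1 with hA
  obtain ⟨ε, hε, c, hc, hrel⟩ := relative_szemeredi hk (δ := 1 / (64 * (A : ℝ))) (by positivity)
  obtain ⟨w, hwk, hw⟩ : ∃ w : ℕ, k ≤ w ∧ Real.exp (32 ^ K / w) - 1 ≤ ε / 2 := by
    have h1 : Filter.Tendsto (fun w : ℕ => Real.exp ((32 : ℝ) ^ K / w) - 1) Filter.atTop
        (nhds (Real.exp 0 - 1)) :=
      ((Real.continuous_exp.tendsto 0).comp
        (tendsto_const_div_atTop_nhds_zero_nat _)).sub_const 1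
    rw [Real.exp_zero, sub_self] at h1
    obtain ⟨w, h2, h3⟩ := ((h1.eventually_lt_const (half_pos hε)).and
      (Filter.eventually_ge_atTop k)).exists
    exact ⟨w, h3, h2.le⟩
  set W := w.factorial with hWdef
  have hW0 : 0 < W := w.factorial_pos
  have hWp : ∀ p : ℕ, p.Prime → (p ∣ W ↔ p ≤ w) := fun p hp => hp.dvd_factorial
  set C : ℝ := 2 * (k * 2 ^ k) * (2 * k * k) with hC
  have hR : ∀ᶠ R : ℕ in Filter.atTop, (1 : ℝ) / (64 * A) ≤
      Real.log (R + 1) * (((W * (R ^ A / 2) - 1).primeCounting : ℝ) - R) / (W * (R ^ A : ℕ)) ∧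
      C / R ≤ ε / 2 ∧ (1 : ℝ) / R < c ∧ max w 2 ≤ R :=
    (eventually_le_log_mul_primeCounting (by omega) hW0).and <|
      (((tendsto_const_div_atTop_nhds_zero_nat C).eventually_lt_const (half_pos hε)).mono
        fun R h => h.le).and <|
      ((tendsto_const_div_atTop_nhds_zero_nat 1).eventually_lt_const hc).and <|
      Filter.eventually_ge_atTop _
  have htend : Filter.Tendsto (fun s : ℕ => k.factorial * s + 1) Filter.atTop Filter.atTop :=
    Filter.tendsto_atTop_mono (fun s => by
      have := Nat.le_mul_of_pos_left s k.factorial_pos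
      simp only [id_eq]
      omega) Filter.tendsto_id
  obtain ⟨s, hdens, herr, hdeg, hwR⟩ := (htend.eventually hR).exists
  set R := k.factorial * s + 1 with hRdef
  have hR1 : 1 ≤ R := by omega
  have hR0 : (0 : ℝ) < R := by exact_mod_cast hR1
  set N := R ^ A with hN
  have hN0 : N ≠ 0 := by positivity
  have : NeZero N := ⟨hN0⟩
  have hN2 : 2 ≤ N := by
    have h1 : R ^ 1 ≤ R ^ A := Nat.pow_le_pow_right hR1 (by omega)
    rw [pow_one] at h1
    omega
  have hcop : ∀ m : ℕ, 0 < m → m < k → m.Coprime N := fun m hm hmk => by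
    refine Nat.Coprime.pow_right A ?_
    obtain ⟨u, hu⟩ := Nat.dvd_factorial hm hmk.le
    rw [hRdef, hu, mul_assoc, Nat.coprime_mul_left_add_right]
    exact Nat.coprime_one_right m
  obtain ⟨b, hb⟩ := exists_le_card_primesInProgression (R := R) (H := N / 2) hW0 (by omega)
    fun p hp hpW => ((hWp p hp).mp hpW).trans (by omega)
  have hlin : LinForms (fun (j : Fin k) v => sieveMeasure w R W b (apForm (ZMod N) j v)) ε := by
    refine linForms_sieveMeasure hk hwk hR1 (fun p hp hpW => ?_) hcop hw ?_
    · have h1 := (hWp p (prime_of_mem_sievePrimes hp)).mp hpW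
      have h2 := (Finset.mem_Ioc.mp (Finset.mem_filter.mp hp).1).1
      omega
    · refine le_trans (le_of_eq ?_) herr
      rw [hN, Nat.cast_pow, hA, pow_succ, ← hK, hC]
      field_simp
  have hV := one_le_sieveNorm (w := w) hR1
  have havg : (1 : ℝ) / (64 * A) ≤
      avg fun x : ZMod N => primeWeight w R W b (N / 2) x := by
    refine hdens.trans (le_trans ?_ (le_avg_primeWeight hR1 (Nat.div_le_self N 2)))
    have hNr : (0 : ℝ) < N := by positivity
    have hWr : (0 : ℝ) < W := by positivity
    have hφ : (0 : ℝ) < W.totient := by exact_mod_cast Nat.totient_pos.mpr hW0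
    rw [← div_div]
    refine div_le_div_of_nonneg_right ?_ hNr.le
    rw [div_le_iff₀ hWr]
    rw [div_le_iff₀ hφ] at hb
    have hlog := log_le_mul_sieveNorm (R := R) hW0.ne' hWp
    have hlog0 : 0 ≤ Real.log (R + 1) := Real.log_nonneg (by linarith)
    calc _ ≤ Real.log (R + 1) * ((primesInProgression R W b (N / 2)).card * W.totient) :=
          mul_le_mul_of_nonneg_left hb hlog0
      _ ≤ (W / W.totient * sieveNorm w R) *
            ((primesInProgression R W b (N / 2)).card * W.totient) :=
          mul_le_mul_of_nonneg_right hlog (by positivity)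
      _ = _ := by field_simp
  have hmain := hrel (ZMod N) (sieveMeasure w R W b) (primeWeight w R W b (N / 2))
    (fun m hm hmk => bijective_nsmul_zmod (hcop m hm hmk)) (sieveMeasure_nonneg hR1) hlin
    (fun x => by
      rw [primeWeight]
      split_ifs
      exacts [sieveMeasure_nonneg hR1 x, le_rfl])
    (fun x => by
      rw [primeWeight]
      split_ifs
      exacts [le_rfl, sieveMeasure_nonneg hR1 x]) havg
  refine exists_prime_progression_of_lt_avg hk hR1 hW0 (lt_of_lt_of_le ?_ hmain)
  refine lt_of_le_of_lt ?_ hdeg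
  have hNr : (0 : ℝ) < N := by positivity
  rw [div_le_div_iff₀ hNr hR0, one_mul, ← pow_succ, hN, Nat.cast_pow]
  exact pow_le_pow_right₀ (by exact_mod_cast hR1) (by omega)

end GreenTaoTheorem

section PathColoring

/-- An arithmetic progression of labels gives a monochromatic path. -/
theorem hits_pathGraph_of_labels {V : Type*} {t a d : ℕ} (hd : 0 < d) (f : V → ℕ)
    (h : ∀ i ≤ t, ∃ v, f v = a + i * d) :
    Hits (pathGraph (t + 1)) (fun _ => d) (⊤ : SimpleGraph V) (distColoring f) := by
  choose g hg using fun i : Fin (t + 1) => h i (Nat.lt_succ_iff.mp i.2)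
  have hinj : Function.Injective g := fun i j hij => by
    have h1 := hg i
    rw [hij, hg j] at h1
    exact Fin.ext (Nat.eq_of_mul_eq_mul_right hd (by omega)).symm
  refine ⟨⟨g, hinj, fun {i j} hij => ?_⟩, fun e => ?_⟩
  · exact (top_adj _ _).mpr fun h1 => hij.ne (hinj h1)
  · obtain ⟨e, he⟩ := e
    induction e using Sym2.ind with
    | _ i j =>
      change Nat.dist (f (g i)) (f (g j)) = d
      rw [hg, hg]
      rcases pathGraph_adj.mp ((mem_edgeSet _).mp he) with h1 | h1
      · rw [← h1, Nat.dist_eq_sub_of_le (by gcongr; omega), Nat.add_mul]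
        omega
      · rw [← h1, Nat.dist_eq_sub_of_le_right (by gcongr; omega), Nat.add_mul]
        omega

/-- At most one prime of the allowed range is not a label. -/
theorem eq_of_forall_ne_label {s : ℕ} (f : Fin (s + 1) → ℕ) (hf : Function.Injective f)
    (himg : ∀ v, ∃ r ≤ s + 1, f v = Nat.nth Nat.Prime (1 + r)) {p q : ℕ} (hp : p.Prime)
    (hp2 : 2 < p) (hps : p ≤ s) (hq : q.Prime) (hq2 : 2 < q) (hqs : q ≤ s)
    (hpf : ∀ v, f v ≠ p) (hqf : ∀ v, f v ≠ q) : p = q := by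
  by_contra hpq
  let P : Finset ℕ := (Finset.range (s + 2)).image fun r => Nat.nth Nat.Prime (1 + r)
  have hmem : ∀ p : ℕ, p.Prime → 2 < p → p ≤ s → p ∈ P := fun p hp hp2 hps => by
    have h1 := Nat.nth_count hp
    have h2 : Nat.count Nat.Prime p ≤ p := Nat.count_le _
    have h3 : Nat.count Nat.Prime p ≠ 0 := fun h0 => by
      rw [h0, Nat.nth_prime_zero_eq_two] at h1
      omega
    refine Finset.mem_image.mpr ⟨Nat.count Nat.Prime p - 1, Finset.mem_range.mpr (by omega), ?_⟩
    rw [Nat.add_sub_cancel' (by omega), h1]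
  have hsub : insert p (insert q (Finset.univ.image f)) ⊆ P := by
    refine Finset.insert_subset (hmem p hp hp2 hps)
      (Finset.insert_subset (hmem q hq hq2 hqs) fun x hx => ?_)
    obtain ⟨v, -, rfl⟩ := Finset.mem_image.mp hx
    obtain ⟨r, hr, hvr⟩ := himg v
    exact Finset.mem_image.mpr ⟨r, Finset.mem_range.mpr (by omega), hvr.symm⟩
  have hcard := (Finset.card_le_card hsub).trans Finset.card_image_le
  rw [Finset.card_insert_of_notMem (by simp [hpq, hpf]),
    Finset.card_insert_of_notMem (by simp [hqf]), Finset.card_image_of_injective _ hf,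
    Finset.card_univ, Fintype.card_fin, Finset.card_range] at hcard
  omega

end PathColoring

end GreenTao

/-- Corollary of the Green–Tao theorem, in Ramseyian form.
Let `𝔾 = {K_{i+1}}_{i∈ℕ}` and `𝒮(1) = {S_i(1)}` with `S_i(1) = {d_{Θ[i,1]}}` the
singleton prime-distance coloring induced by a fixed injection
`Θ[i,1] : V(K_{i+1}) → ℕ` with image contained in `{p_1, …, p_{1+i+1}}` (with `p_r`
the `r`-th prime, `Nat.nth Nat.Prime`).  For fixed `t ∈ ℕ`, the symbol `(𝕏(t),𝒞(t))`
consists at level `i` of the copies `(P_t)_j` of the path graph with `t` edges indexed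
by the gaps `j` with `0 < j < i`, the copy `(P_t)_j` carrying the constant coloring with
value `j`.  Then the Ramsey number `R_{(𝔾,𝒮(1))}(𝕏(t),𝒞(t))` exists for every `t ∈ ℕ`. -/
theorem ramsey_green_tao
    (Θ : ∀ i : ℕ, Fin (i + 1) → ℕ)
    (hΘinj : ∀ i, Function.Injective (Θ i))
    (hΘimg : ∀ i v, ∃ r ≤ i + 1, Θ i v = Nat.nth Nat.Prime (1 + r))
    (t : ℕ) :
    ∃ n : ℕ, ∀ s, n ≤ s →
      ∀ ρ ∈ ({distColoring (G := (⊤ : SimpleGraph (Fin (s + 1)))) (Θ s)} :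
          Set ((⊤ : SimpleGraph (Fin (s + 1))).edgeSet → ℕ)),
        ∃ j : ℕ, (0 < j ∧ j < s) ∧
          Hits (SimpleGraph.pathGraph (t + 1)) (fun _ => j)
            (⊤ : SimpleGraph (Fin (s + 1))) ρ := by
  obtain ⟨a, d, hd, had⟩ := GreenTao.exists_prime_progression (k := 2 * t + 3) (by omega)
  have ha : 2 ≤ a := by
    have := (had 0 (by omega)).two_le
    omega
  refine ⟨a + (2 * t + 2) * d, fun s hs ρ hρ => ⟨d, ⟨hd, by nlinarith⟩, ?_⟩⟩
  rw [Set.mem_singleton_iff.mp hρ]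
  have hterm : ∀ i, 1 ≤ i → i ≤ 2 * t + 2 →
      (a + i * d).Prime ∧ 2 < a + i * d ∧ a + i * d ≤ s := fun i hi hi' => by
    refine ⟨had i (by omega), ?_, le_trans ?_ hs⟩
    · have := Nat.mul_pos hi hd
      omega
    · gcongr
  by_cases h1 : ∀ i ≤ t, ∃ v, Θ s v = (a + d) + i * d
  · exact GreenTao.hits_pathGraph_of_labels hd (Θ s) h1
  · refine GreenTao.hits_pathGraph_of_labels (a := a + (t + 2) * d) hd (Θ s) fun i hi => ?_
    by_contra! h2
    push Not at h1
    obtain ⟨j, hj, h1⟩ := h1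
    rw [show a + d + j * d = a + (j + 1) * d by ring] at h1
    rw [show a + (t + 2) * d + i * d = a + (t + 2 + i) * d by ring] at h2
    obtain ⟨hp, hp2, hps⟩ := hterm (j + 1) (by omega) (by omega)
    obtain ⟨hq, hq2, hqs⟩ := hterm (t + 2 + i) (by omega) (by omega)
    have h3 := GreenTao.eq_of_forall_ne_label (Θ s) (hΘinj s) (hΘimg s) hp hp2 hps hq hq2 hqs h1 h2
    have h4 := Nat.eq_of_mul_eq_mul_right hd (Nat.add_left_cancel h3)
    omega

end RamseyGen
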